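/- arXiv:2201.07550 — 2 statements merged into one kernel-verified Lean document; each statement's English description precedes it below -/
import Mathlib

section
/- Let K be an algebraically closed field of characteristic 0, S = K[x₀,…,x₄], and let I ⊆ S be an ideal generated by a regular sequence of five homogeneous polynomials of degree 2. Set R = S/I, a graded Artinian Gorenstein algebra with socle in degree 5. Then R satisfies the strong Lefschetz property: there exists x ∈ R¹ such that both multiplication maps x³· : R¹ → R⁴ and x· : R² → R³ are isomorphisms of K-vector spaces. -/
/-- The degree-`i` graded piece of the quotient `R = S/I` of a polynomial ring by a
homogeneous ideal: the image of the homogeneous polynomials of degree `i` under the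
quotient map. -/
noncomputable def gradedPiece {K : Type*} [Field K] {n : ℕ}
    (I : Ideal (MvPolynomial (Fin n) K)) (i : ℕ) :
    Submodule K (MvPolynomial (Fin n) K ⧸ I) :=
  (MvPolynomial.homogeneousSubmodule (Fin n) K i).map (Ideal.Quotient.mkₐ K I).toLinearMap

open MvPolynomial

section HomogeneousPart

variable {E σ : Type*} [CommRing E]

/-- The homogeneous part of integral degree `n`, which vanishes when `n` is negative. -/
noncomputable def homPart (n : ℤ) : MvPolynomial σ E →ₗ[E] MvPolynomial σ E :=
  if 0 ≤ n then homogeneousComponent n.toNat else 0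

lemma homPart_of_isHomogeneous {p : MvPolynomial σ E} {e : ℕ} (hp : p.IsHomogeneous e) (n : ℤ) :
    homPart n p = if n = e then p else 0 := by
  unfold homPart
  split_ifs with h1 h2 h2
  · rw [homogeneousComponent_of_mem (n := e) hp, if_pos (by omega)]
  · rw [homogeneousComponent_of_mem (n := e) hp, if_neg (by omega)]
  · omega
  · rfl

lemma homPart_of_neg {n : ℤ} (hn : n < 0) (p : MvPolynomial σ E) : homPart n p = 0 := by
  simp [homPart, not_le.2 hn]

lemma homPart_homPart (n : ℤ) (p : MvPolynomial σ E) : homPart n (homPart n p) = homPart n p := by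
  by_cases h : 0 ≤ n
  · have : (homPart n p).IsHomogeneous n.toNat := by
      simp only [homPart, if_pos h]
      exact homogeneousComponent_isHomogeneous _ _
    rw [homPart_of_isHomogeneous this, if_pos (by omega)]
  · simp [homPart, h]

lemma homPart_mul {f : MvPolynomial σ E} {k : ℕ} (hf : f.IsHomogeneous k) (n : ℤ)
    (p : MvPolynomial σ E) : homPart n (f * p) = f * homPart (n - k) p := by
  conv_lhs => rw [← sum_homogeneousComponent p]
  conv_rhs => rw [← sum_homogeneousComponent p]
  simp only [Finset.mul_sum, map_sum]
  refine Finset.sum_congr rfl fun i _ => ?_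
  have hi := homogeneousComponent_isHomogeneous i p
  rw [homPart_of_isHomogeneous (hf.mul hi), homPart_of_isHomogeneous hi]
  have : n = ((k + i : ℕ) : ℤ) ↔ n - k = i := by push_cast; omega
  simp only [this]
  split_ifs <;> simp

end HomogeneousPart

section InitialIdeal

variable {S : Type*} [CommRing S]

/-- The ideal generated by the first `m` terms of a sequence. -/
def initialIdeal (f : ℕ → S) (m : ℕ) : Ideal S := Ideal.span (f '' Set.Iio m)

lemma initialIdeal_zero (f : ℕ → S) : initialIdeal f 0 = ⊥ := by
  simp [initialIdeal]

lemma initialIdeal_succ (f : ℕ → S) (m : ℕ) :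
    initialIdeal f (m + 1) = initialIdeal f m ⊔ Ideal.span {f m} := by
  have : Set.Iio (m + 1) = insert m (Set.Iio m) := by ext; simp
  rw [initialIdeal, this, Set.image_insert_eq, Ideal.span_insert, sup_comm, initialIdeal]

lemma mem_initialIdeal_succ {f : ℕ → S} {m : ℕ} {p : S} :
    p ∈ initialIdeal f (m + 1) ↔ ∃ a, p - f m * a ∈ initialIdeal f m := by
  rw [initialIdeal_succ]
  constructor
  · intro h
    obtain ⟨y, hy, z, hz, rfl⟩ := Submodule.mem_sup.1 h
    obtain ⟨a, rfl⟩ := Ideal.mem_span_singleton'.1 hz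
    exact ⟨a, by simpa [mul_comm a] using hy⟩
  · rintro ⟨a, ha⟩
    have := Submodule.add_mem_sup ha (Ideal.mem_span_singleton'.2 ⟨a, mul_comm a (f m)⟩)
    simpa using this

lemma initialIdeal_le_succ (f : ℕ → S) (m : ℕ) : initialIdeal f m ≤ initialIdeal f (m + 1) := by
  rw [initialIdeal_succ]; exact le_sup_left

/-- The first `m` terms of `f` form a weakly regular sequence. -/
def IsRegularUpTo (f : ℕ → S) (m : ℕ) : Prop :=
  ∀ k < m, ∀ p, f k * p ∈ initialIdeal f k → p ∈ initialIdeal f k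

end InitialIdeal

section HomogeneousInitialIdeal

variable {E σ : Type*} [CommRing E]

lemma homPart_mem_initialIdeal {f : ℕ → MvPolynomial σ E} {m k : ℕ}
    (hf : ∀ i < m, (f i).IsHomogeneous k) (n : ℤ) {p : MvPolynomial σ E}
    (hp : p ∈ initialIdeal f m) : homPart n p ∈ initialIdeal f m := by
  induction m generalizing p with
  | zero => simp_all [initialIdeal_zero]
  | succ m ih =>
    obtain ⟨a, ha⟩ := mem_initialIdeal_succ.1 hp
    have := ih (fun i hi => hf i (by omega)) ha
    rw [map_sub, homPart_mul (hf m (by omega))] at this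
    exact mem_initialIdeal_succ.2 ⟨_, this⟩

end HomogeneousInitialIdeal

section Koszul

variable {E σ : Type*} [CommRing E]

/-- A graded model of the Koszul complex of the linear forms `l 0, …, l (u - 1)`. -/
structure KoszulModel (l : ℕ → MvPolynomial σ E) (u : ℕ) where
  ι : Type
  deg : ι → ℕ
  top : ι
  d : (ι → MvPolynomial σ E) →ₗ[MvPolynomial σ E] (ι → MvPolynomial σ E)
  deg_top : deg top = u
  d_d : ∀ z, d (d z) = 0
  d_mem : ∀ (J : Ideal (MvPolynomial σ E)) (z), (∀ s, z s ∈ J) → ∀ s, d z s ∈ J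
  d_homPart : ∀ (g : ℤ) (z),
    d (fun s => homPart (g + deg s) (z s)) = fun s => homPart (g + 2 + deg s) (d z s)
  d_of_deg_zero : ∀ z, (∀ s, deg s ≠ 0 → z s = 0) → d z = 0
  d_mem_initialIdeal : ∀ z s, deg s = 0 → d z s ∈ initialIdeal l u
  exact : ∀ z, d z = 0 → (∀ s, deg s = 0 → z s ∈ initialIdeal l u) → ∃ w, d w = z
  d_top : ∀ z, d z top = 0
  d_mem_of_mul_mem : ∀ (J : Ideal (MvPolynomial σ E)) (z), (∀ s, s ≠ top → z s = 0) →
    (∀ j < u, l j * z top ∈ J) → ∀ s, d z s ∈ J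

/-- The Koszul complex of the empty sequence. -/
noncomputable def KoszulModel.zero (l : ℕ → MvPolynomial σ E) : KoszulModel l 0 where
  ι := Unit
  deg _ := 0
  top := ()
  d := 0
  deg_top := rfl
  d_d _ := rfl
  d_mem _ _ _ _ := by simp
  d_homPart g z := by ext1; simp
  d_of_deg_zero _ _ := rfl
  d_mem_initialIdeal _ _ _ := by simp
  exact z _ h := ⟨0, by ext1 s; simpa [initialIdeal_zero, eq_comm] using h s rfl⟩
  d_top _ := rfl
  d_mem_of_mul_mem _ _ _ _ _ := by simp

/-- Adding a linear form to the Koszul complex by a mapping cone. -/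
noncomputable def KoszulModel.cone {l : ℕ → MvPolynomial σ E} {u : ℕ} (C : KoszulModel l u)
    (hl : (l u).IsHomogeneous 1)
    (hreg : ∀ p, l u * p ∈ initialIdeal l u → p ∈ initialIdeal l u) : KoszulModel l (u + 1) where
  ι := C.ι ⊕ C.ι
  deg := Sum.elim C.deg (fun s => C.deg s + 1)
  top := Sum.inr C.top
  d :=
    { toFun := fun z => Sum.elim (C.d (fun s => z (Sum.inl s)) + l u • fun s => z (Sum.inr s))
        (- C.d (fun s => z (Sum.inr s)))
      map_add' := by
        intro x y
        have h1 := C.d.map_add (fun s => x (Sum.inl s)) (fun s => y (Sum.inl s))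
        have h2 := C.d.map_add (fun s => x (Sum.inr s)) (fun s => y (Sum.inr s))
        ext1 (s | s)
        · have := congrFun h1 s
          simp only [Pi.add_def, Sum.elim_inl, Pi.smul_apply, smul_eq_mul] at this ⊢
          rw [this]; ring
        · have := congrFun h2 s
          simp only [Pi.add_def, Sum.elim_inr, Pi.neg_apply] at this ⊢
          rw [this]; ring
      map_smul' := by
        intro c x
        have h1 := C.d.map_smul c (fun s => x (Sum.inl s))
        have h2 := C.d.map_smul c (fun s => x (Sum.inr s))
        ext1 (s | s)
        · have := congrFun h1 s
          simp only [Pi.smul_def, Pi.add_def, Sum.elim_inl, smul_eq_mul, RingHom.id_apply] at this ⊢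
          rw [this]; ring
        · have := congrFun h2 s
          simp only [Pi.smul_def, Sum.elim_inr, Pi.neg_apply, smul_eq_mul,
            RingHom.id_apply] at this ⊢
          rw [this]; ring }
  deg_top := by simp [C.deg_top]
  d_d z := by
    ext1 (s | s)
    · have h1 := C.d_d (fun s => z (Sum.inl s))
      have h2 : C.d (C.d (fun s => z (Sum.inl s)) + l u • fun s => z (Sum.inr s)) =
          l u • C.d (fun s => z (Sum.inr s)) := by rw [map_add, map_smul, h1, zero_add]
      have := congrFun h2 s
      simp only [LinearMap.coe_mk, AddHom.coe_mk, Sum.elim_inl, Sum.elim_inr, Pi.add_apply,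
        Pi.smul_apply, smul_eq_mul, Pi.zero_apply, Pi.neg_apply, mul_neg] at this ⊢
      rw [← sub_eq_add_neg, sub_eq_zero, ← this]
      rfl
    · have h : C.d (-C.d (fun s => z (Sum.inr s))) = 0 := by rw [map_neg, C.d_d, neg_zero]
      exact neg_eq_zero.2 (congrFun h s)
  d_mem J z hz := by
    rintro (s | s)
    · exact J.add_mem (C.d_mem J _ (fun s => hz _) s) (J.mul_mem_left _ (hz _))
    · exact J.neg_mem (C.d_mem J _ (fun s => hz _) s)
  d_homPart g z := by
    have h1 := C.d_homPart g (fun s => z (Sum.inl s))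
    have h2 := C.d_homPart (g + 1) (fun s => z (Sum.inr s))
    ext1 (s | s)
    · have := congrFun h1 s
      simp only [LinearMap.coe_mk, AddHom.coe_mk, Sum.elim_inl, Sum.elim_inr, Pi.add_apply,
        Pi.smul_apply, smul_eq_mul, map_add, homPart_mul hl] at this ⊢
      rw [this]
      congr 3
      push_cast; ring_nf
    · have := congrFun h2 s
      simp only [LinearMap.coe_mk, AddHom.coe_mk, Sum.elim_inr, Pi.neg_apply, map_neg] at this ⊢
      have e (s) : g + ((C.deg s + 1 : ℕ) : ℤ) = g + 1 + C.deg s := by push_cast; ring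
      have e' (s) : g + 2 + ((C.deg s + 1 : ℕ) : ℤ) = g + 1 + 2 + C.deg s := by push_cast; ring
      simp only [e, e', this]
  d_of_deg_zero z hz := by
    have h2 : (fun s => z (Sum.inr s)) = 0 := by ext1 s; exact hz (Sum.inr s) (by simp)
    have h1 : C.d (fun s => z (Sum.inl s)) = 0 := C.d_of_deg_zero _ fun s hs => hz (Sum.inl s) hs
    ext1 (s | s) <;> simp [h1, h2]
  d_mem_initialIdeal z := by
    rintro (s | s) hs
    · exact Ideal.add_mem _ (initialIdeal_le_succ l u (C.d_mem_initialIdeal _ s hs))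
        (Ideal.mul_mem_right _ _ (Ideal.subset_span ⟨u, by simp, rfl⟩))
    · simp at hs
  exact z hz h0 := by
    have hb : C.d (fun s => z (Sum.inr s)) = 0 := by
      ext1 s
      have := congrFun hz (Sum.inr s)
      simpa using this
    have ha : C.d (fun s => z (Sum.inl s)) + l u • (fun s => z (Sum.inr s)) = 0 := by
      ext1 s
      exact congrFun hz (Sum.inl s)
    have hb0 (s) (hs : C.deg s = 0) : z (Sum.inr s) ∈ initialIdeal l u := by
      apply hreg
      have h1 := congrFun ha s
      simp only [Pi.add_apply, Pi.smul_apply, smul_eq_mul, Pi.zero_apply] at h1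
      rw [eq_neg_of_add_eq_zero_right h1]
      exact neg_mem (C.d_mem_initialIdeal _ s hs)
    obtain ⟨b, hb⟩ := C.exact _ hb hb0
    have hc (s) : ∃ c, C.deg s = 0 → z (Sum.inl s) - l u * c ∈ initialIdeal l u := by
      by_cases hs : C.deg s = 0
      · obtain ⟨c, hc⟩ := mem_initialIdeal_succ.1 (h0 (Sum.inl s) hs)
        exact ⟨c, fun _ => hc⟩
      · exact ⟨0, fun h => absurd h hs⟩
    choose c hc using hc
    set t : C.ι → MvPolynomial σ E := fun s => if C.deg s = 0 then c s + b s else 0 with ht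
    have hdt : C.d t = 0 := C.d_of_deg_zero _ fun s hs => by simp [ht, hs]
    have hdb : C.d (b - t) = fun s => z (Sum.inr s) := by rw [map_sub, hdt, sub_zero, hb]
    obtain ⟨a, ha'⟩ := C.exact ((fun s => z (Sum.inl s)) + l u • (b - t))
      (by rw [map_add, map_smul, hdb, ha]) (by
        intro s hs
        have := hc s hs
        simp only [Pi.add_apply, Pi.smul_apply, Pi.sub_apply, smul_eq_mul, ht, if_pos hs]
        convert! this using 1; ring)
    refine ⟨Sum.elim a (-(b - t)), ?_⟩
    ext1 (s | s)
    · have e : (fun s => -(b - t) s) = -(b - t) := rfl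
      simp only [LinearMap.coe_mk, AddHom.coe_mk, Sum.elim_inl, Sum.elim_inr]
      rw [show (fun s => a s) = a from rfl, show (fun s => (-(b - t)) s) = -(b - t) from rfl, ha']
      simp only [Pi.add_apply, Pi.smul_apply, Pi.neg_apply, smul_eq_mul]
      ring
    · simp only [LinearMap.coe_mk, AddHom.coe_mk, Sum.elim_inr]
      rw [show (fun s => (-(b - t)) s) = -(b - t) from rfl, map_neg, hdb, neg_neg]
  d_top z := by simp [C.d_top]
  d_mem_of_mul_mem J z hz h := by
    have h1 : (fun s => z (Sum.inl s)) = 0 := by ext1 s; exact hz _ (by simp)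
    rintro (s | s)
    · simp only [LinearMap.coe_mk, AddHom.coe_mk, Sum.elim_inl, h1, map_zero, zero_add,
        Pi.smul_apply, smul_eq_mul]
      by_cases hs : s = C.top
      · subst hs; exact h u (by omega)
      · rw [hz (Sum.inr s) (by simpa using hs), mul_zero]; exact J.zero_mem
    · refine J.neg_mem (C.d_mem_of_mul_mem J _ (fun s hs => hz _ (by simpa using hs))
        (fun j hj => h j (by omega)) s)

lemma exists_koszulModel {l : ℕ → MvPolynomial σ E} {u : ℕ}
    (hl : ∀ k < u, (l k).IsHomogeneous 1) (hreg : IsRegularUpTo l u) :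
    Nonempty (KoszulModel l u) := by
  induction u with
  | zero => exact ⟨.zero l⟩
  | succ u ih =>
    obtain ⟨C⟩ := ih (fun k hk => hl k (by omega)) (fun k hk => hreg k (by omega))
    exact ⟨C.cone (hl u (by omega)) (hreg u (by omega))⟩

/-- Vanishing of the Koszul homology of a complete intersection of quadrics
in degrees below the quadratic strand. -/
lemma KoszulModel.exists_sub_d_mem {l f : ℕ → MvPolynomial σ E} {u m : ℕ} (C : KoszulModel l u)
    (hf : ∀ k < m, (f k).IsHomogeneous 2) (hreg : IsRegularUpTo f m) {g : ℤ} (hg : g < 0)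
    (z : C.ι → MvPolynomial σ E) (hz : ∀ s, homPart (g + C.deg s) (z s) = z s)
    (hdz : ∀ s, C.d z s ∈ initialIdeal f m) :
    ∃ w : C.ι → MvPolynomial σ E, (∀ s, homPart (g - 2 + C.deg s) (w s) = w s) ∧
      ∀ s, z s - C.d w s ∈ initialIdeal f m := by
  induction m generalizing z with
  | zero =>
    simp only [initialIdeal_zero, Ideal.mem_bot] at hdz ⊢
    obtain ⟨w, hw⟩ := C.exact z (funext hdz) fun s hs => by
      rw [← hz s, hs, homPart_of_neg (by simpa using hg)]; exact Ideal.zero_mem _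
    refine ⟨fun s => homPart (g - 2 + C.deg s) (w s), fun s => homPart_homPart _ _, fun s => ?_⟩
    rw [C.d_homPart, hw, sub_eq_zero]
    simp [hz]
  | succ m ih =>
    have ih := ih (fun k hk => hf k (by omega)) (fun k hk => hreg k (by omega))
    have hfm := hf m (by omega)
    choose w hw using fun s => mem_initialIdeal_succ.1 (hdz s)
    set v : C.ι → MvPolynomial σ E := fun s => homPart (g + C.deg s) (w s) with hv
    have hdv (s) : C.d z s - f m * v s ∈ initialIdeal f m := by
      have h1 := congrFun (C.d_homPart g z) s
      simp only [hz] at h1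
      have h2 := homPart_mem_initialIdeal (fun k hk => hf k (by omega)) (g + 2 + C.deg s) (hw s)
      rw [map_sub, homPart_mul hfm, ← h1] at h2
      convert! h2 using 4
      push_cast; ring_nf
    have hCdv (s) : C.d v s ∈ initialIdeal f m := by
      apply hreg m (by omega)
      have h := C.d_mem _ _ hdv s
      have e : (fun s => C.d z s - f m * v s) = C.d z - f m • v := rfl
      rw [e, map_sub, C.d_d, map_smul, zero_sub] at h
      simpa using h
    obtain ⟨v', hv', hvv'⟩ := ih v (fun s => homPart_homPart _ _) hCdv
    obtain ⟨w', hw', hww'⟩ := ih (z - f m • v') (fun s => by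
        have e : g + (C.deg s : ℤ) - (2 : ℕ) = g - 2 + C.deg s := by push_cast; ring
        rw [Pi.sub_apply, Pi.smul_apply, smul_eq_mul, map_sub, homPart_mul hfm, e, hz, hv'])
        (fun s => by
        rw [map_sub, map_smul]
        have := Ideal.add_mem _ (hdv s) (Ideal.mul_mem_left _ (f m) (hvv' s))
        convert! this using 1
        simp only [Pi.sub_apply, Pi.smul_apply, smul_eq_mul]; ring)
    refine ⟨w', hw', fun s => mem_initialIdeal_succ.2 ⟨v' s, ?_⟩⟩
    convert! hww' s using 1
    simp only [Pi.sub_apply, Pi.smul_apply, smul_eq_mul]; ring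

/-- A form of degree `i` outside an ideal generated by a regular sequence of quadrics cannot be
multiplied into that ideal by a regular sequence of more than `i` linear forms. -/
lemma mem_initialIdeal_of_mul_mem {l f : ℕ → MvPolynomial σ E} {u m i : ℕ}
    (hl : ∀ k < u, (l k).IsHomogeneous 1) (hlreg : IsRegularUpTo l u)
    (hf : ∀ k < m, (f k).IsHomogeneous 2) (hreg : IsRegularUpTo f m)
    {a : MvPolynomial σ E} (ha : a.IsHomogeneous i) (hiu : i < u)
    (h : ∀ j < u, l j * a ∈ initialIdeal f m) : a ∈ initialIdeal f m := by
  classical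
  obtain ⟨C⟩ := exists_koszulModel hl hlreg
  obtain ⟨w, -, hw⟩ := C.exists_sub_d_mem hf hreg (g := i - u) (by omega) (Pi.single C.top a)
    (fun s => by
      by_cases hs : s = C.top
      · subst hs
        rw [Pi.single_eq_same, C.deg_top, homPart_of_isHomogeneous ha, if_pos (sub_add_cancel _ _)]
      · simp [Pi.single_eq_of_ne hs])
    (C.d_mem_of_mul_mem _ _ (fun s hs => Pi.single_eq_of_ne hs _) (by simpa using h))
  simpa [C.d_top] using hw C.top

end Koszul

section LinearForms

variable {E σ : Type*} [Field E] [Fintype σ]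

/-- The linear form with given coefficients. -/
noncomputable def linForm : (σ → E) →ₗ[E] MvPolynomial σ E :=
  Fintype.linearCombination E (X : σ → MvPolynomial σ E)

lemma linForm_apply (c : σ → E) : linForm c = ∑ i, c i • (X i : MvPolynomial σ E) := rfl

lemma linForm_single [DecidableEq σ] (i : σ) :
    linForm (Pi.single i (1 : E)) = (X i : MvPolynomial σ E) := by
  simp [linForm]

lemma linForm_isHomogeneous (c : σ → E) : (linForm c).IsHomogeneous 1 := by
  rw [linForm_apply]
  refine IsHomogeneous.sum _ _ _ fun i _ => ?_
  rw [smul_eq_C_mul]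
  exact isHomogeneous_C_mul_X _ _

lemma coeff_linForm [DecidableEq σ] (c : σ → E) (i : σ) :
    coeff (Finsupp.single i 1) (linForm c) = c i := by
  simp [linForm_apply, coeff_sum, coeff_smul, coeff_X, Finsupp.single_left_inj, eq_comm]

lemma linForm_injective : Function.Injective (linForm : (σ → E) → MvPolynomial σ E) := by
  classical
  intro c d h
  ext i
  rw [← coeff_linForm c, h, coeff_linForm]

lemma exists_linForm_eq {p : MvPolynomial σ E} (hp : p.IsHomogeneous 1) :
    ∃ c, linForm c = p := by
  have : p ∈ homogeneousSubmodule σ E 1 := hp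
  rw [homogeneousSubmodule_one_eq_span_X, ← Fintype.range_linearCombination] at this
  exact this

/-- The ideal generated by a space of linear forms is prime, and its linear forms are the
given ones. -/
lemma exists_algHom_ker_eq_span_linForm (W : Submodule E (σ → E)) :
    ∃ φ : MvPolynomial σ E →ₐ[E] MvPolynomial σ E,
      (∀ p, φ p = 0 ↔ p ∈ Ideal.span (linForm '' (W : Set (σ → E)))) ∧
      ∀ c, φ (linForm c) = 0 ↔ c ∈ W := by
  classical
  obtain ⟨V, hV⟩ := Submodule.exists_isCompl W
  set π := V.projection W hV.symm with hπ
  set φ : MvPolynomial σ E →ₐ[E] MvPolynomial σ E :=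
    aeval fun i => linForm (π (Pi.single i 1)) with hφ
  have hlin (c : σ → E) : φ (linForm c) = linForm (π c) := by
    have : φ.toLinearMap ∘ₗ linForm = linForm ∘ₗ π := by
      refine LinearMap.pi_ext' fun i => LinearMap.ext_ring ?_
      simp [linForm_single, hφ]
    exact LinearMap.congr_fun this c
  have hker (c : σ → E) : φ (linForm c) = 0 ↔ c ∈ W := by
    rw [hlin, map_eq_zero_iff _ linForm_injective]
    simp [hπ]
  refine ⟨φ, fun p => ⟨fun h => ?_, fun h => ?_⟩, hker⟩
  · have key : p - φ p ∈ Ideal.span (linForm '' (W : Set (σ → E))) := by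
      clear h
      induction p using MvPolynomial.induction_on with
      | C a => simp [hφ]
      | add p q hp hq =>
        rw [map_add, add_sub_add_comm]
        exact Ideal.add_mem _ hp hq
      | mul_X p i hp =>
        have hX : X i - φ (X i) ∈ Ideal.span (linForm '' (W : Set (σ → E))) := by
          rw [← linForm_single, hlin, ← map_sub]
          refine Ideal.subset_span ⟨_, ?_, rfl⟩
          rw [SetLike.mem_coe, ← hker, map_sub, map_sub, hlin, hlin, hπ,
            Submodule.projection_apply_of_mem_left _ (Submodule.projection_apply_mem _ _), sub_self]
        have e : p * X i - φ (p * X i) = (p - φ p) * X i + φ p * (X i - φ (X i)) := by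
          rw [map_mul]; ring
        rw [e]
        exact Ideal.add_mem _ (Ideal.mul_mem_right _ _ hp) (Ideal.mul_mem_left _ _ hX)
    rwa [h, sub_zero] at key
  · have : Ideal.span (linForm '' (W : Set (σ → E))) ≤ RingHom.ker φ := by
      rw [Ideal.span_le]
      rintro _ ⟨c, hc, rfl⟩
      exact (hker c).2 hc
    exact this h

lemma isRegularUpTo_linForm {c : ℕ → σ → E} {u : ℕ}
    (hc : LinearIndependent E fun k : Fin u => c k) :
    IsRegularUpTo (fun k => linForm (c k)) u := by
  intro k hk p hp
  obtain ⟨φ, hφ, hlin⟩ := exists_algHom_ker_eq_span_linForm (Submodule.span E (c '' Set.Iio k))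
  have e : initialIdeal (fun k => linForm (c k)) k =
      Ideal.span (linForm '' (Submodule.span E (c '' Set.Iio k) : Set (σ → E))) := by
    refine le_antisymm (Ideal.span_mono ?_) (Ideal.span_le.2 ?_)
    · rintro _ ⟨j, hj, rfl⟩
      exact ⟨_, Submodule.subset_span ⟨j, hj, rfl⟩, rfl⟩
    · rintro _ ⟨d, hd, rfl⟩
      have : Submodule.span E (c '' Set.Iio k) ≤
          ((initialIdeal (fun k => linForm (c k)) k).restrictScalars E).comap linForm := by
        rw [Submodule.span_le]
        rintro _ ⟨j, hj, rfl⟩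
        exact Ideal.subset_span ⟨j, hj, rfl⟩
      exact this hd
  rw [e, ← hφ, map_mul, mul_eq_zero] at hp
  rw [e, ← hφ]
  refine hp.resolve_left fun h => ?_
  have := (hlin _).1 h
  have himg : c '' Set.Iio k = (fun k : Fin u => c k) '' {j | (j : ℕ) < k} := by
    ext x
    constructor
    · rintro ⟨j, hj, rfl⟩
      exact ⟨⟨j, lt_trans hj hk⟩, hj, rfl⟩
    · rintro ⟨j, hj, rfl⟩
      exact ⟨j, hj, rfl⟩
  rw [himg] at this
  exact hc.notMem_span_image (s := {j | (j : ℕ) < k}) (x := ⟨k, hk⟩) (by simp) this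

/-- In a complete intersection of quadrics, a nonzero form of degree `i` is annihilated by at most
`i` independent linear forms. -/
lemma finrank_le_of_linForm_mul_mem {f : ℕ → MvPolynomial σ E} {m i : ℕ}
    (hf : ∀ k < m, (f k).IsHomogeneous 2) (hreg : IsRegularUpTo f m)
    {a : MvPolynomial σ E} (ha : a.IsHomogeneous i) (ha0 : a ∉ initialIdeal f m)
    (W : Submodule E (σ → E)) (hW : ∀ c ∈ W, linForm c * a ∈ initialIdeal f m) :
    Module.finrank E W ≤ i := by
  by_contra! h
  set b := Module.finBasis E W
  set c : ℕ → σ → E := fun k => if h : k < Module.finrank E W then b ⟨k, h⟩ else 0 with hc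
  have hcW (k) : c k ∈ W := by
    simp only [hc]
    split_ifs
    exacts [Subtype.coe_prop _, W.zero_mem]
  refine ha0 (mem_initialIdeal_of_mul_mem (fun k _ => linForm_isHomogeneous (c k))
    (isRegularUpTo_linForm (u := Module.finrank E W) ?_) hf hreg ha h
    fun j _ => hW _ (hcW j))
  have : (fun k : Fin (Module.finrank E W) => c k) = W.subtype ∘ b := by
    ext1 k
    simp [hc]
  rw [this]
  exact b.linearIndependent.map' _ W.ker_subtype

end LinearForms

section HilbertFunction

variable {E σ : Type*} [Field E]

lemma finite_homogeneousSubmodule [Finite σ] (d : ℕ) :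
    Module.Finite E (homogeneousSubmodule σ E d) :=
  Module.Finite.iff_fg.2 (homogeneousSubmodule_fg _ _ d)

lemma finrank_homogeneousSubmodule [Fintype σ] (d : ℕ) :
    Module.finrank E (homogeneousSubmodule σ E d) = (Fintype.card σ + d - 1).choose d := by
  classical
  rw [homogeneousSubmodule_eq_finsupp_supported]
  have e := Module.finrank_eq_nat_card_basis
    (basisRestrictSupport E {m : σ →₀ ℕ | m.degree = d})
  rw [restrictSupport] at e
  rw [e, ← Finset.card_univ, ← Finset.card_finsuppAntidiag_nat_eq_choose]
  have : {m : σ →₀ ℕ | m.degree = d} = ↑(Finset.finsuppAntidiag (Finset.univ : Finset σ) d) := by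
    ext m
    simp [Finsupp.degree_eq_sum]
  rw [this, Nat.card_coe_set_eq, Set.ncard_coe_finset]

/-- The forms of degree `d` in the ideal generated by the first `m` terms of `f`. -/
noncomputable def idealPart (f : ℕ → MvPolynomial σ E) (m d : ℕ) :
    Submodule E (MvPolynomial σ E) :=
  (initialIdeal f m).restrictScalars E ⊓ homogeneousSubmodule σ E d

lemma mem_idealPart {f : ℕ → MvPolynomial σ E} {m d : ℕ} {p : MvPolynomial σ E} :
    p ∈ idealPart f m d ↔ p ∈ initialIdeal f m ∧ p.IsHomogeneous d := Iff.rfl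

lemma exists_sub_mul_mem {f : ℕ → MvPolynomial σ E} {m d : ℕ}
    (hf : ∀ k < m + 1, (f k).IsHomogeneous 2) {p : MvPolynomial σ E}
    (hp : p ∈ idealPart f (m + 1) d) :
    ∃ a, p - f m * homPart (d - 2) a ∈ initialIdeal f m := by
  obtain ⟨a, ha⟩ := mem_initialIdeal_succ.1 hp.1
  have h := homPart_mem_initialIdeal (fun k hk => hf k (by omega)) d ha
  rw [map_sub, homPart_mul (hf m (by omega)), homPart_of_isHomogeneous hp.2, if_pos rfl] at h
  exact ⟨a, h⟩

lemma idealPart_eq_bot {f : ℕ → MvPolynomial σ E} {m d : ℕ}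
    (hf : ∀ k < m, (f k).IsHomogeneous 2) (hd : d < 2 ∨ m = 0) : idealPart f m d = ⊥ := by
  induction m with
  | zero => simp [idealPart, initialIdeal_zero]
  | succ m ih =>
    have hd : d < 2 := by omega
    rw [eq_bot_iff, ← ih (fun k hk => hf k (by omega)) (.inl hd)]
    intro p hp
    refine ⟨?_, hp.2⟩
    obtain ⟨a, h⟩ := exists_sub_mul_mem hf hp
    rwa [homPart_of_neg (by omega), mul_zero, sub_zero] at h

lemma IsRegularUpTo.ne_zero {f : ℕ → MvPolynomial σ E} {m k : ℕ} (hreg : IsRegularUpTo f m)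
    (hf : ∀ k < m, (f k).IsHomogeneous 2) (hk : k < m) : f k ≠ 0 := by
  intro h
  have h1 : (1 : MvPolynomial σ E) ∈ idealPart f k 0 :=
    ⟨hreg k hk 1 (by simp [h]), isHomogeneous_one _ _⟩
  rw [idealPart_eq_bot (fun i hi => hf i (by omega)) (.inl (by omega))] at h1
  exact one_ne_zero ((Submodule.mem_bot E).1 h1)

variable [Finite σ]

lemma finite_idealPart (f : ℕ → MvPolynomial σ E) (m d : ℕ) :
    Module.Finite E (idealPart f m d) :=
  have := finite_homogeneousSubmodule (E := E) (σ := σ) d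
  Submodule.finiteDimensional_of_le inf_le_right

lemma finrank_idealPart_succ {f : ℕ → MvPolynomial σ E} {m : ℕ}
    (hf : ∀ k < m + 1, (f k).IsHomogeneous 2) (hreg : IsRegularUpTo f (m + 1)) (d : ℕ) :
    Module.finrank E (idealPart f (m + 1) (d + 2)) + Module.finrank E (idealPart f m d) =
      Module.finrank E (idealPart f m (d + 2)) +
        Module.finrank E (homogeneousSubmodule σ E d) := by
  have hfin := finite_homogeneousSubmodule (E := E) (σ := σ) d
  have hfin' := finite_idealPart f m (d + 2)
  set μ := LinearMap.mulLeft E (f m) with hμ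
  have hinj : Function.Injective μ :=
    mul_right_injective₀ (hreg.ne_zero hf (Nat.lt_succ_self m))
  have hhom {a : MvPolynomial σ E} (ha : a.IsHomogeneous d) :
      (f m * a).IsHomogeneous (d + 2) := by
    rw [add_comm]; exact (hf m (by omega)).mul ha
  have hsup : idealPart f m (d + 2) ⊔ (homogeneousSubmodule σ E d).map μ =
      idealPart f (m + 1) (d + 2) := by
    refine le_antisymm (sup_le (inf_le_inf_right _ (initialIdeal_le_succ f m)) ?_) fun p hp => ?_
    · rintro _ ⟨a, ha, rfl⟩
      exact ⟨mem_initialIdeal_succ.2 ⟨a, by simp [hμ]⟩, hhom ha⟩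
    · obtain ⟨a, ha⟩ := exists_sub_mul_mem hf hp
      push_cast at ha
      rw [add_sub_cancel_right] at ha
      have hd : (homPart d a).IsHomogeneous d := by
        simp only [homPart, if_pos (Int.natCast_nonneg d), Int.toNat_natCast]
        exact homogeneousComponent_isHomogeneous _ _
      refine Submodule.mem_sup.2 ⟨_, ⟨ha, ?_⟩, _, ⟨_, hd, rfl⟩, by simp [hμ]⟩
      exact Submodule.sub_mem _ hp.2 (hhom hd)
  have hinf : idealPart f m (d + 2) ⊓ (homogeneousSubmodule σ E d).map μ =
      (idealPart f m d).map μ := by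
    apply le_antisymm
    · rintro _ ⟨h1, a, ha, rfl⟩
      exact ⟨a, ⟨hreg m (by omega) a h1.1, ha⟩, rfl⟩
    · rintro _ ⟨a, ha, rfl⟩
      exact ⟨⟨Ideal.mul_mem_left _ _ ha.1, hhom ha.2⟩, a, ha.2, rfl⟩
  have := Submodule.finrank_sup_add_finrank_inf_eq (idealPart f m (d + 2))
    ((homogeneousSubmodule σ E d).map μ)
  rwa [hsup, hinf, ← (Submodule.equivMapOfInjective μ hinj _).finrank_eq,
    ← (Submodule.equivMapOfInjective μ hinj _).finrank_eq] at this

end HilbertFunction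

lemma finrank_gradedPiece_add {E : Type*} [Field E] {n : ℕ} (f : ℕ → MvPolynomial (Fin n) E)
    (m d : ℕ) :
    Module.finrank E (gradedPiece (initialIdeal f m) d) + Module.finrank E (idealPart f m d) =
      Module.finrank E (homogeneousSubmodule (Fin n) E d) := by
  have := finite_homogeneousSubmodule (E := E) (σ := Fin n) d
  set q := (Ideal.Quotient.mkₐ E (initialIdeal f m)).toLinearMap with hq
  have h := (q.domRestrict (homogeneousSubmodule (Fin n) E d)).finrank_range_add_finrank_ker
  rw [LinearMap.range_domRestrict] at h
  rw [← h, gradedPiece]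
  congr 1
  have : idealPart f m d = (LinearMap.ker (q.domRestrict (homogeneousSubmodule (Fin n) E d))).map
      (homogeneousSubmodule (Fin n) E d).subtype := by
    ext p
    rw [mem_idealPart]
    simp [hq, Ideal.Quotient.eq_zero_iff_mem, and_comm]
  rw [this]
  exact ((Submodule.equivMapOfInjective _ (Submodule.subtype_injective _) _).finrank_eq).symm

/-- The Hilbert function of a complete intersection of five quadrics in five variables. -/
lemma finrank_gradedPiece {E : Type*} [Field E] {f : ℕ → MvPolynomial (Fin 5) E}
    (hf : ∀ k < 5, (f k).IsHomogeneous 2) (hreg : IsRegularUpTo f 5) :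
    Module.finrank E (gradedPiece (initialIdeal f 5) 1) = 5 ∧
    Module.finrank E (gradedPiece (initialIdeal f 5) 2) = 10 ∧
    Module.finrank E (gradedPiece (initialIdeal f 5) 3) = 10 ∧
    Module.finrank E (gradedPiece (initialIdeal f 5) 4) = 5 ∧
    Module.finrank E (gradedPiece (initialIdeal f 5) 5) = 1 := by
  have s (d : ℕ) : Module.finrank E (homogeneousSubmodule (Fin 5) E d) = (4 + d).choose d := by
    rw [finrank_homogeneousSubmodule, Fintype.card_fin]; congr 1; omega
  have s0 := s 0
  have s1 := s 1
  have s2 := s 2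
  have s3 := s 3
  have s4 := s 4
  have s5 := s 5
  norm_num [Nat.choose] at s0 s1 s2 s3 s4 s5
  have z (m d : ℕ) (hm : m ≤ 5) (hd : d < 2 ∨ m = 0) :
      Module.finrank E (idealPart f m d) = 0 := by
    rw [idealPart_eq_bot (fun k hk => hf k (by omega)) hd, finrank_bot]
  have r (m d : ℕ) (hm : m < 5) := finrank_idealPart_succ (m := m)
    (fun k hk => hf k (by omega)) (fun k hk => hreg k (by omega)) d
  have j2 (m : ℕ) (hm : m ≤ 5) : Module.finrank E (idealPart f m 2) = m := by
    induction m with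
    | zero => exact z 0 2 (by omega) (.inr rfl)
    | succ m ih =>
      have := ih (by omega)
      have h := r m 0 (by omega)
      rw [zero_add] at h
      have := z m 0 (by omega) (by omega)
      omega
  have j3 (m : ℕ) (hm : m ≤ 5) : Module.finrank E (idealPart f m 3) = 5 * m := by
    induction m with
    | zero => exact z 0 3 (by omega) (.inr rfl)
    | succ m ih =>
      have := ih (by omega)
      have h := r m 1 (by omega)
      rw [show 1 + 2 = 3 from rfl] at h
      have := z m 1 (by omega) (by omega)
      omega
  have g := finrank_gradedPiece_add f 5
  have j4 : Module.finrank E (idealPart f 5 4) = 65 := by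
    have := z 0 4 (by omega) (.inr rfl)
    have := r 0 2 (by omega)
    have := r 1 2 (by omega)
    have := r 2 2 (by omega)
    have := r 3 2 (by omega)
    have := r 4 2 (by omega)
    simp only [Nat.reduceAdd, j2 0 (by omega), j2 1 (by omega), j2 2 (by omega), j2 3 (by omega),
      j2 4 (by omega), s2] at *
    omega
  have j5 : Module.finrank E (idealPart f 5 5) = 125 := by
    have := z 0 5 (by omega) (.inr rfl)
    have := r 0 3 (by omega)
    have := r 1 3 (by omega)
    have := r 2 3 (by omega)
    have := r 3 3 (by omega)
    have := r 4 3 (by omega)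
    simp only [Nat.reduceAdd, j3 0 (by omega), j3 1 (by omega), j3 2 (by omega), j3 3 (by omega),
      j3 4 (by omega), s3] at *
    omega
  have g1 := g 1
  have g2 := g 2
  have g3 := g 3
  have g4 := g 4
  have g5 := g 5
  rw [s1, z 5 1 le_rfl (by omega)] at g1
  rw [s2, j2 5 le_rfl] at g2
  rw [s3, j3 5 le_rfl] at g3
  rw [s4, j4] at g4
  rw [s5, j5] at g5
  omega

section GenericLinearForm

/-- A graded algebra with the Hilbert function and the annihilator bounds of a complete
intersection of five quadrics, together with a linear form `x` and directional derivatives `δ`,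
the derivative of `x` in the direction `v` being the linear form with coefficients `v`. -/
structure GenericLinearForm (L A : Type*) [Field L] [CommRing A] [Algebra L A] where
  /-- The graded pieces. -/
  piece : ℕ → Submodule L A
  /-- The linear form with given coefficients. -/
  lin : (Fin 5 → L) →ₗ[L] A
  /-- The generic linear form. -/
  x : A
  /-- The derivatives of an element, as a function of the direction. -/
  δ : A → (Fin 5 → L) →ₗ[L] A
  mul_mem {i j : ℕ} {a b : A} : a ∈ piece i → b ∈ piece j → a * b ∈ piece (i + j)
  range_lin : LinearMap.range lin = piece 1
  lin_injective : Function.Injective lin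
  x_mem : x ∈ piece 1
  δ_x : δ x = lin
  δ_mul (a b : A) (v : Fin 5 → L) : δ (a * b) v = a * δ b v + b * δ a v
  δ_mem {i : ℕ} {a : A} (v : Fin 5 → L) : a ∈ piece i → δ a v ∈ piece i
  finrank_ann {i : ℕ} {a : A} : a ∈ piece i → a ≠ 0 →
    Module.finrank L ↥(piece 1 ⊓ LinearMap.ker (LinearMap.mulRight L a)) ≤ i
  finrank_two : Module.finrank L (piece 2) = 10
  finrank_five : Module.finrank L (piece 5) = 1

namespace GenericLinearForm

variable {L A : Type*} [Field L] [CommRing A] [Algebra L A] (G : GenericLinearForm L A)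

lemma lin_mem (v : Fin 5 → L) : G.lin v ∈ G.piece 1 := by
  rw [← G.range_lin]; exact ⟨v, rfl⟩

lemma finite_one : Module.Finite L (G.piece 1) := by
  rw [← G.range_lin]; infer_instance

lemma finrank_one : Module.finrank L (G.piece 1) = 5 := by
  rw [← G.range_lin, LinearMap.finrank_range_of_inj G.lin_injective]; simp

lemma finite_ann (a : A) :
    Module.Finite L ↥(G.piece 1 ⊓ LinearMap.ker (LinearMap.mulRight L a)) :=
  have := G.finite_one
  Submodule.finiteDimensional_of_le inf_le_left

lemma eq_zero_of_finrank_lt {i : ℕ} {a : A} (ha : a ∈ G.piece i) (W : Submodule L (Fin 5 → L))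
    (hi : i < Module.finrank L W) (h : ∀ v ∈ W, G.lin v * a = 0) : a = 0 := by
  by_contra h0
  have := G.finite_ann a
  have h1 := G.finrank_ann ha h0
  have h2 : W.map G.lin ≤ G.piece 1 ⊓ LinearMap.ker (LinearMap.mulRight L a) := by
    rintro _ ⟨v, hv, rfl⟩
    exact ⟨G.lin_mem v, h v hv⟩
  have h3 := Submodule.finrank_mono h2
  rw [← (Submodule.equivMapOfInjective _ G.lin_injective _).finrank_eq] at h3
  omega

lemma eq_zero_of_lin_mul {i : ℕ} {a : A} (ha : a ∈ G.piece i) (hi : i < 5)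
    (h : ∀ v, G.lin v * a = 0) : a = 0 :=
  G.eq_zero_of_finrank_lt ha ⊤ (by simpa using hi) fun v _ => h v

lemma δ_zero (v : Fin 5 → L) : G.δ 0 v = 0 := by
  have := G.δ_mul 0 0 v
  simpa using this

lemma δ_x_apply (v : Fin 5 → L) : G.δ G.x v = G.lin v := by rw [G.δ_x]

/-- The directions in which the derivative of `y` is a multiple of `y`. -/
def flat (y : A) : Submodule L (Fin 5 → L) := (L ∙ y).comap (G.δ y)

/-- The span of `y` and its derivatives. -/
def tangent (y : A) : Submodule L A := LinearMap.range (G.δ y) ⊔ (L ∙ y)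

lemma finite_tangent (y : A) : Module.Finite L (G.tangent y) := by
  unfold tangent; infer_instance

lemma le_finrank_flat_add {y : A} (hy : y ≠ 0) :
    6 ≤ Module.finrank L (G.flat y) + Module.finrank L (G.tangent y) := by
  set h := (G.δ y).coprod (LinearMap.toSpanSingleton L A y) with hh
  have h1 := h.finrank_range_add_finrank_ker
  rw [LinearMap.range_coprod, LinearMap.range_toSpanSingleton] at h1
  have h2 : (LinearMap.ker h).map (LinearMap.fst L (Fin 5 → L) L) ≤ G.flat y := by
    rintro _ ⟨⟨c, a⟩, hc, rfl⟩
    have : G.δ y c + a • y = 0 := by simpa [hh] using hc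
    exact Submodule.mem_span_singleton.2 ⟨-a,
      (neg_smul a y).trans (eq_neg_of_add_eq_zero_left this).symm⟩
  have h3 : Module.finrank L (LinearMap.ker h) =
      Module.finrank L ((LinearMap.ker h).map (LinearMap.fst L (Fin 5 → L) L)) := by
    refine (LinearEquiv.finrank_eq (LinearEquiv.ofInjective
      ((LinearMap.fst L (Fin 5 → L) L).domRestrict _) ?_)).trans ?_
    · rw [← LinearMap.ker_eq_bot, LinearMap.ker_eq_bot']
      rintro ⟨⟨c, a⟩, hc⟩ h0
      have hc' : G.δ y c + a • y = 0 := by simpa [hh] using hc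
      have h0' : c = 0 := by simpa using h0
      subst h0'
      have : a = 0 := by simpa [hy] using hc'
      simp [this]
    · rw [LinearMap.range_domRestrict]
  have h4 := Submodule.finrank_mono h2
  simp only [Module.finrank_prod, Module.finrank_fin_fun, Module.finrank_self] at h1
  unfold tangent
  omega

lemma tangent_le {i : ℕ} {y : A} (hy : y ∈ G.piece i) : G.tangent y ≤ G.piece i := by
  refine sup_le ?_ ((Submodule.span_singleton_le_iff_mem _ _).2 hy)
  rintro _ ⟨v, rfl⟩
  exact G.δ_mem v hy

lemma finrank_tangent_le {i : ℕ} {y a : A} (hy : y ∈ G.piece 1) (ha : a ∈ G.piece i) (ha0 : a ≠ 0)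
    (h : ∀ v, a * G.δ y v = 0) (h' : a * y = 0) :
    G.tangent y ≤ G.piece 1 ⊓ LinearMap.ker (LinearMap.mulRight L a) ∧
      Module.finrank L (G.tangent y) ≤ i := by
  have hle : G.tangent y ≤ G.piece 1 ⊓ LinearMap.ker (LinearMap.mulRight L a) := by
    refine le_inf (G.tangent_le hy) (sup_le ?_ ?_)
    · rintro _ ⟨v, rfl⟩
      simp [mul_comm _ a, h]
    · rw [Submodule.span_singleton_le_iff_mem]
      simp [mul_comm _ a, h']
  have := G.finite_ann a
  exact ⟨hle, (Submodule.finrank_mono hle).trans (G.finrank_ann ha ha0)⟩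

lemma pow_mem {a : A} (ha : a ∈ G.piece 1) : a ^ 2 ∈ G.piece 2 ∧ a ^ 3 ∈ G.piece 3 ∧
    a ^ 4 ∈ G.piece 4 := by
  have h2 : a ^ 2 ∈ G.piece 2 := by rw [sq]; exact G.mul_mem ha ha
  have h3 : a ^ 3 ∈ G.piece 3 := by rw [pow_succ]; exact G.mul_mem h2 ha
  have h4 : a ^ 4 ∈ G.piece 4 := by rw [pow_succ]; exact G.mul_mem h3 ha
  exact ⟨h2, h3, h4⟩

lemma eq_zero_of_natCast_mul [CharZero L] (n : ℕ) (hn : n ≠ 0) {a : A} (h : (n : A) * a = 0) :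
    a = 0 := by
  have : (n : L) • a = 0 := by rw [Algebra.smul_def, map_natCast, h]
  exact (smul_eq_zero.1 this).resolve_left (Nat.cast_ne_zero.2 hn)

variable [CharZero L]

/-- Multiplication by the cube of the generic linear form is injective on linear forms. -/
theorem eq_zero_of_x_pow_mul {y : A} (hy : y ∈ G.piece 1) (h : G.x ^ 3 * y = 0) : y = 0 := by
  by_contra hy0
  obtain ⟨hx2, hx3, -⟩ := G.pow_mem G.x_mem
  obtain ⟨hy2, hy3, hy4⟩ := G.pow_mem hy
  have hxy := G.mul_mem G.x_mem hy
  have d1 (v) : 3 * (G.lin v * (G.x ^ 2 * y)) + G.x ^ 3 * G.δ y v = 0 := by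
    have := congrArg (G.δ · v) h
    simp only [pow_succ, pow_zero, one_mul, G.δ_mul, G.δ_x_apply, G.δ_zero] at this
    linear_combination this
  have z22 : G.x ^ 2 * y ^ 2 = 0 := by
    refine G.eq_zero_of_lin_mul (G.mul_mem hx2 hy2) (by norm_num) fun v => ?_
    refine eq_zero_of_natCast_mul (L := L) 3 (by norm_num) ?_
    push_cast
    linear_combination y * d1 v - G.δ y v * h
  have d2 (v) : 2 * (G.lin v * (G.x * y ^ 2)) + 2 * (G.x ^ 2 * y * G.δ y v) = 0 := by
    have := congrArg (G.δ · v) z22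
    simp only [pow_succ, pow_zero, one_mul, G.δ_mul, G.δ_x_apply, G.δ_zero] at this
    linear_combination this
  have z13 : G.x * y ^ 3 = 0 := by
    refine G.eq_zero_of_lin_mul (G.mul_mem G.x_mem hy3) (by norm_num) fun v => ?_
    refine eq_zero_of_natCast_mul (L := L) 2 (by norm_num) ?_
    push_cast
    linear_combination y * d2 v - 2 * G.δ y v * z22
  have d3 (v) : G.lin v * y ^ 3 + 3 * (G.x * y ^ 2 * G.δ y v) = 0 := by
    have := congrArg (G.δ · v) z13
    simp only [pow_succ, pow_zero, one_mul, G.δ_mul, G.δ_x_apply, G.δ_zero] at this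
    linear_combination this
  have z4 : y ^ 4 = 0 := by
    refine G.eq_zero_of_lin_mul hy4 (by norm_num) fun v => ?_
    linear_combination y * d3 v - 3 * G.δ y v * z13
  have d4 (v) : y ^ 3 * G.δ y v = 0 := by
    refine eq_zero_of_natCast_mul (L := L) 4 (by norm_num) ?_
    have := congrArg (G.δ · v) z4
    simp only [pow_succ, pow_zero, one_mul, G.δ_mul, G.δ_zero] at this
    push_cast
    linear_combination this
  have hflat {v} (hv : v ∈ G.flat y) : ∃ c : L, G.δ y v = algebraMap L A c * y := by
    obtain ⟨c, hc⟩ := Submodule.mem_span_singleton.1 hv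
    exact ⟨c, by rw [← Algebra.smul_def]; exact hc.symm⟩
  have f1 {v} (hv : v ∈ G.flat y) : G.lin v * (G.x ^ 2 * y) = 0 := by
    obtain ⟨c, hc⟩ := hflat hv
    refine eq_zero_of_natCast_mul (L := L) 3 (by norm_num) ?_
    push_cast
    linear_combination d1 v - G.x ^ 3 * hc - algebraMap L A c * h
  have f3 {v} (hv : v ∈ G.flat y) : G.lin v * y ^ 3 = 0 := by
    obtain ⟨c, hc⟩ := hflat hv
    linear_combination d3 v - 3 * G.x * y ^ 2 * hc - 3 * algebraMap L A c * z13
  have hdim := G.le_finrank_flat_add hy0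
  by_cases h3 : y ^ 3 = 0
  · have d5 (v) : y ^ 2 * G.δ y v = 0 := by
      refine eq_zero_of_natCast_mul (L := L) 3 (by norm_num) ?_
      have := congrArg (G.δ · v) h3
      simp only [pow_succ, pow_zero, one_mul, G.δ_mul, G.δ_zero] at this
      push_cast
      linear_combination this
    have h4 : 4 ≤ Module.finrank L (G.flat y) := by
      by_cases h2 : y ^ 2 = 0
      · have d6 (v) : y * G.δ y v = 0 := by
          refine eq_zero_of_natCast_mul (L := L) 2 (by norm_num) ?_
          have := congrArg (G.δ · v) h2
          simp only [pow_succ, pow_zero, one_mul, G.δ_mul, G.δ_zero] at this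
          push_cast
          linear_combination this
        have := (G.finrank_tangent_le hy hy hy0 d6 (by rw [← sq, h2])).2
        omega
      · have := (G.finrank_tangent_le hy hy2 h2 d5 (by rw [← pow_succ, h3])).2
        omega
    have z21 : G.x ^ 2 * y = 0 :=
      G.eq_zero_of_finrank_lt (G.mul_mem hx2 hy) (G.flat y) (by omega) fun v => f1
    have z11 : G.x * y = 0 := by
      refine G.eq_zero_of_finrank_lt hxy (G.flat y) (by omega) fun v hv => ?_
      obtain ⟨c, hc⟩ := hflat hv
      refine eq_zero_of_natCast_mul (L := L) 2 (by norm_num) ?_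
      have := congrArg (G.δ · v) z21
      simp only [pow_succ, pow_zero, one_mul, G.δ_mul, G.δ_x_apply, G.δ_zero] at this
      push_cast
      linear_combination this - G.x ^ 2 * hc - algebraMap L A c * z21
    refine hy0 (G.eq_zero_of_finrank_lt hy (G.flat y) (by omega) fun v hv => ?_)
    obtain ⟨c, hc⟩ := hflat hv
    have := congrArg (G.δ · v) z11
    simp only [G.δ_mul, G.δ_x_apply, G.δ_zero] at this
    linear_combination this - G.x * hc - algebraMap L A c * z11
  · obtain ⟨hle, hdim3⟩ := G.finrank_tangent_le hy hy3 h3 d4 (by rw [← pow_succ, z4])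
    have := G.finite_ann (y ^ 3)
    have hann := G.finrank_ann hy3 h3
    have hle' : (G.flat y).map G.lin ≤
        G.piece 1 ⊓ LinearMap.ker (LinearMap.mulRight L (y ^ 3)) := by
      rintro _ ⟨v, hv, rfl⟩
      exact ⟨G.lin_mem v, f3 hv⟩
    have hfl := (Submodule.equivMapOfInjective _ G.lin_injective (G.flat y)).finrank_eq
    have heq := Submodule.eq_of_le_of_finrank_le hle' (by omega)
    have d7 (v) : G.δ y v * (G.x ^ 2 * y) = 0 := by
      have : G.δ y v ∈ (G.flat y).map G.lin := by
        rw [heq]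
        exact hle (Submodule.mem_sup_left ⟨v, rfl⟩)
      obtain ⟨w, hw, hwv⟩ := this
      rw [← hwv, f1 hw]
    have z12 : G.x * y ^ 2 = 0 := by
      refine G.eq_zero_of_lin_mul (G.mul_mem G.x_mem hy2) (by norm_num) fun v => ?_
      refine eq_zero_of_natCast_mul (L := L) 2 (by norm_num) ?_
      push_cast
      linear_combination d2 v - 2 * d7 v
    refine h3 (G.eq_zero_of_lin_mul hy3 (by norm_num) fun v => ?_)
    have := congrArg (G.δ · v) z12
    simp only [pow_succ, pow_zero, one_mul, G.δ_mul, G.δ_x_apply, G.δ_zero] at this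
    linear_combination y * this - 2 * G.δ y v * z12

/-- Multiplication by the generic linear form is injective on quadratic forms. -/
theorem eq_zero_of_x_mul {q : A} (hq : q ∈ G.piece 2) (h : G.x * q = 0) : q = 0 := by
  by_contra hq0
  have d1 (v) : G.lin v * q + G.x * G.δ q v = 0 := by
    have := congrArg (G.δ · v) h
    simp only [G.δ_mul, G.δ_x_apply, G.δ_zero] at this
    linear_combination this
  have zq : q * q = 0 := by
    refine G.eq_zero_of_lin_mul (G.mul_mem hq hq) (by norm_num) fun v => ?_
    linear_combination q * d1 v - G.δ q v * h
  have d2 (v) : q * G.δ q v = 0 := by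
    refine eq_zero_of_natCast_mul (L := L) 2 (by norm_num) ?_
    have := congrArg (G.δ · v) zq
    simp only [G.δ_mul, G.δ_zero] at this
    push_cast
    linear_combination this
  have d3 (v w) : G.x * G.δ q v * G.δ q w = 0 := by
    linear_combination G.δ q w * d1 v - G.lin v * d2 w
  have d4 (v) : G.x ^ 2 * G.δ q v = 0 := by
    linear_combination G.x * d1 v - G.lin v * h
  set ξ := LinearMap.mulLeft L G.x with hξ
  set M := (G.tangent q).map ξ with hM
  have hMeq : M = LinearMap.range (ξ ∘ₗ G.δ q) := by
    rw [hM, tangent, Submodule.map_sup, LinearMap.range_comp, sup_eq_left,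
      Submodule.map_le_iff_le_comap, Submodule.span_singleton_le_iff_mem]
    simp [hξ, h]
  have hMfin : Module.Finite L M := by rw [hMeq]; infer_instance
  have hMrank : 3 ≤ Module.finrank L M := by
    have e : ξ ∘ₗ G.δ q = -(LinearMap.mulRight L q ∘ₗ G.lin) := by
      refine LinearMap.ext fun v => ?_
      exact eq_neg_of_add_eq_zero_right (d1 v)
    have e1 := (ξ ∘ₗ G.δ q).finrank_range_add_finrank_ker
    rw [← hMeq, Module.finrank_fin_fun] at e1
    have e2 : (LinearMap.ker (ξ ∘ₗ G.δ q)).map G.lin ≤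
        G.piece 1 ⊓ LinearMap.ker (LinearMap.mulRight L q) := by
      rintro _ ⟨v, hv, rfl⟩
      rw [e] at hv
      exact ⟨G.lin_mem v, by simpa using hv⟩
    have := G.finite_ann q
    have e3 := Submodule.finrank_mono e2
    rw [← (Submodule.equivMapOfInjective _ G.lin_injective _).finrank_eq] at e3
    have := G.finrank_ann hq hq0
    omega
  have hTfin := G.finite_tangent q
  have hTrank : 4 ≤ Module.finrank L (G.tangent q) := by
    have e1 := (ξ.domRestrict (G.tangent q)).finrank_range_add_finrank_ker
    rw [LinearMap.range_domRestrict, ← hM] at e1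
    have e2 : 0 < Module.finrank L (LinearMap.ker (ξ.domRestrict (G.tangent q))) := by
      have hqm : q ∈ G.tangent q := Submodule.mem_sup_right (Submodule.mem_span_singleton_self q)
      have hqk : (⟨q, hqm⟩ : G.tangent q) ∈ LinearMap.ker (ξ.domRestrict (G.tangent q)) := h
      exact Submodule.one_le_finrank_iff.2
        ((Submodule.ne_bot_iff _).2 ⟨_, hqk, by simpa using hq0⟩)
    omega
  have hinj {l : A} (hl : l ∈ G.piece 1) (h0 : G.x ^ 3 * l = 0) : l = 0 :=
    G.eq_zero_of_x_pow_mul hl h0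
  have hTx {t : A} (ht : t ∈ G.tangent q) : G.x ^ 2 * t = 0 := by
    have : G.tangent q ≤ LinearMap.ker (LinearMap.mulLeft L (G.x ^ 2)) := by
      refine sup_le ?_ ((Submodule.span_singleton_le_iff_mem _ _).2 ?_)
      · rintro _ ⟨v, rfl⟩
        exact d4 v
      · rw [LinearMap.mem_ker, LinearMap.mulLeft_apply]
        linear_combination G.x * h
    exact this ht
  have hone := G.finite_one
  set N := G.tangent q ⊔ (G.piece 1).map ξ with hN
  have hN2 : N ≤ G.piece 2 := by
    refine sup_le (G.tangent_le hq) ?_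
    rintro _ ⟨l, hl, rfl⟩
    exact G.mul_mem G.x_mem hl
  have hNrank : 9 ≤ Module.finrank L N := by
    have e1 := Submodule.finrank_sup_add_finrank_inf_eq (G.tangent q) ((G.piece 1).map ξ)
    have e2 : G.tangent q ⊓ (G.piece 1).map ξ = ⊥ := by
      rw [eq_bot_iff]
      rintro _ ⟨ht, l, hl, rfl⟩
      have : l = 0 := hinj hl (by
        have := hTx ht
        simp only [hξ, LinearMap.mulLeft_apply] at this
        linear_combination this)
      simp [this]
    have e3 : Module.finrank L ((G.piece 1).map ξ) = 5 := by
      rw [← LinearMap.range_domRestrict, LinearMap.finrank_range_of_inj, G.finrank_one]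
      rw [← LinearMap.ker_eq_bot, LinearMap.ker_eq_bot']
      rintro ⟨l, hl⟩ h0
      have h0 : G.x * l = 0 := h0
      have := hinj hl (by linear_combination G.x ^ 2 * h0)
      simpa using this
    rw [e2, finrank_bot, e3, ← hN] at e1
    omega
  have hMN {b t : A} (hb : b ∈ M) (ht : t ∈ N) : t * b = 0 := by
    rw [hMeq] at hb
    obtain ⟨v, rfl⟩ := hb
    have : N ≤ LinearMap.ker (LinearMap.mulRight L ((ξ ∘ₗ G.δ q) v)) := by
      refine sup_le (sup_le ?_ ((Submodule.span_singleton_le_iff_mem _ _).2 ?_)) ?_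
      · rintro _ ⟨w, rfl⟩
        simp only [hξ, LinearMap.mem_ker, LinearMap.mulRight_apply, LinearMap.comp_apply,
          LinearMap.mulLeft_apply]
        linear_combination d3 v w
      · simp only [hξ, LinearMap.mem_ker, LinearMap.mulRight_apply, LinearMap.comp_apply,
          LinearMap.mulLeft_apply]
        linear_combination G.x * d2 v
      · rintro _ ⟨l, -, rfl⟩
        simp only [hξ, LinearMap.mem_ker, LinearMap.mulRight_apply, LinearMap.comp_apply,
          LinearMap.mulLeft_apply]
        linear_combination l * d4 v
    exact this ht
  have hM3 : M ≤ G.piece 3 := by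
    rw [hMeq]
    rintro _ ⟨v, rfl⟩
    exact G.mul_mem G.x_mem (G.δ_mem v hq)
  have htwo : Module.Finite L (G.piece 2) :=
    Module.finite_of_finrank_pos (by rw [G.finrank_two]; norm_num)
  have hfive : Module.Finite L (G.piece 5) :=
    Module.finite_of_finrank_pos (by rw [G.finrank_five]; norm_num)
  obtain ⟨u, hu, hNu⟩ : ∃ u ∈ G.piece 2, G.piece 2 ≤ N ⊔ (L ∙ u) := by
    by_cases hle : G.piece 2 ≤ N
    · exact ⟨0, Submodule.zero_mem _, hle.trans le_sup_left⟩
    · obtain ⟨u, hu, huN⟩ := SetLike.not_le_iff_exists.1 hle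
      have hNu : N ⊔ (L ∙ u) ≤ G.piece 2 :=
        sup_le hN2 ((Submodule.span_singleton_le_iff_mem _ _).2 hu)
      have hlt : N < N ⊔ (L ∙ u) := by
        rw [left_lt_sup, Submodule.span_singleton_le_iff_mem]; exact huN
      have : Module.Finite L ↥(N ⊔ (L ∙ u)) := Submodule.finiteDimensional_of_le hNu
      have := Submodule.finrank_lt_finrank_of_lt hlt
      refine ⟨u, hu, (Submodule.eq_of_le_of_finrank_le hNu ?_).ge⟩
      rw [G.finrank_two]
      omega
  have hMu : Module.finrank L M ≤ 1 := by
    rw [← G.finrank_five]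
    have hmaps (b : M) : (LinearMap.mulLeft L u).domRestrict M b ∈ G.piece 5 :=
      G.mul_mem hu (hM3 b.2)
    refine LinearMap.finrank_le_finrank_of_injective
      (f := LinearMap.codRestrict (G.piece 5) ((LinearMap.mulLeft L u).domRestrict M) hmaps) ?_
    rw [← LinearMap.ker_eq_bot, LinearMap.ker_eq_bot']
    rintro ⟨b, hb⟩ h0
    have hub : u * b = 0 := congrArg Subtype.val h0
    have hkill {a : A} (ha : a ∈ G.piece 2) : a * b = 0 := by
      obtain ⟨t, ht, s, hs, rfl⟩ := Submodule.mem_sup.1 (hNu ha)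
      obtain ⟨c, rfl⟩ := Submodule.mem_span_singleton.1 hs
      rw [add_mul, hMN hb ht, smul_mul_assoc, hub, smul_zero, add_zero]
    have hb0 : b = 0 := by
      refine G.eq_zero_of_lin_mul (hM3 hb) (by norm_num) fun v => ?_
      refine G.eq_zero_of_lin_mul (G.mul_mem (G.lin_mem v) (hM3 hb)) (by norm_num) fun w => ?_
      rw [← mul_assoc]
      exact hkill (G.mul_mem (G.lin_mem w) (G.lin_mem v))
    simpa using hb0
  omega

end GenericLinearForm
end GenericLinearForm

section Regularity

open RingTheory.Sequence

lemma initialIdeal_eq_ofList {S : Type*} [CommRing S] (f : ℕ → S) {k m : ℕ} (hk : k ≤ m) :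
    initialIdeal f k = Ideal.ofList ((List.ofFn fun i : Fin m => f i).take k) := by
  unfold initialIdeal Ideal.ofList
  congr 1
  ext a
  simp only [Set.mem_image, Set.mem_Iio, Set.mem_ofPred_eq, List.mem_take_iff_getElem,
    List.length_ofFn, List.getElem_ofFn]
  constructor
  · rintro ⟨i, hi, rfl⟩
    exact ⟨i, by omega, rfl⟩
  · rintro ⟨i, hi, rfl⟩
    exact ⟨i, by omega, rfl⟩

lemma isRegularUpTo_of_isWeaklyRegular {S : Type*} [CommRing S] (f : ℕ → S) {m : ℕ}
    (h : IsWeaklyRegular S (List.ofFn fun i : Fin m => f i)) : IsRegularUpTo f m := by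
  intro k hk p hp
  have hr := h.regular_mod_prev k (by simpa using hk)
  rw [smul_eq_mul, Ideal.mul_top, ← initialIdeal_eq_ofList f hk.le, List.getElem_ofFn] at hr
  refine (Submodule.Quotient.mk_eq_zero _).1
    (hr.right_eq_zero_of_smul (x := Submodule.Quotient.mk p) ?_)
  rw [← Submodule.Quotient.mk_smul]
  exact (Submodule.Quotient.mk_eq_zero _).2 hp

/-- Regularity of a sequence of polynomials is preserved by extension of the ground field. -/
lemma isRegularUpTo_map {K L σ : Type*} [Field K] [Field L] [Algebra K L]
    (f : ℕ → MvPolynomial σ K) {m : ℕ}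
    (h : IsWeaklyRegular (MvPolynomial σ K) (List.ofFn fun i : Fin m => f i)) :
    IsRegularUpTo (fun k => MvPolynomial.map (algebraMap K L) (f k)) m := by
  let : Algebra (MvPolynomial σ K) (MvPolynomial σ L) := algebraMvPolynomial
  have hflat : Module.Flat (MvPolynomial σ K) (MvPolynomial σ L) :=
    Module.Flat.isBaseChange K (MvPolynomial σ K) L (MvPolynomial σ L)
      (Algebra.IsPushout.out (S := MvPolynomial σ K) (R' := L))
  apply isRegularUpTo_of_isWeaklyRegular
  have := h.of_flat (S := MvPolynomial σ L)
  rwa [List.map_ofFn] at this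

end Regularity

section Derivations

open TrivSqZeroExt

/-- The partial derivative of rational functions, as a ring homomorphism to dual numbers. -/
lemma exists_dualNumber_hom {K σ : Type*} [Field K] [DecidableEq σ] (i : σ) :
    ∃ θ : FractionRing (MvPolynomial σ K) →+* DualNumber (FractionRing (MvPolynomial σ K)),
      (∀ a, (θ a).fst = a) ∧ (∀ c : K, (θ (algebraMap K _ c)).snd = 0) ∧
      ∀ j, (θ (algebraMap (MvPolynomial σ K) _ (X j))).snd = if j = i then 1 else 0 := by
  set L := FractionRing (MvPolynomial σ K)
  set g : MvPolynomial σ K →ₐ[K] DualNumber L :=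
    aeval fun j => inl (algebraMap (MvPolynomial σ K) L (X j)) +
      inr (if j = i then 1 else 0) with hg
  have hfst (p) : (g p).fst = algebraMap _ L p := by
    have : (fstHom K L L).comp g = IsScalarTower.toAlgHom K (MvPolynomial σ K) L :=
      MvPolynomial.algHom_ext fun j => by simp [hg]
    exact DFunLike.congr_fun this p
  have hunit (y : nonZeroDivisors (MvPolynomial σ K)) :
      IsUnit ((g : MvPolynomial σ K →+* DualNumber L) y) := by
    rw [isUnit_iff_isUnit_fst]
    change IsUnit (g y).fst
    rw [hfst]
    exact IsLocalization.map_units L y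
  refine ⟨IsLocalization.lift hunit, fun a => ?_, fun c => ?_, fun j => ?_⟩
  · have : ((fstHom K L L : DualNumber L →ₐ[K] L) : DualNumber L →+* L).comp
        (IsLocalization.lift hunit) = RingHom.id L := by
      refine IsLocalization.ringHom_ext (nonZeroDivisors (MvPolynomial σ K)) ?_
      rw [RingHom.comp_assoc, IsLocalization.lift_comp]
      exact RingHom.ext hfst
    exact DFunLike.congr_fun this a
  · rw [IsScalarTower.algebraMap_apply K (MvPolynomial σ K) L, IsLocalization.lift_eq]
    change (g (algebraMap K _ c)).snd = 0
    rw [AlgHom.commutes]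
    rfl
  · rw [IsLocalization.lift_eq]
    change (g (X j)).snd = _
    simp [hg]

/-- The composite of a homomorphism to dual numbers with an algebra structure map. -/
noncomputable def dualNumberMap {L : Type*} (A : Type*) [Field L] [CommRing A] [Algebra L A]
    (θ : L →+* DualNumber L) (hθ : ∀ a, (θ a).fst = a) : L →+* DualNumber A where
  toFun c := inl (algebraMap L A c) + inr (algebraMap L A (θ c).snd)
  map_one' := by ext <;> simp
  map_zero' := by ext <;> simp
  map_add' a b := by ext <;> simp [Algebra.smul_def]
  map_mul' a b := by
    ext
    · simp
    · simp only [map_mul, snd_mul, hθ, map_add, fst_add, fst_inl, fst_inr, snd_add, snd_inl,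
        snd_inr, smul_eq_mul, MulOpposite.smul_eq_mul_unop, MulOpposite.unop_op]
      ring

/-- A derivation of the field of coefficients, given as a homomorphism to dual numbers, extends to
a graded derivation of a quotient by polynomials with constant coefficients. -/
lemma exists_dualNumber_hom_quotient {K L : Type*} [Field K] [Field L] [Algebra K L] {n m : ℕ}
    (θ : L →+* DualNumber L) (hθ : ∀ a, (θ a).fst = a)
    (hθK : ∀ c : K, (θ (algebraMap K L c)).snd = 0) (f : ℕ → MvPolynomial (Fin n) K)
    {I : Ideal (MvPolynomial (Fin n) L)}
    (hI : I = initialIdeal (fun k => MvPolynomial.map (algebraMap K L) (f k)) m) :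
    ∃ Δ : MvPolynomial (Fin n) L ⧸ I →+* DualNumber (MvPolynomial (Fin n) L ⧸ I),
      (∀ a, (Δ a).fst = a) ∧ (∀ j, (Δ (Ideal.Quotient.mk I (X j))).snd = 0) ∧
      (∀ c : L, (Δ (algebraMap L _ c)).snd = algebraMap L _ (θ c).snd) ∧
      ∀ d, ∀ a ∈ gradedPiece I d, (Δ a).snd ∈ gradedPiece I d := by
  set Ψ : MvPolynomial (Fin n) L →+* DualNumber (MvPolynomial (Fin n) L ⧸ I) :=
    eval₂Hom (S₁ := DualNumber (MvPolynomial (Fin n) L ⧸ I)) (dualNumberMap _ θ hθ)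
      fun j => inl (Ideal.Quotient.mk I (X j)) with hΨ
  have hfst (p) : (Ψ p).fst = Ideal.Quotient.mk I p := by
    have : (fstHom (MvPolynomial (Fin n) L ⧸ I) (MvPolynomial (Fin n) L ⧸ I)
        (MvPolynomial (Fin n) L ⧸ I)).toRingHom.comp Ψ = Ideal.Quotient.mk I := by
      refine MvPolynomial.ringHom_ext (fun c => ?_) fun j => ?_
      · simp [hΨ, dualNumberMap]
        rfl
      · simp [hΨ]
    exact DFunLike.congr_fun this p
  have hmap (p : MvPolynomial (Fin n) K) : Ψ (MvPolynomial.map (algebraMap K L) p) =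
      inl (Ideal.Quotient.mk I (MvPolynomial.map (algebraMap K L) p)) := by
    have : Ψ.comp (MvPolynomial.map (algebraMap K L)) = (inlHom _ _).comp
        ((Ideal.Quotient.mk I).comp (MvPolynomial.map (algebraMap K L))) := by
      refine MvPolynomial.ringHom_ext (fun c => ?_) fun j => ?_
      · simp [hΨ, dualNumberMap, hθK]
        rfl
      · simp [hΨ]
    exact DFunLike.congr_fun this p
  have hker : ∀ p ∈ I, Ψ p = 0 := by
    have : I ≤ RingHom.ker Ψ := by
      conv_lhs => rw [hI]
      refine Ideal.span_le.2 ?_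
      rintro _ ⟨k, hk, rfl⟩
      change Ψ (MvPolynomial.map (algebraMap K L) (f k)) = 0
      rw [hmap, Ideal.Quotient.eq_zero_iff_mem.2, inl_zero]
      rw [hI]
      exact Ideal.subset_span ⟨k, hk, rfl⟩
    exact this
  refine ⟨Ideal.Quotient.lift I Ψ hker, ?_, fun j => ?_, fun c => ?_, fun d => ?_⟩
  · intro a
    obtain ⟨p, rfl⟩ := Ideal.Quotient.mk_surjective a
    exact hfst p
  · simp [hΨ]
  · change (Ψ (C c)).snd = _
    simp [hΨ, dualNumberMap, Algebra.algebraMap_eq_smul_one]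
  · rintro _ ⟨p, hp, rfl⟩
    change (Ψ p).snd ∈ _
    rw [← support_sum_monomial_coeff p, map_sum, snd_sum]
    refine Submodule.sum_mem _ fun k hk => ?_
    have hkd : k.degree = d := by
      rw [Finsupp.degree_eq_weight_one]
      exact hp (mem_support_iff.1 hk)
    refine ⟨monomial k (θ (coeff k p)).snd, isHomogeneous_monomial _ hkd, ?_⟩
    have h1 : Ψ (monomial k 1) = inl (Ideal.Quotient.mk I (monomial k 1)) := by
      simpa using hmap (monomial k 1)
    have h2 (c : L) : monomial k c = C c * monomial k 1 := by rw [C_mul_monomial, mul_one]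
    have h3 : (Ψ (C (coeff k p))).snd = Ideal.Quotient.mk I (C (θ (coeff k p)).snd) := by
      simp only [hΨ, coe_eval₂Hom, eval₂_C]
      simp only [dualNumberMap, RingHom.coe_mk, MonoidHom.coe_mk, OneHom.coe_mk, snd_add, snd_inl,
        snd_inr, zero_add]
      rfl
    change Ideal.Quotient.mk I (monomial k _) = _
    rw [h2, h2 (coeff k p), map_mul, map_mul, h1, snd_mul, snd_inl, fst_inl, h3]
    simp [mul_comm]

end Derivations

section GenericLinearForm

variable {K : Type*} [Field K]

lemma mul_mem_gradedPiece {n i j : ℕ} {I : Ideal (MvPolynomial (Fin n) K)}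
    {a b : MvPolynomial (Fin n) K ⧸ I} (ha : a ∈ gradedPiece I i) (hb : b ∈ gradedPiece I j) :
    a * b ∈ gradedPiece I (i + j) := by
  obtain ⟨p, hp, rfl⟩ := ha
  obtain ⟨q, hq, rfl⟩ := hb
  exact ⟨p * q, IsHomogeneous.mul hp hq, map_mul (Ideal.Quotient.mk I) p q⟩

lemma mk_mem_gradedPiece {n i : ℕ} {I : Ideal (MvPolynomial (Fin n) K)}
    {p : MvPolynomial (Fin n) K} (hp : p.IsHomogeneous i) :
    Ideal.Quotient.mk I p ∈ gradedPiece I i := ⟨p, hp, rfl⟩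

lemma finite_gradedPiece {n i : ℕ} (I : Ideal (MvPolynomial (Fin n) K)) :
    Module.Finite K (gradedPiece I i) :=
  have := finite_homogeneousSubmodule (E := K) (σ := Fin n) i
  inferInstanceAs (Module.Finite K (Submodule.map _ _))

lemma snd_map_mul {A : Type*} [CommRing A] {Δ : A →+* DualNumber A} (h : ∀ a, (Δ a).fst = a)
    (a b : A) : (Δ (a * b)).snd = a * (Δ b).snd + b * (Δ a).snd := by
  rw [map_mul, TrivSqZeroExt.snd_mul, h, h, smul_eq_mul, op_smul_eq_mul, mul_comm b]

lemma snd_map_sum {A ι : Type*} [CommRing A] (Δ : A →+* DualNumber A) (s : Finset ι) (a : ι → A) :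
    (Δ (∑ i ∈ s, a i)).snd = ∑ i ∈ s, (Δ (a i)).snd := by
  rw [map_sum, TrivSqZeroExt.snd_sum]

open RingTheory.Sequence TrivSqZeroExt in
/-- The generic linear form on a complete intersection of five quadrics. -/
lemma exists_genericLinearForm [CharZero K] (f : ℕ → MvPolynomial (Fin 5) K)
    (hf : ∀ k < 5, (f k).IsHomogeneous 2)
    (hreg : IsWeaklyRegular (MvPolynomial (Fin 5) K) (List.ofFn fun i : Fin 5 => f i))
    {I : Ideal (MvPolynomial (Fin 5) (FractionRing (MvPolynomial (Fin 5) K)))}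
    (hI : I = initialIdeal (fun k =>
      MvPolynomial.map (algebraMap K (FractionRing (MvPolynomial (Fin 5) K))) (f k)) 5) :
    ∃ G : GenericLinearForm (FractionRing (MvPolynomial (Fin 5) K))
        (MvPolynomial (Fin 5) (FractionRing (MvPolynomial (Fin 5) K)) ⧸ I),
      G.piece = gradedPiece I ∧ (∀ v, G.lin v = Ideal.Quotient.mk I (linForm v)) ∧
      G.x = Ideal.Quotient.mk I (linForm fun i => algebraMap (MvPolynomial (Fin 5) K) _ (X i)) := by
  set L := FractionRing (MvPolynomial (Fin 5) K)
  set A := MvPolynomial (Fin 5) L ⧸ I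
  choose θ hθ hθK hθX using fun i : Fin 5 => exists_dualNumber_hom (K := K) i
  choose Δ hΔ hΔX hΔL hΔmem using fun i => exists_dualNumber_hom_quotient (θ i) (hθ i) (hθK i) f hI
  have hF : ∀ k < 5, (MvPolynomial.map (algebraMap K L) (f k)).IsHomogeneous 2 :=
    fun k hk => (hf k hk).map _
  have hFreg := isRegularUpTo_map (L := L) f hreg
  obtain ⟨-, h2, -, -, h5⟩ := finrank_gradedPiece hF hFreg
  rw [← hI] at h2 h5
  set lin : (Fin 5 → L) →ₗ[L] A := (Ideal.Quotient.mkₐ L I).toLinearMap ∘ₗ linForm with hlin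
  have hlin_apply (v) : lin v = Ideal.Quotient.mk I (linForm v) := rfl
  have hrange : LinearMap.range lin = gradedPiece I 1 := by
    refine le_antisymm ?_ ?_
    · rintro _ ⟨v, rfl⟩
      exact mk_mem_gradedPiece (linForm_isHomogeneous v)
    · rintro _ ⟨p, hp, rfl⟩
      obtain ⟨v, rfl⟩ := exists_linForm_eq hp
      exact ⟨v, rfl⟩
  have hinj : Function.Injective lin := by
    rw [injective_iff_map_eq_zero]
    intro v hv
    have h1 : linForm v ∈ idealPart
        (fun k => MvPolynomial.map (algebraMap K L) (f k)) 5 1 := by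
      refine mem_idealPart.2 ⟨?_, linForm_isHomogeneous v⟩
      rw [← hI]
      exact Ideal.Quotient.eq_zero_iff_mem.1 hv
    rw [idealPart_eq_bot hF (.inl (by norm_num)), Submodule.mem_bot] at h1
    exact linForm_injective (h1.trans (map_zero _).symm)
  let δ (a : A) : (Fin 5 → L) →ₗ[L] A := Fintype.linearCombination L fun i => (Δ i a).snd
  have hδ (a v) : δ a v = ∑ i, v i • (Δ i a).snd := rfl
  refine ⟨{ piece := gradedPiece I
            lin := lin
            x := Ideal.Quotient.mk I (linForm fun i => algebraMap (MvPolynomial (Fin 5) K) _ (X i))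
            δ := δ
            mul_mem := mul_mem_gradedPiece
            range_lin := hrange
            lin_injective := hinj
            x_mem := mk_mem_gradedPiece (linForm_isHomogeneous _)
            δ_x := ?_
            δ_mul := fun a b v => ?_
            δ_mem := fun {i a} v ha => ?_
            finrank_ann := fun {i a} ha ha0 => ?_
            finrank_two := h2
            finrank_five := h5 }, rfl, fun v => rfl, rfl⟩
  · refine LinearMap.ext fun v => ?_
    rw [hδ, hlin_apply, linForm_apply v, map_sum (Ideal.Quotient.mk I)]
    refine Finset.sum_congr rfl fun i _ => ?_
    have h1 (c : L) (j : Fin 5) : Ideal.Quotient.mk I (c • X j) =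
        algebraMap L A c * Ideal.Quotient.mk I (X j) := by
      rw [smul_eq_C_mul, map_mul]; rfl
    rw [h1, ← Algebra.smul_def, linForm_apply, map_sum (Ideal.Quotient.mk I), snd_map_sum]
    congr 1
    have h3 (j : Fin 5) : (Δ i (Ideal.Quotient.mk I
        (algebraMap (MvPolynomial (Fin 5) K) L (X j) • X j))).snd =
        if j = i then Ideal.Quotient.mk I (X j) else 0 := by
      rw [h1, snd_map_mul (hΔ i), hΔX, hΔL, hθX, mul_zero, zero_add]
      split_ifs
      · rw [map_one, mul_one]
      · rw [map_zero, mul_zero]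
    rw [Finset.sum_congr rfl fun j _ => h3 j]
    simp
  · simp only [hδ, snd_map_mul (hΔ _), smul_add, Finset.sum_add_distrib, Finset.mul_sum,
      mul_smul_comm]
  · rw [hδ]
    exact Submodule.sum_mem _ fun j _ => Submodule.smul_mem _ _ (hΔmem j i a ha)
  · obtain ⟨p, hp, rfl⟩ := ha
    rw [← hrange]
    set N := LinearMap.ker (LinearMap.mulRight L ((Ideal.Quotient.mkₐ L I).toLinearMap p))
    rw [← Submodule.map_comap_eq, ← (Submodule.equivMapOfInjective _ hinj _).finrank_eq]
    refine finrank_le_of_linForm_mul_mem hF hFreg hp ?_ _ fun c hc => ?_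
    · rw [← hI]
      exact fun h => ha0 (Ideal.Quotient.eq_zero_iff_mem.2 h)
    · rw [← hI]
      refine Ideal.Quotient.eq_zero_iff_mem.1 ?_
      rw [map_mul]
      exact hc

end GenericLinearForm

section Specialization

universe u

variable {K : Type u} [Field K] {n : ℕ}

lemma mk_map_eq_of_mk_eq {E : Type*} [Field E] [Algebra K E] {I : Ideal (MvPolynomial (Fin n) K)}
    {J : Ideal (MvPolynomial (Fin n) E)} (h : I ≤ J.comap (MvPolynomial.map (algebraMap K E)))
    {ι : Type*} [Fintype ι] {B : ι → MvPolynomial (Fin n) K} {p : MvPolynomial (Fin n) K}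
    {c : ι → K} (hc : ∑ l, c l • Ideal.Quotient.mk I (B l) = Ideal.Quotient.mk I p)
    (a : E) : ∑ l, (a * algebraMap K E (c l)) •
        Ideal.Quotient.mk J (MvPolynomial.map (algebraMap K E) (B l)) =
      a • Ideal.Quotient.mk J (MvPolynomial.map (algebraMap K E) p) := by
  have hsmul (a : E) (q : MvPolynomial (Fin n) E) :
      a • Ideal.Quotient.mk J q = Ideal.Quotient.mk J (C a * q) := by
    rw [← smul_eq_C_mul]; rfl
  have hsmul' (a : K) (q : MvPolynomial (Fin n) K) :
      a • Ideal.Quotient.mk I q = Ideal.Quotient.mk I (C a * q) := by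
    rw [← smul_eq_C_mul]; rfl
  simp only [hsmul', ← map_sum] at hc
  have h1 := h (Ideal.Quotient.eq.1 hc)
  rw [Ideal.mem_comap, map_sub] at h1
  have h2 := Ideal.Quotient.eq.2 h1
  simp only [map_sum, map_mul, map_C] at h2
  rw [hsmul, map_mul, ← h2, Finset.mul_sum]
  refine Finset.sum_congr rfl fun l _ => ?_
  rw [hsmul]
  simp only [map_mul, mul_assoc]

/-- Polynomials spanning a graded piece of a quotient still do so over a larger field. -/
lemma gradedPiece_le_span_map {E : Type*} [Field E] [Algebra K E]
    {I : Ideal (MvPolynomial (Fin n) K)} {J : Ideal (MvPolynomial (Fin n) E)}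
    (h : I ≤ J.comap (MvPolynomial.map (algebraMap K E))) {ι : Type*} [Fintype ι]
    {B : ι → MvPolynomial (Fin n) K} {e : ℕ}
    (hB : gradedPiece I e ≤ Submodule.span K (Set.range fun l => Ideal.Quotient.mk I (B l))) :
    gradedPiece J e ≤ Submodule.span E
      (Set.range fun l => Ideal.Quotient.mk J (MvPolynomial.map (algebraMap K E) (B l))) := by
  rintro _ ⟨p, hp, rfl⟩
  rw [← support_sum_monomial_coeff p, map_sum]
  refine Submodule.sum_mem _ fun k hk => ?_
  have hkd : k.degree = e := by
    rw [Finsupp.degree_eq_weight_one]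
    exact hp (mem_support_iff.1 hk)
  obtain ⟨c, hc⟩ := (Submodule.mem_span_range_iff_exists_fun K).1
    (hB (mk_mem_gradedPiece (I := I) (isHomogeneous_monomial (1 : K) hkd)))
  refine (Submodule.mem_span_range_iff_exists_fun E).2
    ⟨_, (mk_map_eq_of_mk_eq h hc (coeff k p)).trans ?_⟩
  rw [map_monomial, map_one]
  change Ideal.Quotient.mk J (coeff k p • monomial k 1) = Ideal.Quotient.mk J _
  rw [smul_monomial, smul_eq_mul, mul_one]

/-- The matrix, with entries in the coordinate ring of linear forms, of the bilinear form obtained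
from multiplication by a power of a linear form. -/
lemma exists_matrix {I : Ideal (MvPolynomial (Fin n) K)} {d s e : ℕ} (hs : s + (e + e) = d)
    {ω : MvPolynomial (Fin n) K}
    (hω : gradedPiece I d ≤ Submodule.span K (Set.range fun _ : Unit => Ideal.Quotient.mk I ω))
    {ι : Type*} {B : ι → MvPolynomial (Fin n) K} (hB : ∀ l, (B l).IsHomogeneous e) :
    ∃ M : Matrix ι ι (MvPolynomial (Fin n) K), ∀ (E : Type u) [Field E] [Algebra K E]
      (J : Ideal (MvPolynomial (Fin n) E)), I ≤ J.comap (MvPolynomial.map (algebraMap K E)) →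
      ∀ (p : Fin n → E) (l k : ι), Ideal.Quotient.mk J (linForm p ^ s *
        (MvPolynomial.map (algebraMap K E) (B l) * MvPolynomial.map (algebraMap K E) (B k))) =
      aeval p (M l k) • Ideal.Quotient.mk J (MvPolynomial.map (algebraMap K E) ω) := by
  have hφ (k : Fin n →₀ ℕ) (hk : k.degree = d) : ∃ c : K, ∑ _ : Unit, c • Ideal.Quotient.mk I ω =
      Ideal.Quotient.mk I (monomial k 1) := by
    obtain ⟨c, hc⟩ := (Submodule.mem_span_range_iff_exists_fun K).1
      (hω (mk_mem_gradedPiece (I := I) (isHomogeneous_monomial (1 : K) hk)))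
    exact ⟨c (), hc⟩
  choose! φ hφ using hφ
  let Q (l k : ι) : MvPolynomial (Fin n) (MvPolynomial (Fin n) K) :=
    (∑ i, C (X i) * X i) ^ s * (MvPolynomial.map C (B l) * MvPolynomial.map C (B k))
  have hQ (l k) : (Q l k).IsHomogeneous d := by
    rw [← hs]
    refine .mul ?_ (((hB l).map _).mul ((hB k).map _))
    have h1 : (∑ i, C (X i) * X i :
        MvPolynomial (Fin n) (MvPolynomial (Fin n) K)).IsHomogeneous 1 :=
      .sum _ _ _ fun i _ => (isHomogeneous_X _ i).C_mul (X i)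
    simpa using h1.pow s
  refine ⟨.of fun l k => ∑ m ∈ (Q l k).support, coeff m (Q l k) * C (φ m), ?_⟩
  intro E _ _ J h p l k
  have h1 : MvPolynomial.map (aeval p : MvPolynomial (Fin n) K →ₐ[K] E).toRingHom (Q l k) =
      linForm p ^ s *
        (MvPolynomial.map (algebraMap K E) (B l) * MvPolynomial.map (algebraMap K E) (B k)) := by
    have h2 : (aeval p : MvPolynomial (Fin n) K →ₐ[K] E).toRingHom.comp C = algebraMap K E := by
      ext; simp
    simp only [Q, map_mul, map_pow, map_sum, map_C, map_X, MvPolynomial.map_map, h2, linForm_apply,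
      smul_eq_C_mul]
    simp
  rw [← h1]
  conv_lhs => rw [← support_sum_monomial_coeff (Q l k)]
  rw [map_sum, map_sum, Matrix.of_apply, map_sum, Finset.sum_smul]
  refine Finset.sum_congr rfl fun m hm => ?_
  have hmd : m.degree = d := by
    rw [Finsupp.degree_eq_weight_one]
    exact hQ l k (mem_support_iff.1 hm)
  have h3 := mk_map_eq_of_mk_eq h (c := fun _ : Unit => φ m) (hφ m hmd) (aeval p (coeff m (Q l k)))
  rw [Fintype.sum_unique] at h3
  rw [map_mul, aeval_C, h3, map_monomial, map_monomial, map_one]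
  change _ = Ideal.Quotient.mk J (_ • monomial m 1)
  rw [smul_monomial, smul_eq_mul, mul_one]
  rfl

lemma exists_basis_gradedPiece (I : Ideal (MvPolynomial (Fin n) K)) (e : ℕ) {ι : Type*} [Fintype ι]
    (hι : Module.finrank K (gradedPiece I e) = Fintype.card ι) :
    ∃ B : ι → MvPolynomial (Fin n) K, (∀ l, (B l).IsHomogeneous e) ∧
      gradedPiece I e ≤ Submodule.span K (Set.range fun l => Ideal.Quotient.mk I (B l)) := by
  have := finite_gradedPiece (i := e) I
  let b := (Module.finBasisOfFinrankEq K (gradedPiece I e) hι).reindex (Fintype.equivFin ι).symm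
  choose B hB hBb using fun l => (b l).2
  refine ⟨B, hB, fun y hy => ?_⟩
  have h1 : (fun l => Ideal.Quotient.mk I (B l)) = (gradedPiece I e).subtype ∘ b := funext hBb
  rw [h1, Set.range_comp, ← Submodule.map_span, b.span_eq]
  exact ⟨⟨y, hy⟩, trivial, rfl⟩

lemma mul_pow_mul_sum_eq {E : Type u} [Field E] [Algebra K E] {J : Ideal (MvPolynomial (Fin n) E)}
    {ι : Type*} [Fintype ι] {B : ι → MvPolynomial (Fin n) E} {w : MvPolynomial (Fin n) E ⧸ J}
    {M : Matrix ι ι (MvPolynomial (Fin n) K)} {s : ℕ} {p : Fin n → E}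
    (hM : ∀ l k, Ideal.Quotient.mk J (linForm p ^ s * (B l * B k)) = aeval p (M l k) • w)
    (v : ι → E) (l : ι) :
    Ideal.Quotient.mk J (B l) *
        (Ideal.Quotient.mk J (linForm p) ^ s * ∑ k, v k • Ideal.Quotient.mk J (B k)) =
      ((M.map (aeval p : _ →ₐ[K] E)).mulVec v l) • w := by
  simp only [Matrix.mulVec, dotProduct, Matrix.map_apply, Finset.sum_smul, Finset.mul_sum]
  refine Finset.sum_congr rfl fun k _ => ?_
  rw [mul_comm _ (v k), mul_smul, ← hM, mul_smul_comm, mul_smul_comm, map_mul, map_mul, map_pow]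
  congr 1
  ring

/-- If multiplication by a power of a linear form over some extension field is injective, then so is
multiplication by the power of a linear form outside a hypersurface. -/
lemma exists_ne_zero_of_injective {I : Ideal (MvPolynomial (Fin n) K)} {L : Type u} [Field L]
    [Algebra K L] {J : Ideal (MvPolynomial (Fin n) L)}
    (h : I ≤ J.comap (MvPolynomial.map (algebraMap K L))) {d s e : ℕ} (hs : s + (e + e) = d)
    (hd : Module.finrank K (gradedPiece I d) = 1)
    (he : Module.finrank L (gradedPiece J e) = Module.finrank K (gradedPiece I e)) (t : Fin n → L)
    (hinj : ∀ y ∈ gradedPiece J e, Ideal.Quotient.mk J (linForm t) ^ s * y = 0 → y = 0)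
    (hnd : ∀ z ∈ gradedPiece J (s + e), (∀ w ∈ gradedPiece J e, w * z = 0) → z = 0) :
    ∃ D : MvPolynomial (Fin n) K, D ≠ 0 ∧ ∀ p : Fin n → K, eval p D ≠ 0 →
      ∀ y ∈ gradedPiece I e, Ideal.Quotient.mk I (linForm p) ^ s * y = 0 → y = 0 := by
  obtain ⟨ω, -, hω⟩ := exists_basis_gradedPiece (ι := Unit) I d (by simpa using hd)
  obtain ⟨N, hN⟩ : ∃ N, Module.finrank K (gradedPiece I e) = N := ⟨_, rfl⟩
  obtain ⟨B, hB, hspan⟩ := exists_basis_gradedPiece (ι := Fin N) I e (by rw [hN, Fintype.card_fin])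
  obtain ⟨M, hM⟩ := exists_matrix (ω := ω ()) hs hω hB
  refine ⟨M.det, fun hdet => ?_, fun p hp y hy hxy => ?_⟩
  · have hspanL := gradedPiece_le_span_map h hspan
    have hdet' : (M.map (aeval t : _ →ₐ[K] L)).det = 0 := by
      rw [← AlgHom.mapMatrix_apply, ← AlgHom.map_det, hdet, map_zero]
    obtain ⟨v, hv0, hv⟩ := Matrix.exists_mulVec_eq_zero_iff.2 hdet'
    set y := ∑ k, v k • Ideal.Quotient.mk J (MvPolynomial.map (algebraMap K L) (B k)) with hy
    have hye : y ∈ gradedPiece J e := Submodule.sum_mem _ fun k _ =>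
      Submodule.smul_mem _ _ (mk_mem_gradedPiece ((hB k).map _))
    have hxs : Ideal.Quotient.mk J (linForm t) ^ s ∈ gradedPiece J s := by
      rw [← map_pow]
      refine mk_mem_gradedPiece ?_
      simpa using (linForm_isHomogeneous t).pow s
    have hy0 : y = 0 := by
      refine hinj y hye (hnd _ (mul_mem_gradedPiece hxs hye) fun w hw => ?_)
      obtain ⟨c, rfl⟩ := (Submodule.mem_span_range_iff_exists_fun L).1 (hspanL hw)
      rw [Finset.sum_mul]
      refine Finset.sum_eq_zero fun l _ => ?_
      rw [smul_mul_assoc, mul_pow_mul_sum_eq (hM L J h t), hv, Pi.zero_apply, zero_smul, smul_zero]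
    have hind : LinearIndependent L
        fun k => Ideal.Quotient.mk J (MvPolynomial.map (algebraMap K L) (B k)) := by
      refine linearIndependent_iff_card_le_finrank_span.2 ?_
      rw [Fintype.card_fin]
      refine (hN.symm.trans he.symm).le.trans ?_
      have : FiniteDimensional L (Submodule.span L (Set.range fun k =>
        Ideal.Quotient.mk J (MvPolynomial.map (algebraMap K L) (B k)))) :=
        FiniteDimensional.span_of_finite _ (Set.finite_range _)
      exact Submodule.finrank_mono hspanL
    exact hv0 (funext (Fintype.linearIndependent_iff.1 hind v hy0))
  · have hI : I ≤ I.comap (MvPolynomial.map (algebraMap K K)) := fun q hq => by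
      simpa [Ideal.mem_comap, MvPolynomial.map_id] using hq
    obtain ⟨v, rfl⟩ := (Submodule.mem_span_range_iff_exists_fun K).1 (hspan hy)
    have hω0 : Ideal.Quotient.mk I (ω ()) ≠ 0 := by
      intro h0
      have : gradedPiece I d = ⊥ := by
        rw [eq_bot_iff]
        refine hω.trans (Submodule.span_le.2 ?_)
        rintro _ ⟨_, rfl⟩
        exact h0
      rw [this, finrank_bot] at hd
      exact zero_ne_one hd
    have hdet : (M.map (aeval p : _ →ₐ[K] K)).det ≠ 0 := by
      rw [← AlgHom.mapMatrix_apply, ← AlgHom.map_det]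
      simpa [aeval_eq_eval] using hp
    have hMK := hM K I hI p
    simp only [Algebra.algebraMap_self, MvPolynomial.map_id] at hMK
    have hv : v = 0 := by
      refine Matrix.eq_zero_of_mulVec_eq_zero hdet (funext fun l => ?_)
      have := mul_pow_mul_sum_eq hMK v l
      rw [hxy, mul_zero] at this
      exact (smul_eq_zero.1 this.symm).resolve_right hω0
    simp [hv]

end Specialization

lemma exists_mul_eq_of_injective {K : Type*} [Field K] {n : ℕ} {I : Ideal (MvPolynomial (Fin n) K)}
    {s e : ℕ} {a : MvPolynomial (Fin n) K ⧸ I} (ha : a ∈ gradedPiece I s)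
    (h : Module.finrank K (gradedPiece I (s + e)) = Module.finrank K (gradedPiece I e))
    (hinj : ∀ y ∈ gradedPiece I e, a * y = 0 → y = 0) :
    ∀ z ∈ gradedPiece I (s + e), ∃ y ∈ gradedPiece I e, a * y = z := by
  have hfin := finite_gradedPiece (i := s + e) I
  set φ := (LinearMap.mulLeft K a).domRestrict (gradedPiece I e) with hφ
  have hφinj : Function.Injective φ := by
    rw [injective_iff_map_eq_zero]
    exact fun y hy => Subtype.ext (hinj y y.2 hy)
  have hle : LinearMap.range φ ≤ gradedPiece I (s + e) := by
    rintro _ ⟨y, rfl⟩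
    exact mul_mem_gradedPiece ha y.2
  have heq := Submodule.eq_of_le_of_finrank_eq hle
    ((LinearMap.finrank_range_of_inj hφinj).trans h.symm)
  intro z hz
  rw [← heq] at hz
  obtain ⟨y, rfl⟩ := hz
  exact ⟨y, y.2, rfl⟩

/-- **Theorem C.** Let `S = K[x₀,…,x₄]` over an algebraically closed field of
characteristic `0`, and let `I` be generated by a regular sequence of five homogeneous
quadrics.  Then `R = S/I` (an Artinian Gorenstein algebra with socle in degree `5`)
satisfies the strong Lefschetz property: there is `x ∈ R¹` with
`x³· : R¹ → R⁴` and `x· : R² → R³` both isomorphisms. -/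
theorem slp_complete_intersection_quadrics_five_vars
    {K : Type*} [Field K] [IsAlgClosed K] [CharZero K]
    (f : Fin 5 → MvPolynomial (Fin 5) K)
    (hf : ∀ i, (f i).IsHomogeneous 2)
    (hreg : RingTheory.Sequence.IsRegular (MvPolynomial (Fin 5) K) (List.ofFn f))
    (I : Ideal (MvPolynomial (Fin 5) K)) (hI : I = Ideal.span (Set.range f)) :
    ∃ x ∈ gradedPiece I 1,
      ((∀ y ∈ gradedPiece I 1, x ^ 3 * y = 0 → y = 0) ∧
        (∀ z ∈ gradedPiece I 4, ∃ y ∈ gradedPiece I 1, x ^ 3 * y = z)) ∧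
      ((∀ y ∈ gradedPiece I 2, x * y = 0 → y = 0) ∧
        (∀ z ∈ gradedPiece I 3, ∃ y ∈ gradedPiece I 2, x * y = z)) := by
  obtain ⟨f, rfl⟩ : ∃ g : ℕ → MvPolynomial (Fin 5) K, f = fun i : Fin 5 => g i :=
    ⟨fun k => if h : k < 5 then f ⟨k, h⟩ else 0, by ext1 i; simp⟩
  have hf' : ∀ k < 5, (f k).IsHomogeneous 2 := fun k hk => hf ⟨k, hk⟩
  have hreg' := hreg.toIsWeaklyRegular
  obtain rfl : I = initialIdeal f 5 := by
    rw [hI, initialIdeal]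
    congr 1
    ext q
    exact ⟨fun ⟨i, hi⟩ => ⟨i, i.2, hi⟩, fun ⟨k, hk, hq⟩ => ⟨⟨k, hk⟩, hq⟩⟩
  let L := FractionRing (MvPolynomial (Fin 5) K)
  set J := initialIdeal (fun k => MvPolynomial.map (algebraMap K L) (f k)) 5 with hJ
  have hle : initialIdeal f 5 ≤ J.comap (MvPolynomial.map (algebraMap K L)) := by
    refine Ideal.span_le.2 ?_
    rintro _ ⟨k, hk, rfl⟩
    exact Ideal.subset_span ⟨k, hk, rfl⟩
  have hcharL : CharZero L := charZero_of_injective_algebraMap (algebraMap K L).injective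
  obtain ⟨G, hpiece, hlin, hx⟩ := exists_genericLinearForm f hf' hreg' hJ
  obtain ⟨d1, d2, d3, d4, d5⟩ :=
    finrank_gradedPiece hf' (isRegularUpTo_of_isWeaklyRegular f hreg')
  obtain ⟨e1, e2, -⟩ := finrank_gradedPiece (fun k hk => (hf' k hk).map (algebraMap K L))
    (isRegularUpTo_map (L := L) f hreg')
  have hnd1 : ∀ z ∈ gradedPiece J 4, (∀ w ∈ gradedPiece J 1, w * z = 0) → z = 0 := by
    intro z hz h
    rw [← hpiece] at hz h
    exact G.eq_zero_of_lin_mul hz (by norm_num) fun v => h _ (G.lin_mem v)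
  have hnd2 : ∀ z ∈ gradedPiece J 3, (∀ w ∈ gradedPiece J 2, w * z = 0) → z = 0 := by
    intro z hz h
    rw [← hpiece] at hz h
    refine G.eq_zero_of_lin_mul hz (by norm_num) fun v => ?_
    refine G.eq_zero_of_lin_mul (G.mul_mem (G.lin_mem v) hz) (by norm_num) fun w => ?_
    rw [← mul_assoc]
    exact h _ (G.mul_mem (G.lin_mem w) (G.lin_mem v))
  obtain ⟨D₁, hD₁, h₁⟩ := exists_ne_zero_of_injective hle (s := 3) (e := 1) rfl d5
    (e1.trans d1.symm) (fun i => algebraMap (MvPolynomial (Fin 5) K) L (X i))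
    (fun y hy h => by
      rw [← hpiece] at hy
      rw [← hx] at h
      exact G.eq_zero_of_x_pow_mul hy h) hnd1
  obtain ⟨D₂, hD₂, h₂⟩ := exists_ne_zero_of_injective hle (s := 1) (e := 2) rfl d5
    (e2.trans d2.symm) (fun i => algebraMap (MvPolynomial (Fin 5) K) L (X i))
    (fun y hy h => by
      rw [← hpiece] at hy
      rw [← hx, pow_one] at h
      exact G.eq_zero_of_x_mul hy h) hnd2
  obtain ⟨p, hp⟩ : ∃ p : Fin 5 → K, eval p (D₁ * D₂) ≠ 0 := by
    by_contra! h
    exact mul_ne_zero hD₁ hD₂ (MvPolynomial.funext fun p => by rw [h, map_zero])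
  rw [map_mul] at hp
  have hx1 : Ideal.Quotient.mk (initialIdeal f 5) (linForm p) ∈ gradedPiece (initialIdeal f 5) 1 :=
    mk_mem_gradedPiece (linForm_isHomogeneous p)
  have hx3 : Ideal.Quotient.mk (initialIdeal f 5) (linForm p) ^ 3 ∈
      gradedPiece (initialIdeal f 5) 3 := by
    rw [← map_pow]
    exact mk_mem_gradedPiece ((linForm_isHomogeneous p).pow 3)
  have h₁ := h₁ p (left_ne_zero_of_mul hp)
  have h₂ := h₂ p (right_ne_zero_of_mul hp)
  rw [pow_one] at h₂
  exact ⟨_, hx1, ⟨h₁, exists_mul_eq_of_injective (s := 3) (e := 1) hx3 (d4.trans d1.symm) h₁⟩,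
    h₂, exists_mul_eq_of_injective (s := 1) (e := 2) hx1 (d3.trans d2.symm) h₂⟩
end

section
/- Let K be an algebraically closed field of characteristic 0 and let F ∈ K[x₀,…,x₄] be a homogeneous cubic whose partial derivatives ∂F/∂x₀,…,∂F/∂x₄ have no common zero in K⁵ other than the origin (i.e., the cubic threefold V(F) ⊂ ℙ⁴ is smooth). Let R = S/J(F) be the Jacobian ring, where J(F) is the ideal generated by the partial derivatives of F. Then R satisfies the strong Lefschetz property: there exists x ∈ R¹ such that both multiplication maps x³· : R¹ → R⁴ and x· : R² → R³ are isomorphisms of K-vector spaces. -/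
section StrongLefschetz

open MvPolynomial TensorProduct

section Gorenstein

variable {K : Type*} [Field K] {σ : Type*}

theorem mem_span_X_pow_of_X_mul_mem (N : ℕ) (k : σ) (f : MvPolynomial σ K)
    (h : X k * f ∈ Ideal.span ((fun i : σ => (X i : MvPolynomial σ K) ^ N) '' {i | i ≠ k})) :
    f ∈ Ideal.span ((fun i : σ => (X i : MvPolynomial σ K) ^ N) '' {i | i ≠ k}) := by
  have key : (fun i : σ => (X i : MvPolynomial σ K) ^ N) '' {i | i ≠ k} =
      (fun s => monomial s (1 : K)) '' ((fun i => Finsupp.single i N) '' {i | i ≠ k}) := by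
    rw [Set.image_image]
    simp [X_pow_eq_monomial]
  rw [key, mem_ideal_span_monomial_image] at h ⊢
  intro m hm
  have hm' : Finsupp.single k 1 + m ∈ (X k * f).support := by
    rw [mem_support_iff, coeff_X_mul]
    exact mem_support_iff.1 hm
  obtain ⟨s, ⟨i, hi, rfl⟩, hs⟩ := h _ hm'
  refine ⟨_, ⟨i, hi, rfl⟩, ?_⟩
  rw [Finsupp.single_le_iff] at hs ⊢
  rwa [Finsupp.add_apply, Finsupp.single_eq_of_ne hi, zero_add] at hs

variable [Fintype σ] [DecidableEq σ]

theorem det_sub_det_mem_span_X_pow (N : ℕ) (A B : Matrix σ σ (MvPolynomial σ K))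
    (hA : ∀ i, ∑ j, A i j * X j = X i ^ N) (hB : ∀ i, ∑ j, B i j * X j = X i ^ N) :
    A.det - B.det ∈ Ideal.span (Set.range fun i : σ => (X i : MvPolynomial σ K) ^ N) := by
  suffices H : ∀ s : Finset σ, (Matrix.of fun i => if i ∈ s then A i else B i).det - B.det ∈
      Ideal.span (Set.range fun i : σ => (X i : MvPolynomial σ K) ^ N) by
    have := H Finset.univ
    simp only [Finset.mem_univ, if_true] at this
    exact this
  intro s
  induction s using Finset.induction_on with
  | empty =>
    simp only [Finset.notMem_empty, if_false]
    rw [show Matrix.of (fun i => B i) = B from rfl, sub_self]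
    exact Ideal.zero_mem _
  | insert k s hk ih =>
    set C : Matrix σ σ (MvPolynomial σ K) := Matrix.of fun i => if i ∈ s then A i else B i
      with hC
    have hCx : ∀ i, ∑ j, C i j * X j = X i ^ N := by
      intro i
      by_cases h : i ∈ s <;> simp [hC, h, hA, hB]
    set E := C.updateRow k (A k - B k) with hE
    have h1 : (Matrix.of fun i => if i ∈ insert k s then A i else B i) = C.updateRow k (A k) := by
      ext i j
      by_cases h : i = k
      · subst h; simp
      · simp [hC, h]
    have h2 : C = C.updateRow k (B k) := by
      ext i j
      by_cases h : i = k
      · subst h; simp [hC, hk]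
      · simp [h]
    have h3 : (C.updateRow k (A k)).det = E.det + C.det := by
      conv_rhs => rw [h2]
      rw [hE, h2, Matrix.updateRow_idem, Matrix.updateRow_idem, Matrix.updateRow_idem,
        ← Matrix.det_updateRow_add, sub_add_cancel]
    have h4 : E.det ∈
        Ideal.span ((fun i : σ => (X i : MvPolynomial σ K) ^ N) '' {i | i ≠ k}) := by
      apply mem_span_X_pow_of_X_mul_mem
      have h5 : X k * E.det = ∑ i, E.adjugate k i * ∑ j, E i j * X j := by
        have h6 := congrFun (congrArg (fun M => Matrix.mulVec M X) E.adjugate_mul) k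
        simp only [← Matrix.mulVec_mulVec, Matrix.smul_mulVec, Matrix.one_mulVec] at h6
        rw [Pi.smul_apply, smul_eq_mul] at h6
        rw [mul_comm, ← h6]
        rfl
      rw [h5]
      refine Ideal.sum_mem _ fun i _ => Ideal.mul_mem_left _ _ ?_
      by_cases h : i = k
      · subst h
        have : ∑ j, E i j * X j = 0 := by
          simp [hE, sub_mul, Finset.sum_sub_distrib, hA, hB]
        rw [this]
        exact Ideal.zero_mem _
      · have : ∑ j, E i j * X j = X i ^ N := by
          rw [← hCx i]
          simp [hE, h]
        rw [this]
        exact Ideal.subset_span ⟨i, h, rfl⟩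
    rw [h1, h3, add_sub_assoc]
    exact Ideal.add_mem _ (Ideal.span_mono (Set.image_subset_range _ _) h4) ih

theorem det_mul_mem_of_mem_span (N : ℕ) (M : Matrix σ σ (MvPolynomial σ K))
    (q : σ → MvPolynomial σ K) (hM : ∀ i, ∑ j, M i j * q j = X i ^ N) {f : MvPolynomial σ K}
    (hf : f ∈ Ideal.span (Set.range q)) :
    M.det * f ∈ Ideal.span (Set.range fun i : σ => (X i : MvPolynomial σ K) ^ N) := by
  induction hf using Submodule.span_induction with
  | mem f hf =>
    obtain ⟨k, rfl⟩ := hf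
    have h6 := congrFun (congrArg (fun A => Matrix.mulVec A q) M.adjugate_mul) k
    simp only [← Matrix.mulVec_mulVec, Matrix.smul_mulVec, Matrix.one_mulVec] at h6
    rw [Pi.smul_apply, smul_eq_mul] at h6
    rw [← h6]
    refine Ideal.sum_mem _ fun i _ => Ideal.mul_mem_left _ _ ?_
    change ∑ j, M i j * q j ∈ _
    rw [hM]
    exact Ideal.subset_span ⟨i, rfl⟩
  | zero => simp
  | add f g _ _ hf hg => rw [mul_add]; exact Ideal.add_mem _ hf hg
  | smul a f _ hf => rw [smul_eq_mul, mul_left_comm]; exact Ideal.mul_mem_left _ _ hf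

theorem det_notMem_span (N : ℕ) (M D : Matrix σ σ (MvPolynomial σ K))
    (q : σ → MvPolynomial σ K) (hM : ∀ i, ∑ j, M i j * q j = X i ^ (N + 1))
    (hD : ∀ i, ∑ j, D i j * X j = q i) :
    D.det ∉ Ideal.span (Set.range q) := by
  intro h
  have h1 := det_mul_mem_of_mem_span (N + 1) M q hM h
  rw [← Matrix.det_mul] at h1
  have h2 := det_sub_det_mem_span_X_pow (N + 1) (M * D)
    (Matrix.diagonal fun i : σ => (X i : MvPolynomial σ K) ^ N) (by
      intro i
      rw [← hM i]
      simp_rw [← hD]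
      have := congrFun (Matrix.mulVec_mulVec (X : σ → MvPolynomial σ K) M D) i
      exact this.symm) (by
      intro i
      rw [Finset.sum_eq_single i]
      · simp [pow_succ]
      · intro j _ hj; rw [Matrix.diagonal_apply_ne' _ hj, zero_mul]
      · simp)
  have h3 := (Submodule.sub_mem_iff_right _ h1).1 h2
  rw [Matrix.det_diagonal] at h3
  have key : (Set.range fun i : σ => (X i : MvPolynomial σ K) ^ (N + 1)) =
      (fun s => monomial s (1 : K)) '' (Set.range fun i => Finsupp.single i (N + 1)) := by
    rw [← Set.range_comp]
    simp [Function.comp_def, X_pow_eq_monomial]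
  rw [key, mem_ideal_span_monomial_image] at h3
  have h4 : ∏ i : σ, (X i : MvPolynomial σ K) ^ N =
      monomial (∑ i : σ, Finsupp.single i N) 1 := by
    simp_rw [X_pow_eq_monomial]
    rw [monomial_sum_one]
  rw [h4] at h3
  obtain ⟨s, ⟨i, rfl⟩, hs⟩ := h3 (∑ i : σ, Finsupp.single i N) (by simp)
  rw [Finsupp.single_le_iff, Finsupp.finsetSum_apply] at hs
  rw [Finset.sum_eq_single i] at hs
  · simp at hs
  · intro j _ hj; rw [Finsupp.single_eq_of_ne hj.symm]
  · simp

end Gorenstein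

section Bezoutian

variable {K : Type*} [Field K] {σ : Type*} [Fintype σ] [DecidableEq σ]

/-- The Bezoutian matrix `D(x) + D(y)` of a system of quadrics `q i = ∑ j, D i j * X j`. -/
noncomputable def bezoutian (D : Matrix σ σ (MvPolynomial σ K)) :
    Matrix σ σ (MvPolynomial σ K ⊗[K] MvPolynomial σ K) :=
  Matrix.of fun i j => D i j ⊗ₜ 1 + 1 ⊗ₜ D i j

theorem bezoutian_det_mul_sub_mem (D : Matrix σ σ (MvPolynomial σ K)) (q : σ → MvPolynomial σ K)
    (hD : ∀ i, ∑ j, D i j * X j = q i)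
    (hsymm : ∀ i, ∑ j, D i j ⊗ₜ[K] (X j : MvPolynomial σ K) = ∑ j, X j ⊗ₜ[K] D i j)
    (b : MvPolynomial σ K) :
    (b ⊗ₜ[K] (1 : MvPolynomial σ K) - 1 ⊗ₜ[K] b) * (bezoutian D).det ∈
      Ideal.span (Set.range fun i => q i ⊗ₜ[K] (1 : MvPolynomial σ K) - 1 ⊗ₜ[K] q i) := by
  have key : ∀ i, ∑ j, bezoutian D i j * (X j ⊗ₜ[K] (1 : MvPolynomial σ K) - 1 ⊗ₜ[K] X j) =
      q i ⊗ₜ[K] (1 : MvPolynomial σ K) - 1 ⊗ₜ[K] q i := by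
    intro i
    simp only [bezoutian, Matrix.of_apply, add_mul, mul_sub, Algebra.TensorProduct.tmul_mul_tmul,
      one_mul, mul_one, Finset.sum_add_distrib, Finset.sum_sub_distrib]
    rw [← TensorProduct.sum_tmul, ← TensorProduct.tmul_sum, hD, hsymm]
    abel
  induction b using MvPolynomial.induction_on with
  | C a =>
    have : (C a : MvPolynomial σ K) = a • 1 := by rw [smul_eq_C_mul, mul_one]
    rw [this, TensorProduct.smul_tmul, sub_self, zero_mul]
    exact Ideal.zero_mem _
  | add f g hf hg =>
    rw [TensorProduct.add_tmul, TensorProduct.tmul_add, add_sub_add_comm, add_mul]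
    exact Ideal.add_mem _ hf hg
  | mul_X f j hf =>
    have e1 : (f * X j) ⊗ₜ[K] (1 : MvPolynomial σ K) = (f ⊗ₜ 1) * (X j ⊗ₜ 1) := by simp
    have e2 : (1 : MvPolynomial σ K) ⊗ₜ[K] (f * X j) = (1 ⊗ₜ f) * (1 ⊗ₜ X j) := by simp
    have e3 : ((f * X j) ⊗ₜ[K] (1 : MvPolynomial σ K) - 1 ⊗ₜ[K] (f * X j)) *
        (bezoutian D).det =
        (X j ⊗ₜ[K] 1) * ((f ⊗ₜ[K] (1 : MvPolynomial σ K) - 1 ⊗ₜ[K] f) * (bezoutian D).det) +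
        (1 ⊗ₜ f) * ((bezoutian D).det * (X j ⊗ₜ[K] 1 - 1 ⊗ₜ[K] X j)) := by
      rw [e1, e2]; ring
    rw [e3]
    refine Ideal.add_mem _ (Ideal.mul_mem_left _ _ hf) (Ideal.mul_mem_left _ _ ?_)
    have h6 := congrFun (congrArg (fun A => Matrix.mulVec A
      fun j => (X j : MvPolynomial σ K) ⊗ₜ[K] (1 : MvPolynomial σ K) - 1 ⊗ₜ[K] X j)
      (bezoutian D).adjugate_mul) j
    simp only [← Matrix.mulVec_mulVec, Matrix.smul_mulVec, Matrix.one_mulVec] at h6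
    rw [Pi.smul_apply, smul_eq_mul] at h6
    rw [← h6]
    refine Ideal.sum_mem _ fun i _ => Ideal.mul_mem_left _ _ ?_
    change ∑ j, bezoutian D i j * _ ∈ _
    rw [key]
    exact Ideal.subset_span ⟨i, rfl⟩

/-- Partial evaluation `f ⊗ g ↦ φ f • g` of a functional on the left factor. -/
noncomputable def evalLeft (φ : MvPolynomial σ K →ₗ[K] K) :
    MvPolynomial σ K ⊗[K] MvPolynomial σ K →ₗ[K] MvPolynomial σ K :=
  (TensorProduct.lid K _).toLinearMap ∘ₗ φ.rTensor _

omit [Fintype σ] [DecidableEq σ] in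
theorem evalLeft_tmul (φ : MvPolynomial σ K →ₗ[K] K) (f g : MvPolynomial σ K) :
    evalLeft φ (f ⊗ₜ g) = φ f • g := by
  simp [evalLeft]

omit [Fintype σ] [DecidableEq σ] in
theorem evalLeft_one_tmul_mul (φ : MvPolynomial σ K →ₗ[K] K) (b : MvPolynomial σ K)
    (t : MvPolynomial σ K ⊗[K] MvPolynomial σ K) :
    evalLeft φ ((1 ⊗ₜ b) * t) = b * evalLeft φ t := by
  induction t with
  | zero => simp
  | tmul f g => simp [evalLeft_tmul]
  | add s t hs ht => rw [mul_add, map_add, hs, ht, map_add, mul_add]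

omit [Fintype σ] [DecidableEq σ] in
theorem evalLeft_tmul_one_mul_eq_zero (φ : MvPolynomial σ K →ₗ[K] K) (b : MvPolynomial σ K)
    (hb : ∀ c, φ (b * c) = 0) (t : MvPolynomial σ K ⊗[K] MvPolynomial σ K) :
    evalLeft φ ((b ⊗ₜ 1) * t) = 0 := by
  induction t with
  | zero => simp
  | tmul f g => simp [evalLeft_tmul, hb]
  | add s t hs ht => rw [mul_add, map_add, hs, ht, add_zero]

theorem evalLeft_det_bezoutian (D : Matrix σ σ (MvPolynomial σ K))
    (hdeg : ∀ i j, (D i j).IsHomogeneous 1) (φ : MvPolynomial σ K →ₗ[K] K)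
    (hφ : ∀ d f, d ≠ Fintype.card σ → f.IsHomogeneous d → φ f = 0) (h1 : φ D.det = 1) :
    evalLeft φ (bezoutian D).det = 1 := by
  have e : evalLeft φ (bezoutian D).det = φ D.det • 1 := by
    rw [Matrix.det_apply, Matrix.det_apply, map_sum, map_sum, Finset.sum_smul]
    refine Finset.sum_congr rfl fun τ _ => ?_
    rw [Units.smul_def, Units.smul_def, map_zsmul, map_zsmul, smul_assoc]
    congr 1
    simp only [bezoutian, Matrix.of_apply]
    rw [Finset.prod_add, map_sum]
    have h2 : ∀ s : Finset σ, (∏ i ∈ s, D (τ i) i ⊗ₜ[K] (1 : MvPolynomial σ K)) *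
        ∏ i ∈ Finset.univ \ s, (1 : MvPolynomial σ K) ⊗ₜ[K] D (τ i) i =
        (∏ i ∈ s, D (τ i) i) ⊗ₜ[K] ∏ i ∈ Finset.univ \ s, D (τ i) i := by
      intro s
      have a1 := map_prod (Algebra.TensorProduct.includeLeft :
        MvPolynomial σ K →ₐ[K] MvPolynomial σ K ⊗[K] MvPolynomial σ K) (fun i => D (τ i) i) s
      have a2 := map_prod (Algebra.TensorProduct.includeRight :
        MvPolynomial σ K →ₐ[K] MvPolynomial σ K ⊗[K] MvPolynomial σ K) (fun i => D (τ i) i)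
        (Finset.univ \ s)
      simp only [Algebra.TensorProduct.includeLeft_apply,
        Algebra.TensorProduct.includeRight_apply] at a1 a2
      rw [← a1, ← a2, Algebra.TensorProduct.tmul_mul_tmul, mul_one, one_mul]
    rw [Finset.sum_eq_single Finset.univ]
    · rw [h2, evalLeft_tmul]; simp
    · intro s _ hs
      rw [h2, evalLeft_tmul, hφ s.card _ _ _, zero_smul]
      · intro h
        exact hs ((Finset.card_eq_iff_eq_univ s).1 h)
      · have := MvPolynomial.IsHomogeneous.prod s (fun i => D (τ i) i) (fun _ => 1)
          (fun i _ => hdeg _ _)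
        simpa using this
    · simp
  rw [e, h1, one_smul]

theorem mem_of_forall_functional_mul_eq_zero (D : Matrix σ σ (MvPolynomial σ K))
    (q : σ → MvPolynomial σ K) (hD : ∀ i, ∑ j, D i j * X j = q i)
    (hsymm : ∀ i, ∑ j, D i j ⊗ₜ[K] (X j : MvPolynomial σ K) = ∑ j, X j ⊗ₜ[K] D i j)
    (hdeg : ∀ i j, (D i j).IsHomogeneous 1) (φ : MvPolynomial σ K →ₗ[K] K)
    (hφ : ∀ d f, d ≠ Fintype.card σ → f.IsHomogeneous d → φ f = 0) (h1 : φ D.det = 1)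
    (hJ : ∀ f ∈ Ideal.span (Set.range q), φ f = 0) (b : MvPolynomial σ K)
    (hb : ∀ c, φ (b * c) = 0) : b ∈ Ideal.span (Set.range q) := by
  have h2 : ∀ t ∈ Ideal.span (Set.range fun i => q i ⊗ₜ[K] (1 : MvPolynomial σ K) -
      1 ⊗ₜ[K] q i), evalLeft φ t ∈ Ideal.span (Set.range q) := by
    intro t ht
    rw [Ideal.mem_span_range_iff_exists_fun] at ht
    obtain ⟨c, rfl⟩ := ht
    rw [map_sum]
    refine Ideal.sum_mem _ fun i _ => ?_
    have hq : q i ∈ Ideal.span (Set.range q) := Ideal.subset_span ⟨i, rfl⟩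
    rw [mul_comm, sub_mul, map_sub, evalLeft_one_tmul_mul,
      evalLeft_tmul_one_mul_eq_zero φ (q i) (fun c => hJ _ (Ideal.mul_mem_right _ _ hq)),
      zero_sub]
    exact neg_mem (Ideal.mul_mem_right _ _ hq)
  have h3 := h2 _ (bezoutian_det_mul_sub_mem D q hD hsymm b)
  rw [sub_mul, map_sub, evalLeft_one_tmul_mul, evalLeft_tmul_one_mul_eq_zero φ b hb,
    evalLeft_det_bezoutian D hdeg φ hφ h1, mul_one, zero_sub] at h3
  exact neg_mem_iff.1 h3

end Bezoutian

section Quadrics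

variable {K : Type*} [Field K] {σ : Type*} [Fintype σ] [DecidableEq σ]

/-- The quadrics with coefficient matrices `c i`. -/
noncomputable def quadric (c : σ → σ → σ → K) (i : σ) : MvPolynomial σ K :=
  ∑ j, ∑ k, c i j k • (X j * X k)

/-- The matrix of linear forms `D` with `D * X = quadric c`. -/
noncomputable def polarMatrix (c : σ → σ → σ → K) : Matrix σ σ (MvPolynomial σ K) :=
  Matrix.of fun i j => ∑ k, c i j k • X k

omit [DecidableEq σ] in
theorem polarMatrix_mul_X (c : σ → σ → σ → K) (i : σ) :
    ∑ j, polarMatrix c i j * X j = quadric c i := by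
  simp only [polarMatrix, quadric, Matrix.of_apply, Finset.sum_mul, smul_mul_assoc]
  exact Finset.sum_congr rfl fun j _ => Finset.sum_congr rfl fun k _ => by rw [mul_comm]

omit [DecidableEq σ] in
theorem quadric_isHomogeneous (c : σ → σ → σ → K) (i : σ) : (quadric c i).IsHomogeneous 2 :=
  Submodule.sum_mem (homogeneousSubmodule σ K 2) fun j _ => Submodule.sum_mem _ fun k _ =>
    Submodule.smul_mem _ _ ((isHomogeneous_X K j).mul (isHomogeneous_X K k))

omit [DecidableEq σ] in
theorem polarMatrix_isHomogeneous (c : σ → σ → σ → K) (i j : σ) :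
    (polarMatrix c i j).IsHomogeneous 1 :=
  Submodule.sum_mem (homogeneousSubmodule σ K 1) fun k _ =>
    Submodule.smul_mem _ _ (isHomogeneous_X K k)

omit [DecidableEq σ] in
theorem eval_quadric (c : σ → σ → σ → K) (i : σ) (v : σ → K) :
    eval v (quadric c i) = ∑ j, ∑ k, c i j k * (v j * v k) := by
  simp [quadric, smul_eval]

omit [DecidableEq σ] in
theorem exists_pow_mem_span_quadric [IsAlgClosed K] (c : σ → σ → σ → K)
    (hc : ∀ v : σ → K, (∀ i, eval v (quadric c i) = 0) → v = 0) :
    ∃ N : ℕ, ∀ i : σ, (X i : MvPolynomial σ K) ^ (N + 1) ∈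
      Ideal.span (Set.range (quadric c)) := by
  have h : ∀ i : σ, (X i : MvPolynomial σ K) ∈ (Ideal.span (Set.range (quadric c))).radical := by
    intro i
    rw [← MvPolynomial.vanishingIdeal_zeroLocus_eq_radical (K := K)]
    intro v hv
    have : v = 0 := hc v fun j => by
      have := hv (quadric c j) (Ideal.subset_span ⟨j, rfl⟩)
      rwa [MvPolynomial.aeval_eq_eval] at this
    simp [this]
  choose n hn using h
  refine ⟨∑ i, n i, fun i => ?_⟩
  refine Ideal.pow_mem_of_pow_mem _ (hn i) ?_
  exact (Finset.single_le_sum (fun _ _ => Nat.zero_le _) (Finset.mem_univ i)).trans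
    (Nat.le_succ _)

theorem det_polarMatrix_notMem [IsAlgClosed K] (c : σ → σ → σ → K)
    (hc : ∀ v : σ → K, (∀ i, eval v (quadric c i) = 0) → v = 0) :
    (polarMatrix c).det ∉ Ideal.span (Set.range (quadric c)) := by
  obtain ⟨N, hN⟩ := exists_pow_mem_span_quadric c hc
  simp only [Ideal.mem_span_range_iff_exists_fun] at hN
  choose M hM using hN
  exact det_notMem_span N M _ _ hM (polarMatrix_mul_X c)

omit [DecidableEq σ] in
theorem homogeneousComponent_mem_span_quadric (c : σ → σ → σ → K) (d : ℕ) {f : MvPolynomial σ K}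
    (hf : f ∈ Ideal.span (Set.range (quadric c))) :
    homogeneousComponent d f ∈ Ideal.span (Set.range (quadric c)) := by
  let : GradedAlgebra (homogeneousSubmodule σ K) := MvPolynomial.gradedAlgebra
  have h : (Ideal.span (Set.range (quadric c))).IsHomogeneous (homogeneousSubmodule σ K) := by
    refine Ideal.homogeneous_span _ _ ?_
    rintro _ ⟨i, rfl⟩
    exact ⟨2, quadric_isHomogeneous c i⟩
  exact homogeneousComponent_mem_of_mem h hf d

theorem exists_dualizing_functional [IsAlgClosed K] (c : σ → σ → σ → K)
    (hsymm : ∀ i j k, c i j k = c i k j)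
    (hc : ∀ v : σ → K, (∀ i, eval v (quadric c i) = 0) → v = 0) :
    ∃ φ : MvPolynomial σ K →ₗ[K] K,
      (∀ f ∈ Ideal.span (Set.range (quadric c)), φ f = 0) ∧
      (∀ d f, d ≠ Fintype.card σ → f.IsHomogeneous d → φ f = 0) ∧
      ∀ b, (∀ a, φ (b * a) = 0) → b ∈ Ideal.span (Set.range (quadric c)) := by
  obtain ⟨ψ, hψ, hψJ⟩ := Submodule.exists_le_ker_of_notMem
    (p := (Ideal.span (Set.range (quadric c))).restrictScalars K) (det_polarMatrix_notMem c hc)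
  set d₀ := Fintype.card σ
  have hdet : (polarMatrix c).det.IsHomogeneous d₀ := by
    rw [Matrix.det_apply]
    refine Submodule.sum_mem (homogeneousSubmodule σ K d₀) fun τ _ => ?_
    rw [Units.smul_def]
    refine zsmul_mem ?_ _
    have := MvPolynomial.IsHomogeneous.prod Finset.univ (fun i => polarMatrix c (τ i) i)
      (fun _ => 1) (fun i _ => polarMatrix_isHomogeneous c _ _)
    simpa using this
  set φ : MvPolynomial σ K →ₗ[K] K :=
    (ψ (polarMatrix c).det)⁻¹ • ψ ∘ₗ homogeneousComponent d₀ with hφ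
  have hJ : ∀ f ∈ Ideal.span (Set.range (quadric c)), φ f = 0 := by
    intro f hf
    have : ψ (homogeneousComponent d₀ f) = 0 :=
      hψJ (homogeneousComponent_mem_span_quadric c d₀ hf)
    simp [hφ, this]
  have hd : ∀ d f, d ≠ d₀ → f.IsHomogeneous d → φ f = 0 := by
    intro d f hd hf
    simp [hφ, homogeneousComponent_of_mem hf, hd.symm]
  refine ⟨φ, hJ, hd, fun b hb => mem_of_forall_functional_mul_eq_zero (polarMatrix c)
    (quadric c) (polarMatrix_mul_X c) ?_ (polarMatrix_isHomogeneous c) φ hd ?_ hJ b hb⟩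
  · intro i
    simp only [polarMatrix, Matrix.of_apply, TensorProduct.sum_tmul, TensorProduct.tmul_sum]
    rw [Finset.sum_comm]
    refine Finset.sum_congr rfl fun j _ => Finset.sum_congr rfl fun k _ => ?_
    rw [TensorProduct.smul_tmul, hsymm]
  · simp [hφ, homogeneousComponent_of_mem hdet, hψ]

theorem linearIndependent_quadric [IsAlgClosed K] (c : σ → σ → σ → K)
    (hc : ∀ v : σ → K, (∀ i, eval v (quadric c i) = 0) → v = 0)
    (hsymm : ∀ i j k, c i j k = c i k j) (h2 : (2 : K) ≠ 0) :
    LinearIndependent K (quadric c) := by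
  rw [Fintype.linearIndependent_iff]
  intro g hg
  by_contra! hne
  obtain ⟨i₀, hi₀⟩ := hne
  apply det_polarMatrix_notMem c hc
  have : (polarMatrix c).det = 0 := by
    rw [← Matrix.exists_vecMul_eq_zero_iff]
    refine ⟨fun i => C (g i), fun h => hi₀ ?_, ?_⟩
    · have := congrFun h i₀
      simpa using this
    · funext j
      have h3 := congrArg (pderiv j) hg
      have h4 : ∀ i, pderiv j (quadric c i) = (2 : K) • polarMatrix c i j := by
        intro i
        simp only [quadric, polarMatrix, Matrix.of_apply, map_sum, Derivation.map_smul,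
          Derivation.leibniz, pderiv_X, smul_eq_mul, smul_add, Finset.sum_add_distrib, two_smul]
        congr 1
        · simp only [Pi.single_apply, mul_ite, mul_one, mul_zero, smul_ite, smul_zero,
            Finset.sum_ite_eq', Finset.mem_univ, if_true]
          exact Finset.sum_congr rfl fun k _ => by rw [hsymm]
        · rw [Finset.sum_comm]
          simp only [Pi.single_apply, mul_ite, mul_one, mul_zero, smul_ite, smul_zero,
            Finset.sum_ite_eq', Finset.mem_univ, if_true]
      simp only [map_sum, Derivation.map_smul, h4, map_zero] at h3
      simp_rw [smul_comm (_ : K) (2 : K)] at h3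
      rw [← Finset.smul_sum, smul_eq_zero, or_iff_right h2] at h3
      simp only [Matrix.vecMul, dotProduct, Pi.zero_apply]
      rw [← h3]
      exact Finset.sum_congr rfl fun i _ => by rw [smul_eq_C_mul]
  rw [this]
  exact Ideal.zero_mem _

end Quadrics

section BinaryQuadratics

variable {K : Type*} [Field K] [IsAlgClosed K]

theorem exists_binary_quadratic_eq_zero [NeZero (2 : K)] (a b c : K) :
    ∃ s t : K, (s ≠ 0 ∨ t ≠ 0) ∧ a * s ^ 2 + b * (s * t) + c * t ^ 2 = 0 := by
  by_cases ha : a = 0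
  · exact ⟨1, 0, Or.inl one_ne_zero, by simp [ha]⟩
  · obtain ⟨x, hx⟩ := exists_quadratic_eq_zero (b := b) (c := c) ha (by
      obtain ⟨d, hd⟩ := IsAlgClosed.exists_pow_nat_eq (discrim a b c) (n := 2) two_pos
      exact ⟨d, by rw [← hd, sq]⟩)
    exact ⟨x, 1, Or.inr one_ne_zero, by linear_combination hx⟩

theorem exists_sq_of_mul_eq_sq (a b c : K) (h : a * c = b ^ 2) :
    ∃ s t : K, a = s ^ 2 ∧ b = s * t ∧ c = t ^ 2 := by
  obtain ⟨s, hs⟩ := IsAlgClosed.exists_pow_nat_eq a (n := 2) two_pos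
  obtain ⟨t, ht⟩ := IsAlgClosed.exists_pow_nat_eq c (n := 2) two_pos
  have : (b - s * t) * (b + s * t) = 0 := by
    rw [← hs, ← ht] at h
    linear_combination -h
  rcases mul_eq_zero.mp this with h | h
  · exact ⟨s, t, hs.symm, sub_eq_zero.mp h, ht.symm⟩
  · exact ⟨s, -t, hs.symm, by linear_combination h, by rw [neg_sq, ht]⟩

variable {ι : Type*} {A B C : ι → K}

/-- A system of binary quadratics without a common zero satisfies at most one linear relation
up to scaling. -/
theorem exists_eq_smul_of_apolar [NeZero (2 : K)]
    (h : ∀ s t : K, (∀ i, A i * s ^ 2 + B i * (s * t) + C i * t ^ 2 = 0) → s = 0 ∧ t = 0)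
    (b₀ b₁ b₂ c₀ c₁ c₂ : K) (hb : ∀ i, A i * b₀ + B i * b₁ + C i * b₂ = 0)
    (hc : ∀ i, A i * c₀ + B i * c₁ + C i * c₂ = 0) (hne : ¬(b₀ = 0 ∧ b₁ = 0 ∧ b₂ = 0)) :
    ∃ r : K, c₀ = r * b₀ ∧ c₁ = r * b₁ ∧ c₂ = r * b₂ := by
  obtain ⟨l, m, hlm, hq⟩ := exists_binary_quadratic_eq_zero (b₀ * b₂ - b₁ ^ 2)
    (b₀ * c₂ + c₀ * b₂ - 2 * b₁ * c₁) (c₀ * c₂ - c₁ ^ 2)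
  obtain ⟨s, t, h₀, h₁, h₂⟩ := exists_sq_of_mul_eq_sq (l * b₀ + m * c₀) (l * b₁ + m * c₁)
    (l * b₂ + m * c₂) (by linear_combination hq)
  obtain ⟨rfl, rfl⟩ := h s t fun i => by
    rw [← h₀, ← h₁, ← h₂]
    linear_combination l * hb i + m * hc i
  have hm : m ≠ 0 := by
    rintro rfl
    have hl : l ≠ 0 := by simpa using hlm
    apply hne
    simpa [hl] using And.intro h₀ (And.intro h₁ h₂)
  refine ⟨-l / m, ?_, ?_, ?_⟩
  · field_simp
    linear_combination h₀
  · field_simp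
    linear_combination h₁
  · field_simp
    linear_combination h₂

theorem eq_zero_of_apolar_cubic [NeZero (2 : K)]
    (h : ∀ s t : K, (∀ i, A i * s ^ 2 + B i * (s * t) + C i * t ^ 2 = 0) → s = 0 ∧ t = 0)
    (b₀ b₁ b₂ b₃ : K) (hb : ∀ i, A i * b₀ + B i * b₁ + C i * b₂ = 0)
    (hc : ∀ i, A i * b₁ + B i * b₂ + C i * b₃ = 0) :
    b₀ = 0 ∧ b₁ = 0 ∧ b₂ = 0 ∧ b₃ = 0 := by
  by_cases hne : b₀ = 0 ∧ b₁ = 0 ∧ b₂ = 0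
  · obtain ⟨rfl, rfl, rfl⟩ := hne
    refine ⟨rfl, rfl, rfl, ?_⟩
    by_contra h3
    refine one_ne_zero (h 0 1 fun i => ?_).2
    simpa [h3] using hc i
  · obtain ⟨r, h₁, h₂, h₃⟩ := exists_eq_smul_of_apolar h b₀ b₁ b₂ b₁ b₂ b₃ hb hc hne
    exfalso
    by_cases h0 : b₀ = 0
    · have h1 : b₁ = 0 := by rw [h₁, h0, mul_zero]
      exact hne ⟨h0, h1, by rw [h₂, h1, mul_zero]⟩
    · refine one_ne_zero (h 1 r fun i => ?_).1
      have : b₀ * (A i * 1 ^ 2 + B i * (1 * r) + C i * r ^ 2) = 0 := by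
        rw [h₂, h₁] at hb
        linear_combination hb i
      exact (mul_eq_zero.mp this).resolve_left h0

end BinaryQuadratics

section Annihilators

variable {K R : Type*} [Field K] [CommRing R] [Algebra K R]

/-- The properties of the Jacobian ring of a smooth cubic threefold used in the proof of the strong
Lefschetz property: `G i` are the graded pieces, `φ` is the socle functional, and
`x 0, …, x 4` are generators in degree one subject to quadrics without a common zero. -/
structure IsQuadricGorenstein (G : ℕ → Submodule K R) (φ : R →ₗ[K] K) (x : Fin 5 → R)
    (Q : Fin 5 → Fin 5 → Fin 5 → K) : Prop where
  mul_mem : ∀ {i j : ℕ} {a b : R}, a ∈ G i → b ∈ G j → a * b ∈ G (i + j)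
  succ_le : ∀ i, G (i + 1) ≤ G 1 * G i
  finite : ∀ i, FiniteDimensional K (G i)
  eq_zero_of_pairing : ∀ {i j : ℕ}, i + j = 5 → ∀ a ∈ G i, (∀ b ∈ G j, φ (a * b) = 0) → a = 0
  span_eq : Submodule.span K (Set.range x) = G 1
  linearIndependent : LinearIndependent K x
  finrank_two_le : Module.finrank K (G 2) ≤ 10
  quadric_eq_zero : ∀ i, ∑ j, ∑ k, Q i j k • (x j * x k) = 0
  anisotropic : ∀ p : Fin 5 → K, (∀ i, ∑ j, ∑ k, Q i j k * (p j * p k) = 0) → p = 0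

namespace IsQuadricGorenstein

variable {G : ℕ → Submodule K R} {φ : R →ₗ[K] K} {x : Fin 5 → R}
  {Q : Fin 5 → Fin 5 → Fin 5 → K} (h : IsQuadricGorenstein G φ x Q)
include h

theorem mem_one (i : Fin 5) : x i ∈ G 1 := by
  rw [← h.span_eq]
  exact Submodule.subset_span ⟨i, rfl⟩

theorem finrank_one : Module.finrank K (G 1) = 5 := by
  rw [← h.span_eq, finrank_span_eq_card h.linearIndependent, Fintype.card_fin]

theorem eq_zero_of_forall_mul_eq_zero {j : ℕ} (hj : j ≤ 4) {t : R} (ht : t ∈ G j)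
    (h0 : ∀ v ∈ G 1, v * t = 0) : t = 0 := by
  refine h.eq_zero_of_pairing (j := 4 - j + 1) (by omega) t ht fun b hb => ?_
  have hb := h.succ_le _ hb
  refine Submodule.mul_induction_on hb (fun m hm n _ => ?_) fun a b ha hb => ?_
  · rw [← mul_assoc, mul_comm t m, h0 m hm, zero_mul, map_zero]
  · rw [mul_add, map_add, ha, hb, add_zero]

theorem eq_zero_of_forall_mul_mul_eq_zero {j : ℕ} (hj : j ≤ 3) {t : R} (ht : t ∈ G j)
    (h0 : ∀ v ∈ G 1, ∀ w ∈ G 1, v * (w * t) = 0) : t = 0 :=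
  h.eq_zero_of_forall_mul_eq_zero (hj.trans (by norm_num)) ht fun w hw =>
    h.eq_zero_of_forall_mul_eq_zero (j := 1 + j) (by omega) (h.mul_mem hw ht) fun v hv =>
      h0 v hv w hw

/-- Coordinates on `G 1` modulo a subspace `W`. -/
theorem exists_coordinates {W : Submodule K R} (hW : W ≤ G 1) (n : ℕ)
    (hn : Module.finrank K W + n = 5) :
    ∃ (u : Fin n → R) (s : Fin n → Fin 5 → K), (∀ i, u i ∈ G 1) ∧
      (∀ a : Fin n → K, (∀ j, ∑ i, a i * s i j = 0) → a = 0) ∧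
      (∀ v ∈ G 1, ∃ a : Fin n → K, v - ∑ i, a i • u i ∈ W) ∧
      ∀ j, x j - ∑ i, s i j • u i ∈ W := by
  have := h.finite 1
  have hdim : Module.finrank K (G 1 ⧸ W.submoduleOf (G 1)) = n := by
    have h1 := Submodule.finrank_quotient_add_finrank (W.submoduleOf (G 1))
    have h2 := (Submodule.submoduleOfEquivOfLe hW).finrank_eq
    have := h.finrank_one
    omega
  let b := Module.finBasisOfFinrankEq K _ hdim
  choose u hu using fun i => Submodule.mkQ_surjective (W.submoduleOf (G 1)) (b i)
  have key : ∀ v : G 1, (v : R) - ∑ i, b.repr (Submodule.mkQ _ v) i • (u i : R) ∈ W := by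
    intro v
    have : Submodule.mkQ (W.submoduleOf (G 1)) (v - ∑ i, b.repr (Submodule.mkQ _ v) i • u i)
        = 0 := by
      simp only [map_sub, map_sum, map_smul, hu, b.sum_repr, sub_self]
    rw [Submodule.mkQ_apply, Submodule.Quotient.mk_eq_zero] at this
    simpa using Submodule.mem_comap.mp this
  refine ⟨fun i => u i, fun i j => b.repr (Submodule.mkQ _ ⟨x j, h.mem_one j⟩) i,
    fun i => (u i).2, fun a ha => ?_, fun v hv => ⟨_, key ⟨v, hv⟩⟩,
    fun j => key ⟨x j, h.mem_one j⟩⟩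
  have hf : (∑ i, a i • b.coord i) ∘ₗ Submodule.mkQ (W.submoduleOf (G 1)) = 0 := by
    have hspan : Submodule.span K (Set.range fun j => (⟨x j, h.mem_one j⟩ : G 1)) = ⊤ := by
      apply Submodule.map_injective_of_injective (G 1).injective_subtype
      rw [Submodule.map_span, Submodule.map_top, Submodule.range_subtype, ← Set.range_comp]
      exact h.span_eq
    refine LinearMap.ext_on_range hspan fun j => ?_
    simpa using ha j
  funext i
  have := LinearMap.congr_fun hf (u i)
  simpa [hu, Finsupp.single_apply, -Submodule.mkQ_apply] using this

/-- The quadric relations in terms of coordinates modulo the annihilator of `z`. -/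
theorem mul_sum_quadric_eq_zero {n : ℕ} (u : Fin n → R) (s : Fin n → Fin 5 → K) (z : R)
    (hs : ∀ j, (x j - ∑ i, s i j • u i) * z = 0) (i : Fin 5) :
    ∑ l, ∑ m, (∑ j, ∑ k, Q i j k * (s l j * s m k)) • (u l * (u m * z)) = 0 := by
  have hx : ∀ j, x j * z = ∑ l, s l j • (u l * z) := fun j => by
    have := hs j
    rw [sub_mul, sub_eq_zero] at this
    rw [this, Finset.sum_mul]
    simp_rw [smul_mul_assoc]
  have hxx : ∀ j k, x j * x k * z = ∑ l, ∑ m, (s l j * s m k) • (u l * (u m * z)) := fun j k => by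
    rw [mul_assoc, hx, Finset.mul_sum, Finset.sum_comm]
    refine Finset.sum_congr rfl fun m _ => ?_
    rw [mul_smul_comm, mul_left_comm, hx, Finset.mul_sum, Finset.smul_sum]
    refine Finset.sum_congr rfl fun l _ => ?_
    rw [mul_smul_comm, smul_smul, mul_left_comm, mul_comm (s l j)]
  calc _ = ∑ j, ∑ k, Q i j k • (x j * x k * z) := by
        simp_rw [hxx, Finset.smul_sum, Finset.sum_smul, smul_smul]
        rw [Finset.sum_congr rfl fun l _ => Finset.sum_comm, Finset.sum_comm]
        refine Finset.sum_congr rfl fun j _ => ?_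
        rw [Finset.sum_congr rfl fun l _ => Finset.sum_comm, Finset.sum_comm]
    _ = (∑ j, ∑ k, Q i j k • (x j * x k)) * z := by
        simp_rw [Finset.sum_mul, smul_mul_assoc]
    _ = 0 := by rw [h.quadric_eq_zero, zero_mul]

/-- A nonzero element of degree at most three is killed by no hyperplane of `G 1`. -/
theorem eq_zero_of_finrank_eq_four {j : ℕ} (hj : j ≤ 3) {z : R} (hz : z ∈ G j)
    {W : Submodule K R} (hW : W ≤ G 1) (hWz : ∀ w ∈ W, w * z = 0)
    (hn : Module.finrank K W = 4) : z = 0 := by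
  obtain ⟨u, s, hu, hs, hv, hx⟩ := h.exists_coordinates hW 1 (by rw [hn])
  have hq := h.mul_sum_quadric_eq_zero u s z fun j => hWz _ (hx j)
  simp only [Fin.sum_univ_one] at hq hv
  have huu : u 0 * (u 0 * z) = 0 := by
    by_contra hne
    have h0 := h.anisotropic (s 0) fun i => (smul_eq_zero.mp (hq i)).resolve_right hne
    have := congrFun (hs 1 fun j => by simp [h0]) 0
    simp at this
  have hvz : ∀ v ∈ G 1, ∃ a : K, v * z = a • (u 0 * z) := fun v hv' => by
    obtain ⟨a, ha⟩ := hv v hv'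
    refine ⟨a 0, ?_⟩
    have := hWz _ ha
    rwa [sub_mul, sub_eq_zero, smul_mul_assoc] at this
  refine h.eq_zero_of_forall_mul_mul_eq_zero hj hz fun v hv w hw => ?_
  obtain ⟨a, ha⟩ := hvz v hv
  obtain ⟨b, hb⟩ := hvz w hw
  rw [hb, mul_smul_comm, mul_left_comm, ha, mul_smul_comm, huu, smul_zero, smul_zero]

omit h in
theorem exists_le_finrank_eq {W : Submodule K R} {n : ℕ} (hn : n ≤ Module.finrank K W) :
    ∃ W' ≤ W, Module.finrank K W' = n := by
  obtain ⟨f, hf⟩ := exists_linearIndependent_of_le_finrank hn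
  refine ⟨(Submodule.span K (Set.range f)).map W.subtype, Submodule.map_subtype_le _ _, ?_⟩
  rw [Submodule.finrank_map_subtype_eq, finrank_span_eq_card hf, Fintype.card_fin]

theorem finrank_le_three {j : ℕ} (hj : j ≤ 3) {z : R} (hz : z ∈ G j) (hne : z ≠ 0)
    {W : Submodule K R} (hW : W ≤ G 1) (hWz : ∀ w ∈ W, w * z = 0) :
    Module.finrank K W ≤ 3 := by
  by_contra! hlt
  obtain ⟨W', hle, hW'⟩ := exists_le_finrank_eq (n := 4) hlt
  exact hne (h.eq_zero_of_finrank_eq_four hj hz (hle.trans hW) (fun w hw => hWz w (hle hw)) hW')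

/-- Modulo a three-dimensional space of linear forms the quadrics become binary quadratics without
a common zero. -/
theorem exists_binary_quadratics {W : Submodule K R} (hW : W ≤ G 1)
    (hn : Module.finrank K W = 3) :
    ∃ (u v : R) (A B C : Fin 5 → K), u ∈ G 1 ∧ v ∈ G 1 ∧
      (∀ w ∈ G 1, ∃ a b : K, w - (a • u + b • v) ∈ W) ∧
      (∀ s t : K, (∀ i, A i * s ^ 2 + B i * (s * t) + C i * t ^ 2 = 0) → s = 0 ∧ t = 0) ∧
      ∀ z : R, (∀ w ∈ W, w * z = 0) →
        ∀ i, A i • (u ^ 2 * z) + B i • (u * v * z) + C i • (v ^ 2 * z) = 0 := by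
  obtain ⟨u, s, hu, hs, hv, hx⟩ := h.exists_coordinates hW 2 (by rw [hn])
  refine ⟨u 0, u 1, fun i => ∑ j, ∑ k, Q i j k * (s 0 j * s 0 k),
    fun i => ∑ j, ∑ k, Q i j k * (s 0 j * s 1 k) + ∑ j, ∑ k, Q i j k * (s 1 j * s 0 k),
    fun i => ∑ j, ∑ k, Q i j k * (s 1 j * s 1 k), hu 0, hu 1, fun w hw => ?_, ?_, ?_⟩
  · obtain ⟨a, ha⟩ := hv w hw
    exact ⟨a 0, a 1, by simpa using ha⟩
  · intro a b hab
    have h0 := h.anisotropic (fun j => a * s 0 j + b * s 1 j) fun i => by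
      rw [← hab i]
      simp only [Finset.sum_mul, ← Finset.sum_add_distrib]
      exact Finset.sum_congr rfl fun j _ => Finset.sum_congr rfl fun k _ => by ring
    have := hs ![a, b] fun j => by simpa using congrFun h0 j
    exact ⟨by simpa using congrFun this 0, by simpa using congrFun this 1⟩
  · intro z hz i
    have hq := h.mul_sum_quadric_eq_zero u s z (fun j => hz _ (hx j)) i
    rw [← hq]
    simp only [Fin.sum_univ_two, add_smul]
    rw [show u 1 * (u 0 * z) = u 0 * u 1 * z by ring, show u 0 * (u 1 * z) = u 0 * u 1 * z by ring,
      show u 1 * (u 1 * z) = u 1 ^ 2 * z by ring, show u 0 * (u 0 * z) = u 0 ^ 2 * z by ring]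
    abel

variable [IsAlgClosed K] [CharZero K]

/-- The annihilator in `G 1` of a nonzero element of degree two has dimension at most two. -/
theorem finrank_le_two {z : R} (hz : z ∈ G 2) (hne : z ≠ 0)
    {W : Submodule K R} (hW : W ≤ G 1) (hWz : ∀ w ∈ W, w * z = 0) :
    Module.finrank K W ≤ 2 := by
  by_contra! hlt
  obtain ⟨W', hle, hW'⟩ := exists_le_finrank_eq (n := 3) hlt
  obtain ⟨u, v, A, B, C, hu, hv, hspan, hani, hrel⟩ :=
    h.exists_binary_quadratics (hle.trans hW) hW'
  have hrel := fun y => hrel (y * z) fun w hw => by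
    rw [mul_left_comm, hWz w (hle hw), mul_zero]
  obtain ⟨h₀, h₁, h₂, h₃⟩ := eq_zero_of_apolar_cubic hani (φ (u ^ 3 * z)) (φ (u ^ 2 * v * z))
    (φ (u * v ^ 2 * z)) (φ (v ^ 3 * z))
    (fun i => by
      have := congrArg φ (hrel u i)
      simp only [map_add, map_smul, smul_eq_mul, map_zero] at this
      rw [← this]
      ring_nf)
    (fun i => by
      have := congrArg φ (hrel v i)
      simp only [map_add, map_smul, smul_eq_mul, map_zero] at this
      rw [← this]
      ring_nf)
  have hwz : ∀ w ∈ G 1, ∃ a b : K, ∀ y, w * (y * z) = a • (u * y * z) + b • (v * y * z) :=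
    fun w hw => by
      obtain ⟨a, b, hab⟩ := hspan w hw
      refine ⟨a, b, fun y => ?_⟩
      have := congrArg (y * ·) (hWz _ (hle hab))
      simp only [Algebra.smul_def, mul_zero] at this ⊢
      linear_combination this
  apply hne
  refine h.eq_zero_of_forall_mul_mul_eq_zero (by norm_num) hz fun v₁ hv₁ v₂ hv₂ => ?_
  refine h.eq_zero_of_pairing (i := 4) (j := 1) rfl _
    (h.mul_mem (i := 1) (j := 3) hv₁ (h.mul_mem (i := 1) (j := 2) hv₂ hz)) fun v₃ hv₃ => ?_
  obtain ⟨a₁, b₁, e₁⟩ := hwz v₁ hv₁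
  obtain ⟨a₂, b₂, e₂⟩ := hwz v₂ hv₂
  obtain ⟨a₃, b₃, e₃⟩ := hwz v₃ hv₃
  have key : v₁ * (v₂ * z) * v₃ =
      (a₁ * a₂ * a₃) • (u ^ 3 * z) + (a₁ * a₂ * b₃ + a₁ * b₂ * a₃ + b₁ * a₂ * a₃) • (u ^ 2 * v * z)
      + (a₁ * b₂ * b₃ + b₁ * a₂ * b₃ + b₁ * b₂ * a₃) • (u * v ^ 2 * z)
      + (b₁ * b₂ * b₃) • (v ^ 3 * z) := by
    have f₁ := e₁ (v₂ * v₃)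
    have f₂ := e₂ (u * v₃)
    have f₃ := e₂ (v * v₃)
    have g₁ := e₃ (u ^ 2)
    have g₂ := e₃ (u * v)
    have g₃ := e₃ (v ^ 2)
    simp only [Algebra.smul_def, map_mul, map_add] at *
    linear_combination f₁ + algebraMap K R a₁ * f₂ + algebraMap K R b₁ * f₃
      + algebraMap K R a₁ * algebraMap K R a₂ * g₁
      + (algebraMap K R a₁ * algebraMap K R b₂ + algebraMap K R b₁ * algebraMap K R a₂) * g₂
      + algebraMap K R b₁ * algebraMap K R b₂ * g₃
  rw [key]
  simp [h₀, h₁, h₂, h₃]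

/-- Two elements of degree three killed by a three-dimensional space of linear forms are
proportional. -/
theorem exists_eq_smul {z z' : R} (hz : z ∈ G 3) (hz' : z' ∈ G 3) (hne : z ≠ 0)
    {W : Submodule K R} (hW : W ≤ G 1) (hWz : ∀ w ∈ W, w * z = 0) (hWz' : ∀ w ∈ W, w * z' = 0)
    (hlt : 3 ≤ Module.finrank K W) : ∃ c : K, z' = c • z := by
  obtain ⟨W', hle, hW'⟩ := exists_le_finrank_eq hlt
  obtain ⟨u, v, A, B, C, hu, hv, hspan, hani, hrel⟩ :=
    h.exists_binary_quadratics (hle.trans hW) hW'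
  have hzero : ∀ y ∈ G 3, (∀ w ∈ W, w * y = 0) → φ (u ^ 2 * y) = 0 → φ (u * v * y) = 0 →
      φ (v ^ 2 * y) = 0 → y = 0 := by
    intro y hy hWy h₀ h₁ h₂
    have hwy : ∀ w ∈ G 1, ∃ a b : K, w * y = a • (u * y) + b • (v * y) := fun w hw => by
      obtain ⟨a, b, hab⟩ := hspan w hw
      refine ⟨a, b, ?_⟩
      have := hWy _ (hle hab)
      simp only [Algebra.smul_def] at this ⊢
      linear_combination this
    refine h.eq_zero_of_forall_mul_eq_zero (by norm_num) hy fun v₁ hv₁ => ?_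
    refine h.eq_zero_of_pairing (i := 4) (j := 1) rfl _
      (h.mul_mem (i := 1) (j := 3) hv₁ hy) fun v₂ hv₂ => ?_
    obtain ⟨a₁, b₁, e₁⟩ := hwy v₁ hv₁
    obtain ⟨a₂, b₂, e₂⟩ := hwy v₂ hv₂
    have key : v₁ * y * v₂ = (a₁ * a₂) • (u ^ 2 * y) + (a₁ * b₂ + b₁ * a₂) • (u * v * y)
        + (b₁ * b₂) • (v ^ 2 * y) := by
      simp only [Algebra.smul_def, map_mul, map_add] at *
      linear_combination v₂ * e₁ + (algebraMap K R a₁ * u + algebraMap K R b₁ * v) * e₂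
    rw [key]
    simp [h₀, h₁, h₂]
  have hrel' : ∀ y, (∀ w ∈ W, w * y = 0) →
      ∀ i, A i * φ (u ^ 2 * y) + B i * φ (u * v * y) + C i * φ (v ^ 2 * y) = 0 := fun y hy i => by
    have := congrArg φ (hrel y (fun w hw => hy w (hle hw)) i)
    simpa only [map_add, map_smul, smul_eq_mul, map_zero] using this
  obtain ⟨c, h₀, h₁, h₂⟩ := exists_eq_smul_of_apolar hani _ _ _ _ _ _ (hrel' z hWz)
    (hrel' z' hWz') fun h0 => hne (hzero z hz hWz h0.1 h0.2.1 h0.2.2)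
  refine ⟨c, sub_eq_zero.mp (hzero _ (Submodule.sub_mem _ hz' (Submodule.smul_mem _ c hz))
    (fun w hw => ?_) ?_ ?_ ?_)⟩
  · rw [mul_sub, mul_smul_comm, hWz w hw, hWz' w hw, smul_zero, sub_zero]
  · rw [mul_sub, mul_smul_comm, map_sub, map_smul, h₀, smul_eq_mul, sub_self]
  · rw [mul_sub, mul_smul_comm, map_sub, map_smul, h₁, smul_eq_mul, sub_self]
  · rw [mul_sub, mul_smul_comm, map_sub, map_smul, h₂, smul_eq_mul, sub_self]

end IsQuadricGorenstein

end Annihilators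

section Families

variable {K R σ : Type*} [Field K] [CommRing R] [Algebra K R]

/-- Evaluation of a polynomial over a `K`-algebra at a `K`-rational point. -/
noncomputable def evalAt (R : Type*) [CommRing R] [Algebra K R] (a : σ → K) :
    MvPolynomial σ R →+* R :=
  eval fun i => algebraMap K R (a i)

@[simp]
theorem evalAt_C (a : σ → K) (r : R) : evalAt R a (C r) = r := eval_C r

@[simp]
theorem evalAt_X (a : σ → K) (i : σ) : evalAt R a (X i) = algebraMap K R (a i) := eval_X i

@[simp]
theorem evalAt_map (a : σ → K) (p : MvPolynomial σ K) :
    evalAt R a (map (algebraMap K R) p) = algebraMap K R (eval a p) := by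
  rw [evalAt, eval_map, eval, coe_eval₂Hom]
  exact (hom_eval₂ p (RingHom.id K) (algebraMap K R) a).symm

/-- A linear functional applied to the coefficients of a polynomial. -/
theorem exists_eval_eq (f : MvPolynomial σ R) (ψ : R →ₗ[K] K) :
    ∃ g : MvPolynomial σ K, (∀ m, coeff m g = ψ (coeff m f)) ∧
      ∀ a, eval a g = ψ (evalAt R a f) := by
  classical
  refine ⟨∑ m ∈ f.support, monomial m (ψ (coeff m f)), fun m => ?_, fun a => ?_⟩
  · simp only [coeff_sum, coeff_monomial, Finset.sum_ite_eq', mem_support_iff]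
    split_ifs with h
    · rfl
    · rw [not_not.mp h, map_zero]
  · rw [evalAt, map_sum, eval_eq (f := f), map_sum]
    refine Finset.sum_congr rfl fun m _ => ?_
    rw [eval_monomial, Finsupp.prod]
    simp_rw [← map_pow, ← map_prod]
    rw [mul_comm (coeff m f), ← Algebra.smul_def, map_smul, smul_eq_mul, mul_comm]

theorem exists_ne_zero_of_ne_zero {f : MvPolynomial σ R} (hf : f ≠ 0) :
    ∃ g : MvPolynomial σ K, g ≠ 0 ∧ ∀ a, eval a g ≠ 0 → evalAt R a f ≠ 0 := by
  obtain ⟨m, hm⟩ := MvPolynomial.ne_zero_iff.mp hf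
  obtain ⟨ψ, hψ⟩ : ∃ ψ : R →ₗ[K] K, ψ (coeff m f) ≠ 0 := by
    by_contra! h
    exact hm ((Module.forall_dual_apply_eq_zero_iff K _).mp h)
  obtain ⟨g, hg, hev⟩ := exists_eval_eq f ψ
  refine ⟨g, fun h => hψ ?_, fun a ha h => ha ?_⟩
  · rw [← hg m, h, coeff_zero]
  · rw [hev, h, map_zero]

theorem eq_zero_of_forall_evalAt [Infinite K] {f : MvPolynomial σ R}
    (h : ∀ a : σ → K, evalAt R a f = 0) : f = 0 := by
  by_contra hf
  obtain ⟨g, hg, hev⟩ := exists_ne_zero_of_ne_zero (K := K) hf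
  exact hg (MvPolynomial.funext fun a => by
    by_contra hne
    exact hev a (by simpa using hne) (h a))

theorem exists_evalAt_ne_zero [Infinite K] {f : MvPolynomial σ R} (hf : f ≠ 0) :
    ∃ a : σ → K, evalAt R a f ≠ 0 := by
  by_contra! h
  exact hf (eq_zero_of_forall_evalAt h)

theorem mul_mem_coeffsIn {V W U : Submodule K R} (h : ∀ v ∈ V, ∀ w ∈ W, v * w ∈ U)
    {f g : MvPolynomial σ R} (hf : f ∈ coeffsIn σ V) (hg : g ∈ coeffsIn σ W) :
    f * g ∈ coeffsIn σ U := by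
  classical
  intro m
  rw [coeff_mul]
  exact Submodule.sum_mem _ fun p _ => h _ (hf _) _ (hg _)

theorem pderiv_mem_coeffsIn {V : Submodule K R} (i : σ) {f : MvPolynomial σ R}
    (hf : f ∈ coeffsIn σ V) : pderiv i f ∈ coeffsIn σ V := by
  intro m
  have := nsmul_mem (hf (m + Finsupp.single i 1)) (m i + 1)
  rw [coeff_pderiv, mul_comm]
  simpa [nsmul_eq_mul] using this

theorem evalAt_mem {V : Submodule K R} (a : σ → K) {f : MvPolynomial σ R}
    (hf : f ∈ coeffsIn σ V) : evalAt R a f ∈ V := by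
  rw [evalAt, eval_eq]
  refine Submodule.sum_mem _ fun m _ => ?_
  simp_rw [← map_pow, ← map_prod]
  rw [mul_comm, ← Algebra.smul_def]
  exact Submodule.smul_mem _ _ (hf m)

theorem eq_zero_of_natCast_mul_eq_zero [CharZero K] (n : ℕ) (hn : n ≠ 0) {f : MvPolynomial σ R}
    (h : (n : MvPolynomial σ R) * f = 0) : f = 0 := by
  have hn' : (n : K) ≠ 0 := by exact_mod_cast hn
  have : (n : K) • f = 0 := by rw [← h, Algebra.smul_def, map_natCast]
  exact (smul_eq_zero.mp this).resolve_left hn'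

end Families

namespace IsQuadricGorenstein

variable {K R : Type*} [Field K] [CommRing R] [Algebra K R] {G : ℕ → Submodule K R}
  {φ : R →ₗ[K] K} {x : Fin 5 → R} {Q : Fin 5 → Fin 5 → Fin 5 → K}

/-- The generic linear form. -/
noncomputable def genericForm (x : Fin 5 → R) : MvPolynomial (Fin 5) R := ∑ i, C (x i) * X i

theorem pderiv_genericForm (x : Fin 5 → R) (i : Fin 5) :
    pderiv i (genericForm x) = C (x i) := by
  simp [genericForm, Derivation.leibniz, pderiv_X, Pi.single_apply]

variable (h : IsQuadricGorenstein G φ x Q)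
include h

theorem genericForm_mem : genericForm x ∈ coeffsIn (Fin 5) (G 1) :=
  Submodule.sum_mem _ fun i _ => mul_X_mem_coeffsIn.mpr (C_mem_coeffsIn.mpr (h.mem_one i))

theorem eq_zero_of_forall_C_mul_eq_zero {j : ℕ} (hj : j ≤ 4) {f : MvPolynomial (Fin 5) R}
    (hf : f ∈ coeffsIn (Fin 5) (G j)) (h0 : ∀ i, C (x i) * f = 0) : f = 0 := by
  ext m
  refine h.eq_zero_of_forall_mul_eq_zero hj (hf m) fun v hv => ?_
  rw [← h.span_eq] at hv
  refine Submodule.span_induction ?_ (zero_mul _) (fun v w _ _ hv hw => ?_)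
    (fun a v _ hv => ?_) hv
  · rintro _ ⟨i, rfl⟩
    rw [← coeff_C_mul, h0, coeff_zero]
  · rw [add_mul, hv, hw, add_zero]
  · rw [smul_mul_assoc, hv, smul_zero]

theorem mul_mem' {i j : ℕ} {f g : MvPolynomial (Fin 5) R} (hf : f ∈ coeffsIn (Fin 5) (G i))
    (hg : g ∈ coeffsIn (Fin 5) (G j)) : f * g ∈ coeffsIn (Fin 5) (G (i + j)) :=
  mul_mem_coeffsIn (fun _ ha _ hb => h.mul_mem ha hb) hf hg

/-- Multiplication by a polynomial family `g` of elements of degree `m` on `G i`, where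
`2 i + m = 5`, is either injective at the points of a nonempty open set or has a polynomial family
of kernel elements. -/
theorem injective_or_exists_kernel [Infinite K] {i m : ℕ} (him : i + m + i = 5)
    {g : MvPolynomial (Fin 5) R} (hg : g ∈ coeffsIn (Fin 5) (G m)) :
    (∃ D : MvPolynomial (Fin 5) K, D ≠ 0 ∧ ∀ a, eval a D ≠ 0 →
      ∀ y ∈ G i, evalAt R a g * y = 0 → y = 0) ∨
    ∃ y ∈ coeffsIn (Fin 5) (G i), y ≠ 0 ∧ g * y = 0 := by
  classical
  have := h.finite i
  let e := Module.finBasis K (G i)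
  have hmul : ∀ k l, ∃ p : MvPolynomial (Fin 5) K,
      ∀ a, eval a p = φ (evalAt R a g * (e l : R) * e k) := fun k l => by
    obtain ⟨p, -, hp⟩ := exists_eval_eq (g * C (e l : R) * C (e k : R)) φ
    exact ⟨p, fun a => by rw [hp, RingHom.map_mul, RingHom.map_mul, evalAt_C, evalAt_C]⟩
  choose M hM using hmul
  have hker : ∀ (a : Fin 5 → K) (c : Fin (Module.finrank K (G i)) → K),
      (∀ k, ∑ l, eval a (M k l) * c l = 0) ↔ evalAt R a g * ∑ l, c l • (e l : R) = 0 := by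
    intro a c
    have hφ : ∀ k, ∑ l, eval a (M k l) * c l = φ (evalAt R a g * (∑ l, c l • (e l : R)) * e k) := by
      intro k
      rw [Finset.mul_sum, Finset.sum_mul, map_sum]
      refine Finset.sum_congr rfl fun l _ => ?_
      rw [hM, mul_smul_comm, smul_mul_assoc, map_smul, smul_eq_mul, mul_comm]
    refine ⟨fun h0 => ?_, fun h0 k => by rw [hφ, h0, zero_mul, map_zero]⟩
    refine h.eq_zero_of_pairing (i := m + i) (j := i) (by omega) _ (h.mul_mem (evalAt_mem a hg)
      (Submodule.sum_mem _ fun l _ => Submodule.smul_mem _ _ (e l).2)) fun b hb => ?_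
    have hb' := congrArg Subtype.val (e.sum_repr ⟨b, hb⟩)
    rw [AddSubmonoidClass.coe_finsetSum] at hb'
    simp only [Submodule.coe_smul] at hb'
    rw [← hb', Finset.mul_sum, map_sum]
    refine Finset.sum_eq_zero fun k _ => ?_
    rw [mul_smul_comm, map_smul, ← hφ, h0, smul_zero]
  by_cases hdet : (Matrix.of M).det = 0
  · right
    obtain ⟨p, hp, hMp⟩ := Matrix.exists_mulVec_eq_zero_iff.mpr hdet
    refine ⟨∑ l, C (e l : R) * map (algebraMap K R) (p l), Submodule.sum_mem _ fun l _ m => ?_,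
      fun h0 => ?_, eq_zero_of_forall_evalAt (K := K) fun a => ?_⟩
    · rw [coeff_C_mul, coeff_map, mul_comm, ← Algebra.smul_def]
      exact Submodule.smul_mem _ _ (e l).2
    · refine hp (funext fun l => MvPolynomial.funext fun a => ?_)
      have h1 := congrArg (evalAt R a) h0
      have h2 : ∑ l, eval a (p l) • e l = 0 := by
        apply Subtype.val_injective
        simpa [Algebra.smul_def, mul_comm] using h1
      simpa using Fintype.linearIndependent_iff.mp e.linearIndependent _ h2 l
    · have h1 := (hker a fun l => eval a (p l)).mp fun k => by
        have := congrArg (eval a) (congrFun hMp k)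
        simpa [Matrix.mulVec, dotProduct] using this
      simpa [Algebra.smul_def, mul_comm] using h1
  · left
    refine ⟨_, hdet, fun a ha y hy h0 => ?_⟩
    have hb' := congrArg Subtype.val (e.sum_repr ⟨y, hy⟩)
    rw [AddSubmonoidClass.coe_finsetSum] at hb'
    simp only [Submodule.coe_smul] at hb'
    rw [← hb', ← hker] at h0
    by_contra hne
    apply ha
    rw [RingHom.map_det, ← Matrix.exists_mulVec_eq_zero_iff]
    refine ⟨fun l => e.repr ⟨y, hy⟩ l, fun hz => hne ?_, funext fun k => by
      simpa [Matrix.mulVec, dotProduct] using h0 k⟩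
    rw [← hb']
    exact Finset.sum_eq_zero fun l _ => by rw [show e.repr ⟨y, hy⟩ l = 0 from congrFun hz l, zero_smul]

/-- The linear forms `w` in whose direction the derivative of a family is proportional to the
family. -/
theorem exists_le_six_le {y : R} (hne : y ≠ 0) (y' : Fin 5 → R) :
    ∃ W ≤ G 1, 6 ≤ Module.finrank K W +
        Module.finrank K (Submodule.span K (insert y (Set.range y'))) ∧
      ∀ w ∈ W, ∃ c : K, ∀ p q : R, (∀ i, p * x i + q * y' i = 0) → p * w + c • (q * y) = 0 := by
  set L : (Fin 5 → K) × K →ₗ[K] R :=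
    (Fintype.linearCombination K y').coprod (-(LinearMap.toSpanSingleton K R y)) with hL
  set P : LinearMap.ker L →ₗ[K] R := ((Fintype.linearCombination K x) ∘ₗ
    LinearMap.fst K (Fin 5 → K) K).domRestrict (LinearMap.ker L) with hP
  have hLapp : ∀ v c, L (v, c) = ∑ i, v i • y' i - c • y := fun v c => by
    simp [hL, Fintype.linearCombination_apply, sub_eq_add_neg]
  have hPapp : ∀ p, P p = ∑ i, p.1.1 i • x i := fun p => by
    simp [hP, Fintype.linearCombination_apply]
  have hinj : Function.Injective P := by
    rw [← LinearMap.ker_eq_bot, LinearMap.ker_eq_bot']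
    rintro ⟨⟨v, c⟩, hvc⟩ hv
    rw [hPapp] at hv
    have hv0 : v = 0 := funext (Fintype.linearIndependent_iff.mp h.linearIndependent v hv)
    rw [LinearMap.mem_ker, hLapp, hv0] at hvc
    have hc : c = 0 := by simpa [hne] using hvc
    simp [hv0, hc]
  refine ⟨LinearMap.range P, ?_, ?_, ?_⟩
  · rintro _ ⟨p, rfl⟩
    rw [hPapp]
    exact Submodule.sum_mem _ fun i _ => Submodule.smul_mem _ _ (h.mem_one i)
  · rw [LinearMap.finrank_range_of_inj hinj]
    have h1 := LinearMap.finrank_range_add_finrank_ker L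
    have h2 : Module.finrank K ((Fin 5 → K) × K) = 6 := by simp
    have h3 : LinearMap.range L ≤ Submodule.span K (insert y (Set.range y')) := by
      rintro _ ⟨⟨v, c⟩, rfl⟩
      rw [hLapp]
      exact Submodule.sub_mem _ (Submodule.sum_mem _ fun i _ => Submodule.smul_mem _ _
        (Submodule.subset_span (Set.mem_insert_of_mem _ ⟨i, rfl⟩)))
        (Submodule.smul_mem _ _ (Submodule.subset_span (Set.mem_insert _ _)))
    have : FiniteDimensional K (Submodule.span K (insert y (Set.range y'))) :=
      FiniteDimensional.span_of_finite K ((Set.finite_range y').insert y)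
    have h4 := Submodule.finrank_mono h3
    omega
  · rintro _ ⟨⟨⟨v, c⟩, hvc⟩, rfl⟩
    refine ⟨c, fun p q hpq => ?_⟩
    rw [LinearMap.mem_ker, hLapp, sub_eq_zero] at hvc
    rw [hPapp, ← mul_smul_comm, ← hvc, Finset.mul_sum, Finset.mul_sum, ← Finset.sum_add_distrib]
    refine Finset.sum_eq_zero fun i _ => ?_
    rw [mul_smul_comm, mul_smul_comm, ← smul_add, hpq, smul_zero]

end IsQuadricGorenstein

namespace IsQuadricGorenstein

variable {K R : Type*} [Field K] [CommRing R] [Algebra K R]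
  {G : ℕ → Submodule K R} {φ : R →ₗ[K] K} {x : Fin 5 → R} {Q : Fin 5 → Fin 5 → Fin 5 → K}
  (h : IsQuadricGorenstein G φ x Q)
include h

variable [CharZero K]

/-- If `z` is killed by a family and its derivatives, then many linear forms annihilate the
coefficient `p` of any first-order relation `m * p * x i + q * ∂ᵢ y = 0` with `q * y = 0`. -/
theorem exists_le_forall_mul_eq_zero {y : MvPolynomial (Fin 5) R}
    (hy : y ∈ coeffsIn (Fin 5) (G 1)) {a : Fin 5 → K} (ha : evalAt R a y ≠ 0) {z : R} {n : ℕ}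
    (hz : ∀ T ≤ G 1, (∀ t ∈ T, t * z = 0) → Module.finrank K T ≤ n)
    (hyz : evalAt R a y * z = 0) (hy'z : ∀ i, evalAt R a (pderiv i y) * z = 0) :
    ∃ W ≤ G 1, 6 ≤ Module.finrank K W + n ∧ ∀ w ∈ W,
      ∀ (m : ℕ) (p q : MvPolynomial (Fin 5) R), m ≠ 0 →
      (∀ i, (m : MvPolynomial (Fin 5) R) * p * C (x i) + q * pderiv i y = 0) → q * y = 0 → w * evalAt R a p = 0 := by
  obtain ⟨W, hW, hdim, hrel⟩ := h.exists_le_six_le ha fun i => evalAt R a (pderiv i y)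
  have hT := hz (Submodule.span K (insert (evalAt R a y)
      (Set.range fun i => evalAt R a (pderiv i y)))) (by
    rw [Submodule.span_le, Set.insert_subset_iff, Set.range_subset_iff]
    exact ⟨evalAt_mem a hy, fun i => evalAt_mem a (pderiv_mem_coeffsIn i hy)⟩) fun w hw => by
    refine Submodule.span_induction ?_ (zero_mul _) (fun v w _ _ hv hw => ?_)
      (fun a v _ hv => ?_) hw
    · rintro v (rfl | ⟨i, rfl⟩)
      exacts [hyz, hy'z i]
    · rw [add_mul, hv, hw, add_zero]
    · rw [smul_mul_assoc, hv, smul_zero]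
  refine ⟨W, hW, by omega, fun w hw m p q hm hpq hqy => ?_⟩
  obtain ⟨c, hc⟩ := hrel w hw
  have := hc (evalAt R a (m * p)) (evalAt R a q) fun i => by
    have := congrArg (evalAt R a) (hpq i)
    rwa [map_add, map_mul _ _ (C _), map_mul _ q, evalAt_C, map_zero] at this
  rw [← map_mul, hqy, map_zero, smul_zero, add_zero, map_mul, map_natCast, mul_assoc,
    mul_comm _ w, ← map_natCast (algebraMap K R), ← Algebra.smul_def] at this
  exact (smul_eq_zero.mp this).resolve_left (by exact_mod_cast hm)

variable [IsAlgClosed K]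

theorem sq_ne_zero_of_cube_mul_eq_zero {y : MvPolynomial (Fin 5) R}
    (hy : y ∈ coeffsIn (Fin 5) (G 1)) (hy0 : y ≠ 0) (h3 : genericForm x ^ 3 * y = 0) :
    y ^ 2 ≠ 0 := by
  intro hyy
  set g := genericForm x with hg
  have hgm : g ∈ coeffsIn (Fin 5) (G 1) := h.genericForm_mem
  have hgym : g * y ∈ coeffsIn (Fin 5) (G 2) := h.mul_mem' hgm hy
  have hggym : g ^ 2 * y ∈ coeffsIn (Fin 5) (G 3) := by
    rw [sq, mul_assoc]
    exact h.mul_mem' hgm hgym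
  have hdg : ∀ i, pderiv i g = C (x i) := pderiv_genericForm x
  have hyd : ∀ i, y * pderiv i y = 0 := fun i => by
    have := congrArg (pderiv i) hyy
    simp only [Derivation.leibniz_pow, map_zero, smul_eq_mul, nsmul_eq_mul] at this
    refine eq_zero_of_natCast_mul_eq_zero (K := K) 2 two_ne_zero ?_
    linear_combination this
  have hW : ∀ a : Fin 5 → K, evalAt R a y ≠ 0 → ∃ W ≤ G 1, 4 ≤ Module.finrank K W ∧
      ∀ w ∈ W, ∀ (m : ℕ) (p q : MvPolynomial (Fin 5) R), m ≠ 0 →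
        (∀ i, (m : MvPolynomial (Fin 5) R) * p * C (x i) + q * pderiv i y = 0) → q * y = 0 → w * evalAt R a p = 0 := by
    intro a ha
    obtain ⟨v, hv, hvy⟩ : ∃ v ∈ G 1, v * evalAt R a y ≠ 0 := by
      by_contra! h0
      exact ha (h.eq_zero_of_forall_mul_eq_zero (by norm_num) (evalAt_mem a hy) h0)
    obtain ⟨W, hW, hdim, hrel⟩ := h.exists_le_forall_mul_eq_zero hy ha (n := 2)
      (fun T hT hTz => h.finrank_le_two (h.mul_mem (i := 1) (j := 1) hv (evalAt_mem a hy)) hvy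
        hT hTz)
      (by rw [mul_left_comm, ← sq, ← map_pow, hyy, map_zero, mul_zero])
      (fun i => by rw [mul_comm, mul_assoc, ← map_mul, hyd, map_zero, mul_zero])
    exact ⟨W, hW, by omega, hrel⟩
  have h2 : g ^ 2 * y = 0 := by
    refine eq_zero_of_forall_evalAt (K := K) fun a => ?_
    by_cases ha : evalAt R a y = 0
    · rw [map_mul, ha, mul_zero]
    obtain ⟨W, hW, hdim, hrel⟩ := hW a ha
    by_contra hne
    have := h.finrank_le_three (j := 3) le_rfl (evalAt_mem a hggym) hne hW fun w hw => by
      refine hrel w hw 3 _ (g ^ 3) (by norm_num) (fun i => ?_) h3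
      have := congrArg (pderiv i) h3
      simp only [Derivation.leibniz, Derivation.leibniz_pow, hdg, map_zero, smul_eq_mul,
        nsmul_eq_mul] at this
      linear_combination this
    omega
  have h1 : g * y = 0 := by
    refine eq_zero_of_forall_evalAt (K := K) fun a => ?_
    by_cases ha : evalAt R a y = 0
    · rw [map_mul, ha, mul_zero]
    obtain ⟨W, hW, hdim, hrel⟩ := hW a ha
    by_contra hne
    have := h.finrank_le_two (evalAt_mem a hgym) hne hW fun w hw => by
      refine hrel w hw 2 _ (g ^ 2) (by norm_num) (fun i => ?_) h2
      have := congrArg (pderiv i) h2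
      simp only [Derivation.leibniz, Derivation.leibniz_pow, hdg, map_zero, smul_eq_mul,
        nsmul_eq_mul] at this
      linear_combination this
    omega
  have hrel1 : ∀ i, ((1 : ℕ) : MvPolynomial (Fin 5) R) * y * C (x i) + g * pderiv i y = 0 := fun i => by
    have := congrArg (pderiv i) h1
    simp only [Derivation.leibniz, hdg, map_zero, smul_eq_mul] at this
    rw [Nat.cast_one]
    linear_combination this
  obtain ⟨a, ha⟩ := exists_evalAt_ne_zero (K := K) hy0
  obtain ⟨W, hW, hdim, hrel⟩ := hW a ha
  refine ha (h.eq_zero_of_forall_mul_eq_zero (by norm_num) (evalAt_mem a hy) fun v hv => ?_)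
  by_contra hne
  have := h.finrank_le_two (h.mul_mem (i := 1) (j := 1) hv (evalAt_mem a hy)) hne hW
    fun w hw => by rw [mul_left_comm, hrel w hw 1 y g one_ne_zero hrel1 h1, mul_zero]
  omega

/-- The generic cube `g ^ 3` has no kernel on families in `G 1`. -/
theorem eq_zero_of_cube_mul_eq_zero {y : MvPolynomial (Fin 5) R}
    (hy : y ∈ coeffsIn (Fin 5) (G 1)) (h3 : genericForm x ^ 3 * y = 0) : y = 0 := by
  by_contra hy0
  have hy2 := h.sq_ne_zero_of_cube_mul_eq_zero hy hy0 h3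
  set g := genericForm x with hg
  have hgm : g ∈ coeffsIn (Fin 5) (G 1) := h.genericForm_mem
  have hyym : y ^ 2 ∈ coeffsIn (Fin 5) (G 2) := by
    rw [sq]
    exact h.mul_mem' hy hy
  have hyyym : y ^ 3 ∈ coeffsIn (Fin 5) (G 3) := by
    rw [pow_succ]
    exact h.mul_mem' hyym hy
  have hgyym : g * y ^ 2 ∈ coeffsIn (Fin 5) (G 3) := h.mul_mem' hgm hyym
  have hdg : ∀ i, pderiv i g = C (x i) := pderiv_genericForm x
  have d3 : ∀ i, 3 * g ^ 2 * y * C (x i) + g ^ 3 * pderiv i y = 0 := fun i => by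
    have := congrArg (pderiv i) h3
    simp only [Derivation.leibniz, Derivation.leibniz_pow, hdg, map_zero, smul_eq_mul,
      nsmul_eq_mul] at this
    linear_combination this
  have h22 : g ^ 2 * y ^ 2 = 0 := by
    refine h.eq_zero_of_forall_C_mul_eq_zero (j := 4) le_rfl ?_ fun i => ?_
    · rw [sq g, mul_assoc]
      exact h.mul_mem' hgm hgyym
    · refine eq_zero_of_natCast_mul_eq_zero (K := K) 3 three_ne_zero ?_
      linear_combination y * d3 i - pderiv i y * h3
  have d2 : ∀ i, g * y ^ 2 * C (x i) + g ^ 2 * y * pderiv i y = 0 := fun i => by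
    have := congrArg (pderiv i) h22
    simp only [Derivation.leibniz, Derivation.leibniz_pow, map_zero, smul_eq_mul,
      nsmul_eq_mul, hdg] at this
    refine eq_zero_of_natCast_mul_eq_zero (K := K) 2 two_ne_zero ?_
    linear_combination this
  have h13 : g * y ^ 3 = 0 := by
    refine h.eq_zero_of_forall_C_mul_eq_zero (j := 4) le_rfl (h.mul_mem' hgm hyyym) fun i => ?_
    linear_combination y * d2 i - pderiv i y * h22
  have d1 : ∀ i, ((1 : ℕ) : MvPolynomial (Fin 5) R) * y ^ 3 * C (x i) + 3 * g * y ^ 2 * pderiv i y = 0 := fun i => by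
    have := congrArg (pderiv i) h13
    simp only [Derivation.leibniz, Derivation.leibniz_pow, map_zero, smul_eq_mul,
      nsmul_eq_mul, hdg] at this
    rw [Nat.cast_one]
    linear_combination this
  have d1' := d1
  simp only [Nat.cast_one] at d1'
  have h04 : y ^ 4 = 0 := by
    refine h.eq_zero_of_forall_C_mul_eq_zero (j := 4) le_rfl ?_ fun i => ?_
    · rw [pow_succ]
      exact h.mul_mem' hyyym hy
    · linear_combination y * d1' i - 3 * pderiv i y * h13
  have d0 : ∀ i, y ^ 3 * pderiv i y = 0 := fun i => by
    have := congrArg (pderiv i) h04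
    simp only [Derivation.leibniz_pow, map_zero, smul_eq_mul, nsmul_eq_mul] at this
    refine eq_zero_of_natCast_mul_eq_zero (K := K) 4 four_ne_zero ?_
    linear_combination this
  have hy3 : y ^ 3 ≠ 0 := by
    intro h03
    have d0' : ∀ i, y ^ 2 * pderiv i y = 0 := fun i => by
      have := congrArg (pderiv i) h03
      simp only [Derivation.leibniz_pow, map_zero, smul_eq_mul, nsmul_eq_mul] at this
      refine eq_zero_of_natCast_mul_eq_zero (K := K) 3 three_ne_zero ?_
      linear_combination this
    have hW : ∀ a : Fin 5 → K, evalAt R a (y ^ 2) ≠ 0 → ∃ W ≤ G 1, 4 ≤ Module.finrank K W ∧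
        ∀ w ∈ W, ∀ (m : ℕ) (p q : MvPolynomial (Fin 5) R), m ≠ 0 →
          (∀ i, (m : MvPolynomial (Fin 5) R) * p * C (x i) + q * pderiv i y = 0) → q * y = 0 → w * evalAt R a p = 0 := by
      intro a ha
      have ha1 : evalAt R a y ≠ 0 := fun h0 => ha (by rw [map_pow, h0, zero_pow two_ne_zero])
      obtain ⟨W, hW, hdim, hrel⟩ := h.exists_le_forall_mul_eq_zero hy ha1 (n := 2)
        (fun T hT hTz => h.finrank_le_two (evalAt_mem a hyym) ha hT hTz)
        (by rw [← map_mul, ← pow_succ', h03, map_zero])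
        (fun i => by rw [← map_mul, mul_comm, d0', map_zero])
      exact ⟨W, hW, by omega, hrel⟩
    have h12 : g * y ^ 2 = 0 := by
      refine eq_zero_of_forall_evalAt (K := K) fun a => ?_
      by_cases ha : evalAt R a (y ^ 2) = 0
      · rw [map_mul, ha, mul_zero]
      obtain ⟨W, hW, hdim, hrel⟩ := hW a ha
      by_contra hne
      have := h.finrank_le_three (j := 3) le_rfl (evalAt_mem a hgyym) hne hW fun w hw =>
        hrel w hw 1 _ (g ^ 2 * y) one_ne_zero (fun i => by
          rw [Nat.cast_one]
          linear_combination d2 i) (by linear_combination h22)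
      omega
    obtain ⟨a, ha⟩ := exists_evalAt_ne_zero (K := K) hy2
    obtain ⟨W, hW, hdim, hrel⟩ := hW a ha
    have := h.finrank_le_two (evalAt_mem a hyym) ha hW fun w hw =>
      hrel w hw 1 _ (2 * g * y) one_ne_zero (fun i => by
        have := congrArg (pderiv i) h12
        simp only [Derivation.leibniz, Derivation.leibniz_pow, map_zero, smul_eq_mul,
          nsmul_eq_mul, hdg] at this
        linear_combination this) (by linear_combination 2 * h12)
    omega
  obtain ⟨a, ha⟩ := exists_evalAt_ne_zero (K := K) hy3
  have ha1 : evalAt R a y ≠ 0 := fun h0 => ha (by rw [map_pow, h0, zero_pow three_ne_zero])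
  obtain ⟨W, hW, hdim, hrel⟩ := h.exists_le_forall_mul_eq_zero hy ha1 (n := 3)
    (fun T hT hTz => h.finrank_le_three le_rfl (evalAt_mem a hyyym) ha hT hTz)
    (by rw [← map_mul, ← pow_succ', h04, map_zero])
    (fun i => by rw [← map_mul, mul_comm, d0, map_zero])
  obtain ⟨c, hc⟩ := h.exists_eq_smul (evalAt_mem a hyyym) (evalAt_mem a hgyym) ha hW
    (fun w hw => hrel w hw 1 _ _ one_ne_zero d1 (by linear_combination 3 * h13))
    (fun w hw => hrel w hw 1 _ (g ^ 2 * y) one_ne_zero (fun i => by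
      rw [Nat.cast_one]
      linear_combination d2 i) (by linear_combination h22)) (by omega)
  refine ha (h.eq_zero_of_forall_mul_eq_zero (j := 3) (by norm_num) (evalAt_mem a hyyym)
    fun v hv => ?_)
  rw [← h.span_eq] at hv
  refine Submodule.span_induction ?_ (zero_mul _) (fun v w _ _ hv hw => ?_)
    (fun b v _ hv => ?_) hv
  · rintro _ ⟨i, rfl⟩
    have e1 := congrArg (evalAt R a) (d1 i)
    have e2 := congrArg (evalAt R a) (d0 i)
    rw [map_mul, map_zero] at e2
    rw [show 3 * g * y ^ 2 * pderiv i y = 3 * (g * y ^ 2) * pderiv i y by ring, Nat.cast_one,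
      one_mul, map_add, map_mul, map_mul, map_mul _ 3, hc, evalAt_C, map_zero] at e1
    rw [Algebra.smul_def] at e1
    linear_combination e1 - evalAt R a 3 * algebraMap K R c * e2
  · rw [add_mul, hv, hw, add_zero]
  · rw [smul_mul_assoc, hv, smul_zero]

end IsQuadricGorenstein

namespace IsQuadricGorenstein

variable {K R : Type*} [Field K] [CommRing R] [Algebra K R]
  {G : ℕ → Submodule K R} {φ : R →ₗ[K] K} {x : Fin 5 → R} {Q : Fin 5 → Fin 5 → Fin 5 → K}
  (h : IsQuadricGorenstein G φ x Q)
include h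

/-- The annihilators of `z ∈ G 2` in degrees one and two have complementary dimensions. -/
theorem finrank_annihilator_le {z : R} (hz : z ∈ G 2) {N A : Submodule K R} (hN : N ≤ G 2)
    (hNz : ∀ t ∈ N, z * t = 0) (hA : ∀ u ∈ G 1, u * z = 0 → u ∈ A) (hfin : FiniteDimensional K A) :
    Module.finrank K N ≤ 5 + Module.finrank K A := by
  have := h.finite 1
  have := h.finite 2
  let f : G 1 →ₗ[K] Module.Dual K (G 2) := LinearMap.mk₂ K (fun u t => φ (u * z * t))
    (fun u v t => by simp [add_mul]) (fun c u t => by simp) (fun u s t => by simp [mul_add])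
    (fun c u t => by simp)
  have hf : ∀ u t, f u t = φ (u * z * t) := fun _ _ => rfl
  have h1 := LinearMap.finrank_range_add_finrank_ker f
  rw [h.finrank_one] at h1
  have hker : Module.finrank K (LinearMap.ker f) ≤ Module.finrank K A := by
    rw [← Submodule.finrank_map_subtype_eq]
    refine Submodule.finrank_mono ?_
    rintro _ ⟨u, hu, rfl⟩
    refine hA _ u.2 (h.eq_zero_of_pairing (i := 3) (j := 2) rfl _
      (h.mul_mem (i := 1) (j := 2) u.2 hz) fun t ht => ?_)
    exact LinearMap.congr_fun (LinearMap.mem_ker.mp hu) ⟨t, ht⟩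
  have hrange : LinearMap.range f ≤ (N.submoduleOf (G 2)).dualAnnihilator := by
    rintro _ ⟨u, rfl⟩
    rw [Submodule.mem_dualAnnihilator]
    intro t ht
    rw [hf, mul_assoc, hNz t (Submodule.mem_comap.mp ht), mul_zero, map_zero]
  have h2 := Submodule.finrank_mono hrange
  have h3 := Subspace.finrank_add_finrank_dualAnnihilator_eq (N.submoduleOf (G 2))
  have h4 := (Submodule.submoduleOfEquivOfLe hN).finrank_eq
  have h5 := h.finrank_two_le
  omega

theorem finrank_annihilator_ge {g z : R} (hg : g ∈ G 1) (hz : z ∈ G 2) (hz0 : z ≠ 0)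
    {z' : Fin 5 → R} (hz' : ∀ i, z' i ∈ G 2) (hinj : ∀ y ∈ G 1, g ^ 3 * y = 0 → y = 0)
    (hgz : g * z = 0) (hzz : z * z = 0) (hzz' : ∀ i, z * z' i = 0)
    (hd : ∀ i, x i * z + g * z' i = 0) {N A : Submodule K R}
    (hN : ∀ t ∈ G 2, z * t = 0 → t ∈ N) (hA : ∀ u ∈ G 1, u * z = 0 → u ∈ A)
    (hNfin : FiniteDimensional K N) (hAfin : FiniteDimensional K A) :
    11 ≤ Module.finrank K N + Module.finrank K A := by
  have := h.finite 1
  set L : G 1 × ((Fin 5 → K) × K) →ₗ[K] R :=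
    (LinearMap.mulLeft K g ∘ₗ (G 1).subtype).coprod
      ((Fintype.linearCombination K z').coprod (LinearMap.toSpanSingleton K R z)) with hL
  have hLapp : ∀ w v c, L (w, v, c) = g * w + (∑ i, v i • z' i + c • z) := fun w v c => by
    simp [hL, Fintype.linearCombination_apply]
  set P : LinearMap.ker L →ₗ[K] R := ((Fintype.linearCombination K x) ∘ₗ
    LinearMap.fst K (Fin 5 → K) K ∘ₗ LinearMap.snd K (G 1) _).domRestrict (LinearMap.ker L) with hP
  have hPapp : ∀ p, P p = ∑ i, p.1.2.1 i • x i := fun p => by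
    simp [hP, Fintype.linearCombination_apply]
  have hsum : ∀ v : Fin 5 → K, (∑ i, v i • x i) * z + g * ∑ i, v i • z' i = 0 := fun v => by
    rw [Finset.sum_mul, Finset.mul_sum, ← Finset.sum_add_distrib]
    refine Finset.sum_eq_zero fun i _ => ?_
    rw [mul_smul_comm, smul_mul_assoc, ← smul_add, hd, smul_zero]
  have hker : ∀ (w : G 1) (v : Fin 5 → K) (c : K), L (w, v, c) = 0 →
      w = 0 ∧ (∑ i, v i • x i) * z = 0 := by
    intro w v c h0
    rw [hLapp, Algebra.smul_def c] at h0
    have hw : (w : R) = 0 := hinj w w.2 (by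
      linear_combination g ^ 2 * h0 - g * hsum v + ((∑ i, v i • x i) -
        g * algebraMap K R c) * hgz)
    refine ⟨Subtype.ext hw, ?_⟩
    linear_combination hsum v - g * h0 + g * g * hw + algebraMap K R c * hgz
  have hPinj : Function.Injective P := by
    rw [injective_iff_map_eq_zero]
    rintro ⟨⟨w, v, c⟩, hp⟩ hv
    rw [hPapp] at hv
    obtain rfl : v = 0 := funext (Fintype.linearIndependent_iff.mp h.linearIndependent v hv)
    obtain ⟨rfl, -⟩ := hker w _ c hp
    have hc : c = 0 := by simpa [hLapp, hz0] using hp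
    simp [hc]
  have hLN : LinearMap.range L ≤ N := by
    rintro _ ⟨⟨w, v, c⟩, rfl⟩
    rw [hLapp]
    refine N.add_mem (hN _ (h.mul_mem hg w.2) ?_)
      (N.add_mem (N.sum_mem fun i _ => N.smul_mem _ (hN _ (hz' i) (hzz' i)))
        (N.smul_mem _ (hN _ hz hzz)))
    linear_combination (w : R) * hgz
  have hPA : LinearMap.range P ≤ A := by
    rintro _ ⟨⟨⟨w, v, c⟩, hp⟩, rfl⟩
    rw [hPapp]
    exact hA _ (Submodule.sum_mem _ fun i _ => Submodule.smul_mem _ _ (h.mem_one i))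
      (hker w v c hp).2
  have h1 := LinearMap.finrank_range_add_finrank_ker L
  have h2 : Module.finrank K (G 1 × ((Fin 5 → K) × K)) = 11 := by
    simp [h.finrank_one]
  have h3 := Submodule.finrank_mono hLN
  have h4 := Submodule.finrank_mono hPA
  rw [LinearMap.finrank_range_of_inj hPinj] at h4
  omega

variable [IsAlgClosed K] [CharZero K]

/-- The generic linear form has no kernel on families in `G 2`. -/
theorem eq_zero_of_mul_eq_zero {z : MvPolynomial (Fin 5) R} (hz : z ∈ coeffsIn (Fin 5) (G 2))
    (h1 : genericForm x * z = 0) : z = 0 := by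
  by_contra hz0
  set g := genericForm x with hg
  have hgm : g ∈ coeffsIn (Fin 5) (G 1) := h.genericForm_mem
  have hd : ∀ i, C (x i) * z + g * pderiv i z = 0 := fun i => by
    have := congrArg (pderiv i) h1
    simp only [Derivation.leibniz, map_zero, smul_eq_mul] at this
    rw [pderiv_genericForm] at this
    linear_combination this
  have hzz : z ^ 2 = 0 := by
    refine h.eq_zero_of_forall_C_mul_eq_zero (j := 4) le_rfl ?_ fun i => ?_
    · rw [sq]
      exact h.mul_mem' hz hz
    · linear_combination z * hd i - pderiv i z * h1
  have hzd : ∀ i, z * pderiv i z = 0 := fun i => by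
    have := congrArg (pderiv i) hzz
    simp only [Derivation.leibniz_pow, map_zero, smul_eq_mul, nsmul_eq_mul] at this
    refine eq_zero_of_natCast_mul_eq_zero (K := K) 2 two_ne_zero ?_
    linear_combination this
  have hgggm : g ^ 3 ∈ coeffsIn (Fin 5) (G 3) := by
    rw [show g ^ 3 = g * (g * g) by ring]
    exact h.mul_mem' (i := 1) (j := 2) hgm (h.mul_mem' (i := 1) (j := 1) hgm hgm)
  obtain ⟨D, hD, hDinj⟩ := (h.injective_or_exists_kernel (i := 1) (m := 3) rfl hgggm).resolve_right
    fun ⟨y, hy, hy0, h3⟩ => hy0 (h.eq_zero_of_cube_mul_eq_zero hy h3)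
  obtain ⟨E, hE, hEz⟩ := exists_ne_zero_of_ne_zero (K := K) hz0
  obtain ⟨a, ha⟩ : ∃ a, eval a (D * E) ≠ 0 := by
    by_contra! h0
    exact mul_ne_zero hD hE (MvPolynomial.funext fun a => by rw [h0, map_zero])
  rw [map_mul, mul_ne_zero_iff] at ha
  have hza := hEz a ha.2
  have hzam := evalAt_mem a hz
  let μ := LinearMap.mulLeft K (evalAt R a z)
  have := h.finite 1
  have := h.finite 2
  have hNfin : FiniteDimensional K ↥(G 2 ⊓ LinearMap.ker μ) :=
    Submodule.finiteDimensional_of_le inf_le_left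
  have hAfin : FiniteDimensional K ↥(G 1 ⊓ LinearMap.ker μ) :=
    Submodule.finiteDimensional_of_le inf_le_left
  have hA : ∀ u ∈ G 1, u * evalAt R a z = 0 → u ∈ G 1 ⊓ LinearMap.ker μ :=
    fun u hu hu0 => ⟨hu, by rwa [mul_comm] at hu0⟩
  have e1 := h.finrank_annihilator_le hzam (N := G 2 ⊓ LinearMap.ker μ) inf_le_left
    (fun t ht => ht.2) hA hAfin
  have e2 := h.finrank_annihilator_ge (evalAt_mem a hgm) hzam hza
    (z' := fun i => evalAt R a (pderiv i z)) (fun i => evalAt_mem a (pderiv_mem_coeffsIn i hz))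
    (fun y hy hy0 => hDinj a ha.1 y hy (by rwa [map_pow]))
    (by rw [← map_mul, h1, map_zero])
    (by rw [← map_mul, ← sq, hzz, map_zero])
    (fun i => by rw [← map_mul, hzd, map_zero])
    (fun i => by
      have := congrArg (evalAt R a) (hd i)
      rwa [map_add, map_mul, map_mul, evalAt_C, map_zero] at this)
    (N := G 2 ⊓ LinearMap.ker μ) (fun t ht ht0 => ⟨ht, ht0⟩) hA hNfin hAfin
  have e3 := h.finrank_le_two hzam hza (W := G 1 ⊓ LinearMap.ker μ) inf_le_left
    fun w hw => by rw [mul_comm]; exact hw.2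
  omega

omit [IsAlgClosed K] [CharZero K] in
theorem finrank_le_finrank {i j : ℕ} (hij : i + j = 5) :
    Module.finrank K (G i) ≤ Module.finrank K (G j) := by
  have := h.finite j
  have := h.finite i
  let f : G i →ₗ[K] Module.Dual K (G j) := LinearMap.mk₂ K (fun u t => φ (u * t))
    (fun u v t => by simp [add_mul]) (fun c u t => by simp) (fun u s t => by simp [mul_add])
    (fun c u t => by simp)
  have hf : Function.Injective f := by
    rw [← LinearMap.ker_eq_bot, LinearMap.ker_eq_bot']
    exact fun u hu => Subtype.ext (h.eq_zero_of_pairing hij _ u.2 fun b hb =>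
      LinearMap.congr_fun hu ⟨b, hb⟩)
  rw [← Subspace.dual_finrank_eq (V := G j)]
  exact LinearMap.finrank_le_finrank_of_injective hf

omit [IsAlgClosed K] [CharZero K] in
theorem exists_mul_eq {i m j : ℕ} (hmi : m + i = j) (hij : i + j = 5) {g : R} (hg : g ∈ G m)
    (hinj : ∀ y ∈ G i, g * y = 0 → y = 0) : ∀ z ∈ G j, ∃ y ∈ G i, g * y = z := by
  have := h.finite j
  have := h.finite i
  have hmem : ∀ y ∈ G i, LinearMap.mulLeft K g y ∈ G j := fun y hy => by
    rw [← hmi]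
    exact h.mul_mem hg hy
  have hf : Function.Injective ((LinearMap.mulLeft K g).restrict hmem) := by
    rw [← LinearMap.ker_eq_bot, LinearMap.ker_eq_bot']
    exact fun y hy => Subtype.ext (hinj _ y.2 (congrArg Subtype.val hy))
  have hs := (LinearMap.injective_iff_surjective_of_finrank_eq_finrank
    (le_antisymm (h.finrank_le_finrank hij) (h.finrank_le_finrank (by omega)))).mp hf
  intro z hz
  obtain ⟨y, hy⟩ := hs ⟨z, hz⟩
  exact ⟨y, y.2, congrArg Subtype.val hy⟩

theorem exists_strongLefschetz : ∃ g ∈ G 1,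
    ((∀ y ∈ G 1, g ^ 3 * y = 0 → y = 0) ∧ (∀ z ∈ G 4, ∃ y ∈ G 1, g ^ 3 * y = z)) ∧
      ((∀ y ∈ G 2, g * y = 0 → y = 0) ∧ (∀ z ∈ G 3, ∃ y ∈ G 2, g * y = z)) := by
  have hgm : genericForm x ∈ coeffsIn (Fin 5) (G 1) := h.genericForm_mem
  have hgggm : genericForm x ^ 3 ∈ coeffsIn (Fin 5) (G 3) := by
    rw [show genericForm x ^ 3 = genericForm x * (genericForm x * genericForm x) by ring]
    exact h.mul_mem' (i := 1) (j := 2) hgm (h.mul_mem' (i := 1) (j := 1) hgm hgm)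
  obtain ⟨D, hD, hDinj⟩ := (h.injective_or_exists_kernel (i := 1) (m := 3) rfl hgggm).resolve_right
    fun ⟨y, hy, hy0, h3⟩ => hy0 (h.eq_zero_of_cube_mul_eq_zero hy h3)
  obtain ⟨E, hE, hEinj⟩ := (h.injective_or_exists_kernel (i := 2) (m := 1) rfl hgm).resolve_right
    fun ⟨z, hz, hz0, h1⟩ => hz0 (h.eq_zero_of_mul_eq_zero hz h1)
  obtain ⟨a, ha⟩ : ∃ a, eval a (D * E) ≠ 0 := by
    by_contra! h0
    exact mul_ne_zero hD hE (MvPolynomial.funext fun a => by rw [h0, map_zero])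
  rw [map_mul, mul_ne_zero_iff] at ha
  have i1 := hDinj a ha.1
  have i2 := hEinj a ha.2
  have s1 := h.exists_mul_eq (i := 1) (m := 3) (j := 4) rfl rfl (evalAt_mem a hgggm) i1
  have s2 := h.exists_mul_eq (i := 2) (m := 1) (j := 3) rfl rfl (evalAt_mem a hgm) i2
  rw [map_pow] at i1 s1
  exact ⟨_, evalAt_mem a hgm, ⟨i1, s1⟩, i2, s2⟩

end IsQuadricGorenstein

section JacobianRing

variable {K : Type*} [Field K]

theorem pderiv_pderiv_comm {σ : Type*} (i j : σ) (f : MvPolynomial σ K) :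
    pderiv i (pderiv j f) = pderiv j (pderiv i f) := by
  classical
  have h : ⁅pderiv (R := K) i, pderiv (R := K) j⁆ = 0 := by
    refine derivation_ext fun k => ?_
    simp only [Derivation.commutator_apply, pderiv_X, Pi.single_apply, Derivation.zero_apply]
    split_ifs <;> simp
  exact sub_eq_zero.mp ((Derivation.commutator_apply ..).symm.trans (DFunLike.congr_fun h f))

/-- The coefficients of the partial derivatives of a cubic form. -/
noncomputable def cubicCoeff {σ : Type*} (F : MvPolynomial σ K) (i j k : σ) : K :=
  2⁻¹ * coeff 0 (pderiv k (pderiv j (pderiv i F)))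

theorem cubicCoeff_swap {σ : Type*} (F : MvPolynomial σ K) (i j k : σ) :
    cubicCoeff F i j k = cubicCoeff F i k j := by
  rw [cubicCoeff, pderiv_pderiv_comm, cubicCoeff]

theorem quadric_cubicCoeff {σ : Type*} [Fintype σ] [CharZero K] {F : MvPolynomial σ K}
    (hF : F.IsHomogeneous 3) (i : σ) : quadric (cubicCoeff F) i = pderiv i F := by
  have h1 : (pderiv i F).IsHomogeneous 2 := hF.pderiv
  have h2 : ∀ j, (pderiv j (pderiv i F)).IsHomogeneous 1 := fun j => h1.pderiv
  have h3 : ∀ j k, pderiv k (pderiv j (pderiv i F)) =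
      C (coeff 0 (pderiv k (pderiv j (pderiv i F)))) := fun j k =>
    totalDegree_eq_zero_iff_eq_C.mp (Nat.le_zero.mp (h2 j).pderiv.totalDegree_le)
  have e2 : ∀ j, ∑ k, coeff 0 (pderiv k (pderiv j (pderiv i F))) • X k =
      pderiv j (pderiv i F) := fun j => by
    have := (h2 j).sum_X_mul_pderiv
    rw [one_smul] at this
    refine .trans (Finset.sum_congr rfl fun k _ => ?_) this
    rw [smul_eq_C_mul, ← h3, mul_comm]
  have e1 := h1.sum_X_mul_pderiv
  calc quadric (cubicCoeff F) i
      = (2⁻¹ : K) • ∑ j, X j * ∑ k, coeff 0 (pderiv k (pderiv j (pderiv i F))) • X k := by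
        simp only [quadric, cubicCoeff, Finset.smul_sum, Finset.mul_sum, mul_smul, mul_smul_comm]
    _ = pderiv i F := by
        simp only [e2]
        rw [e1, ← Nat.cast_smul_eq_nsmul K, smul_smul, Nat.cast_ofNat, inv_mul_cancel₀ two_ne_zero,
          one_smul]

theorem gradedPiece_mul_mem {n : ℕ} {I : Ideal (MvPolynomial (Fin n) K)} {i j : ℕ}
    {a b : MvPolynomial (Fin n) K ⧸ I} (ha : a ∈ gradedPiece I i) (hb : b ∈ gradedPiece I j) :
    a * b ∈ gradedPiece I (i + j) := by
  obtain ⟨f, hf, rfl⟩ := ha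
  obtain ⟨g, hg, rfl⟩ := hb
  exact ⟨f * g, IsHomogeneous.mul hf hg, map_mul (Ideal.Quotient.mkₐ K I) f g⟩

theorem gradedPiece_succ {n : ℕ} (I : Ideal (MvPolynomial (Fin n) K)) (i : ℕ) :
    gradedPiece I (i + 1) = gradedPiece I 1 * gradedPiece I i := by
  rw [gradedPiece, gradedPiece, gradedPiece, ← homogeneousSubmodule_one_pow (σ := Fin n) (R := K) (i + 1),
    pow_succ', homogeneousSubmodule_one_pow]
  exact Submodule.map_mul _ _ (Ideal.Quotient.mkₐ K I)

theorem finiteDimensional_gradedPiece {n : ℕ} (I : Ideal (MvPolynomial (Fin n) K)) (i : ℕ) :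
    FiniteDimensional K (gradedPiece I i) :=
  Module.Finite.iff_fg.mpr ((homogeneousSubmodule_fg (σ := Fin n) (R := K) i).map _)

theorem span_gradedPiece_one {n : ℕ} (I : Ideal (MvPolynomial (Fin n) K)) :
    Submodule.span K (Set.range fun i => Ideal.Quotient.mk I (X i)) = gradedPiece I 1 := by
  rw [gradedPiece, homogeneousSubmodule_one_eq_span_X, Submodule.map_span, ← Set.range_comp]
  rfl

theorem finrank_homogeneousSubmodule_two_le (n : ℕ) :
    Module.finrank K (homogeneousSubmodule (Fin n) K 2) ≤ Fintype.card (Sym2 (Fin n)) := by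
  let f : Sym2 (Fin n) → MvPolynomial (Fin n) K :=
    Sym2.lift ⟨fun j k => X j * X k, fun j k => mul_comm _ _⟩
  have h : homogeneousSubmodule (Fin n) K 2 ≤ Submodule.span K (Set.range f) := by
    rw [← homogeneousSubmodule_one_pow, sq, homogeneousSubmodule_one_eq_span_X,
      Submodule.span_mul_span]
    refine Submodule.span_mono ?_
    rintro _ ⟨_, ⟨j, rfl⟩, _, ⟨k, rfl⟩, rfl⟩
    exact ⟨s(j, k), rfl⟩
  have := FiniteDimensional.span_of_finite K (Set.finite_range f)
  exact (Submodule.finrank_mono h).trans (finrank_range_le_card f)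

theorem linearIndependent_mk_X {n : ℕ} (c : Fin n → Fin n → Fin n → K) :
    LinearIndependent K fun i => Ideal.Quotient.mk (Ideal.span (Set.range (quadric c))) (X i) := by
  rw [Fintype.linearIndependent_iff]
  intro g hg i
  have hmem : ∑ i, C (g i) * X i ∈ Ideal.span (Set.range (quadric c)) := by
    rw [← Ideal.Quotient.eq_zero_iff_mem, map_sum, ← hg]
    refine Finset.sum_congr rfl fun i _ => ?_
    rw [← smul_eq_C_mul]
    rfl
  have hle : Ideal.span (Set.range (quadric c)) ≤ idealOfVars (Fin n) K ^ 2 := by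
    rw [Ideal.span_le]
    rintro _ ⟨i, rfl⟩
    refine (mem_pow_idealOfVars_iff _ _).mpr fun m hm => ?_
    rw [← quadric_isHomogeneous c i (mem_support_iff.mp hm), Finsupp.degree_eq_weight_one]
    rfl
  by_contra hi
  have := (mem_pow_idealOfVars_iff _ _).mp (hle hmem) (Finsupp.single i 1) (by
    simpa [coeff_sum, coeff_C_mul, coeff_X, Finsupp.single_left_inj] using hi)
  simp at this

variable [IsAlgClosed K] [CharZero K]

theorem finrank_gradedPiece_two_le (c : Fin 5 → Fin 5 → Fin 5 → K)
    (hsymm : ∀ i j k, c i j k = c i k j)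
    (hc : ∀ v : Fin 5 → K, (∀ i, eval v (quadric c i) = 0) → v = 0) :
    Module.finrank K (gradedPiece (Ideal.span (Set.range (quadric c))) 2) ≤ 10 := by
  set J := Ideal.span (Set.range (quadric c)) with hJ
  have : FiniteDimensional K (homogeneousSubmodule (Fin 5) K 2) :=
    Module.Finite.iff_fg.mpr (homogeneousSubmodule_fg (σ := Fin 5) (R := K) 2)
  set f := (Ideal.Quotient.mkₐ K J).toLinearMap.domRestrict (homogeneousSubmodule (Fin 5) K 2)
    with hf
  have h1 := LinearMap.finrank_range_add_finrank_ker f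
  rw [hf, LinearMap.range_domRestrict, ← hf] at h1
  let q : Fin 5 → LinearMap.ker f := fun i =>
    ⟨⟨quadric c i, quadric_isHomogeneous c i⟩,
      Ideal.Quotient.eq_zero_iff_mem.mpr (Ideal.subset_span ⟨i, rfl⟩)⟩
  have hq : LinearIndependent K q :=
    LinearIndependent.of_comp ((homogeneousSubmodule (Fin 5) K 2).subtype ∘ₗ
      (LinearMap.ker f).subtype) (linearIndependent_quadric c hc hsymm two_ne_zero)
  have h2 := hq.fintype_card_le_finrank
  have h3 := finrank_homogeneousSubmodule_two_le (K := K) 5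
  have h4 : Fintype.card (Sym2 (Fin 5)) = 15 := by rw [Sym2.card, Fintype.card_fin]; rfl
  rw [Fintype.card_fin] at h2
  rw [gradedPiece]
  omega

theorem exists_isQuadricGorenstein (c : Fin 5 → Fin 5 → Fin 5 → K)
    (hsymm : ∀ i j k, c i j k = c i k j)
    (hc : ∀ v : Fin 5 → K, (∀ i, eval v (quadric c i) = 0) → v = 0) :
    ∃ φ, IsQuadricGorenstein (gradedPiece (Ideal.span (Set.range (quadric c)))) φ
      (fun i => Ideal.Quotient.mk (Ideal.span (Set.range (quadric c))) (X i)) c := by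
  obtain ⟨φ, hφJ, hφd, hφ⟩ := exists_dualizing_functional c hsymm hc
  set J := Ideal.span (Set.range (quadric c)) with hJ
  refine ⟨(J.restrictScalars K).liftQ φ hφJ ∘ₗ
    (Submodule.Quotient.restrictScalarsEquiv K J).symm.toLinearMap, ?_⟩
  exact {
    mul_mem := gradedPiece_mul_mem
    succ_le := fun i => (gradedPiece_succ J i).le
    finite := finiteDimensional_gradedPiece J
    eq_zero_of_pairing := by
      rintro i j hij _ ⟨f, hf, rfl⟩ h0
      refine Ideal.Quotient.eq_zero_iff_mem.mpr (hφ f fun a => ?_)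
      rw [← sum_homogeneousComponent a, Finset.mul_sum, map_sum]
      refine Finset.sum_eq_zero fun d _ => ?_
      have ha := homogeneousComponent_isHomogeneous d a
      by_cases hd : d = j
      · subst hd
        exact h0 _ ⟨_, ha, rfl⟩
      · exact hφd (i + d) _ (by rw [Fintype.card_fin]; omega) (IsHomogeneous.mul hf ha)
    span_eq := span_gradedPiece_one J
    linearIndependent := linearIndependent_mk_X c
    finrank_two_le := finrank_gradedPiece_two_le c hsymm hc
    quadric_eq_zero := fun i => by
      have h : Ideal.Quotient.mkₐ K J (quadric c i) = 0 :=
        Ideal.Quotient.eq_zero_iff_mem.mpr (Ideal.subset_span ⟨i, rfl⟩)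
      simp only [quadric, map_sum, map_smul, map_mul] at h
      exact h
    anisotropic := fun p hp => hc p fun i => by rw [eval_quadric, hp] }

end JacobianRing

end StrongLefschetz

/-- **Strong Lefschetz for the Jacobian ring of a smooth cubic threefold.** Let `F` be a
homogeneous cubic in `K[x₀,…,x₄]` (char `K = 0`, algebraically closed) whose partial
derivatives have no common zero but the origin, and let `R = S/J(F)` be the Jacobian ring.
Then there is `x ∈ R¹` with `x³· : R¹ → R⁴` and `x· : R² → R³` both isomorphisms. -/
theorem slp_jacobian_ring_smooth_cubic_threefold
    {K : Type*} [Field K] [IsAlgClosed K] [CharZero K]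
    {F : MvPolynomial (Fin 5) K} (hF : F.IsHomogeneous 3)
    (hsm : ∀ v : Fin 5 → K,
      (∀ i, MvPolynomial.eval v (MvPolynomial.pderiv i F) = 0) → v = 0)
    (J : Ideal (MvPolynomial (Fin 5) K))
    (hJ : J = Ideal.span (Set.range fun i => MvPolynomial.pderiv i F)) :
    ∃ x ∈ gradedPiece J 1,
      ((∀ y ∈ gradedPiece J 1, x ^ 3 * y = 0 → y = 0) ∧
        (∀ z ∈ gradedPiece J 4, ∃ y ∈ gradedPiece J 1, x ^ 3 * y = z)) ∧
      ((∀ y ∈ gradedPiece J 2, x * y = 0 → y = 0) ∧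
        (∀ z ∈ gradedPiece J 3, ∃ y ∈ gradedPiece J 2, x * y = z)) := by
  have hQ : quadric (cubicCoeff F) = fun i => MvPolynomial.pderiv i F :=
    funext (quadric_cubicCoeff hF)
  rw [← hQ] at hJ
  subst hJ
  obtain ⟨φ, h⟩ := exists_isQuadricGorenstein (cubicCoeff F) (cubicCoeff_swap F)
    fun v hv => hsm v fun i => by rw [← hv i, hQ]
  exact h.exists_strongLefschetz
end
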